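/- arXiv:2507.05059 — 2 statements merged into one kernel-verified Lean document; each statement's English description precedes it below -/
import Mathlib

section
/- There is a constant C = C(μ, δ, η) such that for every n ∈ ℤ∖{0}: (i) for every f ∈ 𝒞^δ_0, the function g = L_{n,−}^{−1}f is differentiable on (0,∞), the function β ↦ −βg'(β) + inβ g(β) extends to an element of 𝒞^δ_0, and ‖−βg' + inβg‖_{𝒞^δ} ≤ C‖f‖_{𝒞^δ}; (ii) for every g ∈ 𝒞^δ_0 which is differentiable on (0,∞) and such that β ↦ −βg'(β) + inβ g(β) extends to an element of 𝒞^δ_0, one has ‖L_{n,+}^{−1}(−βg' + inβg)‖_{𝒞^δ} ≤ C‖g‖_{𝒞^δ}. -/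
open Filter Topology Set MeasureTheory intervalIntegral

/-- sup norm over `[0,∞)`. -/
noncomputable def supN (f : ℝ → ℂ) : ℝ := ⨆ β : Ici (0 : ℝ), ‖f (β : ℝ)‖

/-- sup norm over `(0,∞)`. -/
noncomputable def supNIoi (f : ℝ → ℂ) : ℝ := ⨆ β : Ioi (0 : ℝ), ‖f (β : ℝ)‖

/-- weighted seminorm `sup_{β>0} β^δ ‖f(β) − L‖`. -/
noncomputable def hoel (δ : ℝ) (f : ℝ → ℂ) (L : ℂ) : ℝ :=
  ⨆ β : Ioi (0 : ℝ), (β : ℝ) ^ δ * ‖f (β : ℝ) - L‖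

/-- the `𝒞^δ` norm, with `L = f(∞)`. -/
noncomputable def normC (δ : ℝ) (f : ℝ → ℂ) (L : ℂ) : ℝ := supN f + hoel δ f L

/-- membership in `𝒞^δ`, with limit value `L` at infinity. -/
def MemCdelta (δ : ℝ) (f : ℝ → ℂ) (L : ℂ) : Prop :=
  ContinuousOn f (Ici 0) ∧ Tendsto f atTop (nhds L) ∧
    BddAbove (Set.range fun β : Ioi (0 : ℝ) => (β : ℝ) ^ δ * ‖f (β : ℝ) - L‖)

/-- `a_n(β) = √(n²μ² − (2μ−1)η(β))`. -/
noncomputable def aFun (μ : ℝ) (η : ℝ → ℝ) (n : ℤ) (β : ℝ) : ℝ :=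
  Real.sqrt ((n : ℝ) ^ 2 * μ ^ 2 - (2 * μ - 1) * η β)

/-- `W_n(β) = exp(∫_1^β a_n(b)/b db)`. -/
noncomputable def WFun (μ : ℝ) (η : ℝ → ℝ) (n : ℤ) (β : ℝ) : ℝ :=
  Real.exp (∫ b in (1 : ℝ)..β, aFun μ η n b / b)

/-- `L_{n,+}^{-1}`. -/
noncomputable def Lplus (μ : ℝ) (η : ℝ → ℝ) (n : ℤ) (f : ℝ → ℂ) (β : ℝ) : ℂ :=
  ((β ^ (2 * μ - 1) * WFun μ η n β : ℝ) : ℂ) *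
    ∫ b in Ioi β, ((b ^ (-(2 * μ)) / WFun μ η n b : ℝ) : ℂ) *
      Complex.exp (Complex.I * (n : ℂ) * ((β : ℂ) - (b : ℂ))) * f b

/-- `L_{n,-}^{-1}`. -/
noncomputable def Lminus (μ : ℝ) (η : ℝ → ℝ) (n : ℤ) (f : ℝ → ℂ) (β : ℝ) : ℂ :=
  if 2 ≤ |n| then
    -(((β ^ (2 * μ - 1) / WFun μ η n β : ℝ) : ℂ) *
      ∫ b in (0 : ℝ)..β, ((b ^ (-(2 * μ)) * WFun μ η n b : ℝ) : ℂ) *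
        Complex.exp (Complex.I * (n : ℂ) * ((β : ℂ) - (b : ℂ))) * f b)
  else
    ((β ^ (2 * μ - 1) / WFun μ η n β : ℝ) : ℂ) *
      ∫ b in Ioi β, ((b ^ (-(2 * μ)) * WFun μ η n b : ℝ) : ℂ) *
        Complex.exp (Complex.I * (n : ℂ) * ((β : ℂ) - (b : ℂ))) * f b

/-- the operator `g ↦ −βg' + inβg` (i.e. `\hat D_ρ g`). -/
noncomputable def Drho (n : ℤ) (g : ℝ → ℂ) (β : ℝ) : ℂ :=
  -(β : ℂ) * deriv g β + Complex.I * (n : ℂ) * (β : ℂ) * g β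

/-! ### Weights with bounded logarithmic slope -/

/-- `p` is positive on `(0,∞)` and `k` is its logarithmic slope `β p'(β) / p(β)`. -/
structure IsLogSlope (p k : ℝ → ℝ) : Prop where
  pos : ∀ β, 0 < β → 0 < p β
  hasDerivAt : ∀ β, 0 < β → HasDerivAt p (p β * k β / β) β

namespace IsLogSlope

variable {p k : ℝ → ℝ} {c : ℝ}

lemma continuousOn (h : IsLogSlope p k) : ContinuousOn p (Ioi 0) :=
  fun β hβ => (h.hasDerivAt β hβ).continuousAt.continuousWithinAt

lemma hasDerivAt_mul_rpow (h : IsLogSlope p k) {β : ℝ} (hβ : 0 < β) :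
    HasDerivAt (fun x => p x * x ^ (-c)) (p β * β ^ (-c) * (k β - c) / β) β := by
  convert! (h.hasDerivAt β hβ).mul
    (Real.hasDerivAt_rpow_const (p := -c) (Or.inl hβ.ne')) using 1
  rw [Real.rpow_sub_one hβ.ne']
  field_simp
  ring

lemma monotoneOn_mul_rpow (h : IsLogSlope p k) (hk : ∀ β, 0 < β → c ≤ k β) :
    MonotoneOn (fun x => p x * x ^ (-c)) (Ioi 0) := by
  refine monotoneOn_of_deriv_nonneg (convex_Ioi 0)
    (fun β hβ => (h.hasDerivAt_mul_rpow hβ).continuousAt.continuousWithinAt)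
    (fun β hβ => (h.hasDerivAt_mul_rpow
      (interior_subset hβ)).differentiableAt.differentiableWithinAt) ?_
  intro β hβ
  rw [interior_Ioi] at hβ
  rw [(h.hasDerivAt_mul_rpow hβ).deriv]
  have := h.pos β hβ
  have := hk β hβ
  have : 0 < β ^ (-c) := Real.rpow_pos_of_pos hβ _
  have h0 : (0 : ℝ) < β := hβ
  have : 0 ≤ k β - c := by linarith
  positivity

lemma antitoneOn_mul_rpow (h : IsLogSlope p k) (hk : ∀ β, 0 < β → k β ≤ c) :
    AntitoneOn (fun x => p x * x ^ (-c)) (Ioi 0) := by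
  refine antitoneOn_of_deriv_nonpos (convex_Ioi 0)
    (fun β hβ => (h.hasDerivAt_mul_rpow hβ).continuousAt.continuousWithinAt)
    (fun β hβ => (h.hasDerivAt_mul_rpow
      (interior_subset hβ)).differentiableAt.differentiableWithinAt) ?_
  intro β hβ
  rw [interior_Ioi] at hβ
  rw [(h.hasDerivAt_mul_rpow hβ).deriv]
  have := h.pos β hβ
  have := hk β hβ
  have : 0 < β ^ (-c) := Real.rpow_pos_of_pos hβ _
  have h0 : (0 : ℝ) < β := hβ
  have h1 : 0 ≤ c - k β := by linarith
  have h2 : 0 ≤ p β * β ^ (-c) * (c - k β) / β := by positivity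
  have h3 : p β * β ^ (-c) * (k β - c) / β = -(p β * β ^ (-c) * (c - k β) / β) := by ring
  linarith

lemma comp_mul_le_of_le_one (h : IsLogSlope p k) (hk : ∀ β, 0 < β → c ≤ k β)
    {β t : ℝ} (hβ : 0 < β) (ht : 0 < t) (ht1 : t ≤ 1) : p (β * t) ≤ p β * t ^ c := by
  have hm := h.monotoneOn_mul_rpow hk (mul_pos hβ ht : β * t ∈ Ioi 0) hβ
    (by nlinarith : β * t ≤ β)
  simp only [Real.rpow_neg (mul_pos hβ ht).le, Real.rpow_neg hβ.le,
    Real.mul_rpow hβ.le ht.le] at hm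
  have h1 : 0 < β ^ c := Real.rpow_pos_of_pos hβ _
  have h2 : 0 < t ^ c := Real.rpow_pos_of_pos ht _
  field_simp at hm
  linarith

lemma comp_mul_le_of_one_le (h : IsLogSlope p k) (hk : ∀ β, 0 < β → k β ≤ c)
    {β t : ℝ} (hβ : 0 < β) (ht1 : 1 ≤ t) : p (β * t) ≤ p β * t ^ c := by
  have ht : 0 < t := by linarith
  have hm := h.antitoneOn_mul_rpow hk hβ (mul_pos hβ ht : β * t ∈ Ioi 0)
    (by nlinarith : β ≤ β * t)
  simp only [Real.rpow_neg (mul_pos hβ ht).le, Real.rpow_neg hβ.le,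
    Real.mul_rpow hβ.le ht.le] at hm
  have h1 : 0 < β ^ c := Real.rpow_pos_of_pos hβ _
  have h2 : 0 < t ^ c := Real.rpow_pos_of_pos ht _
  field_simp at hm
  linarith

end IsLogSlope

/-! ### Power integrals on the two half-lines cut at `1` -/

lemma integrableOn_Ioc_zero_one_rpow {c : ℝ} (hc : 0 < c) :
    IntegrableOn (fun t : ℝ => t ^ (c - 1)) (Ioc 0 1) :=
  (intervalIntegrable_iff_integrableOn_Ioc_of_le zero_le_one).1
    (intervalIntegral.intervalIntegrable_rpow' (by linarith))

lemma setIntegral_Ioc_zero_one_rpow {c : ℝ} (hc : 0 < c) :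
    ∫ t in Ioc (0 : ℝ) 1, t ^ (c - 1) = 1 / c := by
  rw [← intervalIntegral.integral_of_le zero_le_one, integral_rpow (Or.inl (by linarith))]
  simp [Real.zero_rpow hc.ne']

lemma integrableOn_Ioi_one_rpow {c : ℝ} (hc : c < 0) :
    IntegrableOn (fun t : ℝ => t ^ (c - 1)) (Ioi 1) :=
  integrableOn_Ioi_rpow_of_lt (by linarith) one_pos

lemma setIntegral_Ioi_one_rpow {c : ℝ} (hc : c < 0) :
    ∫ t in Ioi (1 : ℝ), t ^ (c - 1) = -(1 / c) := by
  rw [integral_Ioi_rpow_of_lt (by linarith) one_pos]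
  simp [neg_div]

/-! ### The weighted averages `∫_S p(βt) / (p(β) t) e^{inβ(1-t)} f(βt) dt` -/

/-- The integrand of the weighted average of `f` in the scaled variable `t = b / β`. -/
noncomputable def scaledKernel (p : ℝ → ℝ) (n : ℤ) (f : ℝ → ℂ) (β t : ℝ) : ℂ :=
  ((p (β * t) / (p β * t) : ℝ) : ℂ) *
    Complex.exp (Complex.I * (n : ℂ) * ((β : ℂ) - ((β * t : ℝ) : ℂ))) * f (β * t)

lemma norm_exp_I_mul_int_mul_sub (n : ℤ) (x y : ℝ) :
    ‖Complex.exp (Complex.I * (n : ℂ) * ((x : ℂ) - (y : ℂ)))‖ = 1 := by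
  rw [Complex.norm_exp]
  simp

section scaledKernel

variable {p : ℝ → ℝ} {n : ℤ} {f : ℝ → ℂ} {S : Set ℝ} {d e M β : ℝ}

lemma norm_scaledKernel_le (hp : ∀ β, 0 < β → 0 < p β) (hβ : 0 < β) {t : ℝ} (ht : 0 < t)
    (hpd : p (β * t) ≤ p β * t ^ d) (hf : ∀ b, 0 < b → ‖f b‖ ≤ M * b ^ (-e)) :
    ‖scaledKernel p n f β t‖ ≤ M * β ^ (-e) * t ^ (d - e - 1) := by
  have hp0 := hp β hβ
  have hbt := mul_pos hβ ht
  have hp1 := hp _ hbt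
  rw [scaledKernel, norm_mul, norm_mul, norm_exp_I_mul_int_mul_sub, mul_one,
    Complex.norm_real, Real.norm_of_nonneg (by positivity)]
  have h1 : p (β * t) / (p β * t) ≤ t ^ d / t := by
    rw [div_le_div_iff₀ (by positivity) ht]
    nlinarith
  calc p (β * t) / (p β * t) * ‖f (β * t)‖
      ≤ t ^ d / t * (M * (β * t) ^ (-e)) :=
        mul_le_mul h1 (hf _ hbt) (norm_nonneg _) (by positivity)
    _ = M * β ^ (-e) * t ^ (d - e - 1) := by
        rw [Real.mul_rpow hβ.le ht.le, Real.rpow_sub_one ht.ne', sub_eq_add_neg,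
          Real.rpow_add ht]
        ring

lemma norm_setIntegral_scaledKernel_le (hS : MeasurableSet S) (hS0 : S ⊆ Ioi 0)
    (hp : ∀ β, 0 < β → 0 < p β) (hβ : 0 < β) (hpd : ∀ t ∈ S, p (β * t) ≤ p β * t ^ d)
    (hf : ∀ b, 0 < b → ‖f b‖ ≤ M * b ^ (-e))
    (hint : IntegrableOn (fun t : ℝ => t ^ (d - e - 1)) S) :
    ‖∫ t in S, scaledKernel p n f β t‖ ≤ M * β ^ (-e) * ∫ t in S, t ^ (d - e - 1) := by
  rw [← MeasureTheory.integral_const_mul]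
  refine MeasureTheory.norm_integral_le_of_norm_le (hint.const_mul _) ?_
  filter_upwards [ae_restrict_mem hS] with t ht
  exact norm_scaledKernel_le hp hβ (hS0 ht) (hpd t ht) hf

lemma continuousOn_scaledKernel (hp : ∀ β, 0 < β → 0 < p β) (hpc : ContinuousOn p (Ioi 0))
    (hfc : ContinuousOn f (Ici 0)) (hβ : 0 < β) :
    ContinuousOn (scaledKernel p n f β) (Ioi 0) := by
  have hm : MapsTo (fun t : ℝ => β * t) (Ioi 0) (Ioi 0) := fun t ht => mul_pos hβ ht
  have h1 : ContinuousOn (fun t : ℝ => p (β * t)) (Ioi 0) := hpc.comp (by fun_prop) hm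
  have h2 : ContinuousOn (fun t : ℝ => f (β * t)) (Ioi 0) :=
    hfc.comp (by fun_prop) fun t ht => Ioi_subset_Ici_self (hm ht)
  have h3 : ContinuousOn (fun t : ℝ => p (β * t) / (p β * t)) (Ioi 0) :=
    h1.div (by fun_prop) fun t ht => (mul_pos (hp β hβ) ht).ne'
  unfold scaledKernel
  exact ((Complex.continuous_ofReal.comp_continuousOn h3).mul (by fun_prop)).mul h2

/-- If `p` is the power `b ^ d₀` near `0`, the weighted average of `f` tends to
`f 0 * ∫_S t ^ (d₀ - 1)` at `0`. -/
lemma tendsto_setIntegral_scaledKernel {d₀ : ℝ} (hS : MeasurableSet S) (hS0 : S ⊆ Ioi 0)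
    (hp : ∀ β, 0 < β → 0 < p β) (hpc : ContinuousOn p (Ioi 0))
    (hp1 : ∀ β, 0 < β → β ≤ 1 → p β = β ^ d₀)
    (hpd : ∀ β, 0 < β → ∀ t ∈ S, p (β * t) ≤ p β * t ^ d)
    (hfc : ContinuousOn f (Ici 0)) (hf : ∀ b, 0 < b → ‖f b‖ ≤ M)
    (hint : IntegrableOn (fun t : ℝ => t ^ (d - 1)) S) :
    Tendsto (fun β => ∫ t in S, scaledKernel p n f β t) (𝓝[>] 0)
      (𝓝 (((∫ t in S, t ^ (d₀ - 1) : ℝ) : ℂ) * f 0)) := by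
  have hlim : (((∫ t in S, t ^ (d₀ - 1) : ℝ) : ℂ) * f 0)
      = ∫ t in S, ((t ^ (d₀ - 1) : ℝ) : ℂ) * f 0 := by
    rw [MeasureTheory.integral_mul_const, integral_complex_ofReal]
  rw [hlim]
  refine MeasureTheory.tendsto_integral_filter_of_dominated_convergence
    (fun t => M * t ^ (d - 1)) ?_ ?_ (hint.const_mul _) ?_
  · filter_upwards [self_mem_nhdsWithin] with β hβ
    exact ((continuousOn_scaledKernel hp hpc hfc hβ).mono hS0).aestronglyMeasurable hS
  · filter_upwards [self_mem_nhdsWithin] with β hβ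
    filter_upwards [ae_restrict_mem hS] with t ht
    have := norm_scaledKernel_le (n := n) (e := 0) (M := M) hp hβ (hS0 ht) (hpd β hβ t ht)
      (by simpa using hf)
    simpa using this
  · filter_upwards [ae_restrict_mem hS] with t ht
    have ht0 : 0 < t := hS0 ht
    have hmul : Tendsto (fun β : ℝ => β * t) (𝓝[>] 0) (𝓝[≥] 0) := by
      refine tendsto_nhdsWithin_iff.2 ⟨?_, ?_⟩
      · have : Tendsto (fun β : ℝ => β * t) (𝓝 0) (𝓝 (0 * t)) := by
          exact (continuous_id.mul continuous_const).tendsto 0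
        rw [zero_mul] at this
        exact this.mono_left nhdsWithin_le_nhds
      · filter_upwards [self_mem_nhdsWithin] with β hβ
        exact (mul_pos hβ ht0).le
    have h1 : Tendsto (fun β : ℝ => f (β * t)) (𝓝[>] 0) (𝓝 (f 0)) :=
      (hfc 0 self_mem_Ici).tendsto.comp hmul
    have h2 : Tendsto (fun β : ℝ => Complex.exp (Complex.I * (n : ℂ) *
        ((β : ℂ) - ((β * t : ℝ) : ℂ)))) (𝓝[>] 0) (𝓝 1) := by
      have : Continuous fun β : ℝ => Complex.exp (Complex.I * (n : ℂ) *
        ((β : ℂ) - ((β * t : ℝ) : ℂ))) := by fun_prop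
      have := this.tendsto 0
      simp only [zero_mul, Complex.ofReal_zero, sub_zero, mul_zero, Complex.exp_zero] at this
      exact this.mono_left nhdsWithin_le_nhds
    have h3 : (fun β : ℝ => p (β * t) / (p β * t)) =ᶠ[𝓝[>] 0] fun _ => t ^ (d₀ - 1) := by
      have hlt : ∀ᶠ β : ℝ in 𝓝[>] 0, β < min 1 (1 / t) :=
        nhdsWithin_le_nhds (eventually_lt_nhds (by positivity))
      filter_upwards [self_mem_nhdsWithin, hlt] with β hβ hβ1
      have hβ0 : 0 < β := hβ
      have hb1 : β * t ≤ 1 := by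
        have := (hβ1.trans_le (min_le_right _ _)).le
        rwa [le_div_iff₀ ht0] at this
      rw [hp1 _ (mul_pos hβ0 ht0) hb1, hp1 β hβ0 (hβ1.trans_le (min_le_left _ _)).le,
        Real.mul_rpow hβ0.le ht0.le, Real.rpow_sub_one ht0.ne']
      have : 0 < β ^ d₀ := Real.rpow_pos_of_pos hβ0 _
      field_simp
    have h4 : Tendsto (fun β : ℝ => ((p (β * t) / (p β * t) : ℝ) : ℂ)) (𝓝[>] 0)
        (𝓝 ((t ^ (d₀ - 1) : ℝ) : ℂ)) :=
      (Complex.continuous_ofReal.tendsto _).comp (tendsto_const_nhds.congr' h3.symm)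
    simpa [scaledKernel] using (h4.mul h2).mul h1

end scaledKernel

/-! ### Norms on `𝒞^δ_0` -/

lemma MemCdelta.norm_le_supN {δ : ℝ} {f : ℝ → ℂ} {L : ℂ} (hf : MemCdelta δ f L) {β : ℝ}
    (hβ : 0 ≤ β) : ‖f β‖ ≤ supN f := by
  obtain ⟨hc, hlim, -⟩ := hf
  obtain ⟨R, hR⟩ := eventually_atTop.1 (hlim.norm.eventually_le_const (lt_add_one ‖L‖))
  obtain ⟨B, hB⟩ := (isCompact_Icc (a := (0 : ℝ)) (b := R)).exists_bound_of_continuousOn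
    (hc.mono Icc_subset_Ici_self)
  have hbdd : BddAbove (Set.range fun β : Ici (0 : ℝ) => ‖f (β : ℝ)‖) := by
    refine ⟨max B (‖L‖ + 1), ?_⟩
    rintro _ ⟨⟨x, hx⟩, rfl⟩
    rcases le_total x R with h | h
    · exact (hB x ⟨hx, h⟩).trans (le_max_left _ _)
    · exact (hR x h).trans (le_max_right _ _)
  exact le_ciSup hbdd ⟨β, hβ⟩

lemma MemCdelta.rpow_mul_norm_le_hoel {δ : ℝ} {f : ℝ → ℂ} (hf : MemCdelta δ f 0) {β : ℝ}
    (hβ : 0 < β) : β ^ δ * ‖f β‖ ≤ hoel δ f 0 := by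
  simpa [hoel] using le_ciSup hf.2.2 ⟨β, hβ⟩

lemma MemCdelta.norm_le_hoel_mul_rpow {δ : ℝ} {f : ℝ → ℂ} (hf : MemCdelta δ f 0) {β : ℝ}
    (hβ : 0 < β) : ‖f β‖ ≤ hoel δ f 0 * β ^ (-δ) := by
  have := hf.rpow_mul_norm_le_hoel hβ
  have h1 : 0 < β ^ δ := Real.rpow_pos_of_pos hβ _
  rw [Real.rpow_neg hβ.le, ← div_eq_mul_inv, le_div_iff₀ h1]
  linarith

lemma hoel_zero_le {δ B : ℝ} {G : ℝ → ℂ} (hB : ∀ β, 0 < β → β ^ δ * ‖G β‖ ≤ B) :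
    hoel δ G 0 ≤ B := by
  have : Nonempty (Ioi (0 : ℝ)) := ⟨⟨1, mem_Ioi.2 one_pos⟩⟩
  exact ciSup_le fun β => by simpa using hB β β.2

lemma bddAbove_hoel_zero {δ B : ℝ} {G : ℝ → ℂ} (hB : ∀ β, 0 < β → β ^ δ * ‖G β‖ ≤ B) :
    BddAbove (Set.range fun β : Ioi (0 : ℝ) => (β : ℝ) ^ δ * ‖G (β : ℝ)‖) := by
  refine ⟨B, ?_⟩
  rintro _ ⟨β, rfl⟩
  exact hB β β.2

lemma supN_le {A : ℝ} {G : ℝ → ℂ} (hA : ∀ β, 0 ≤ β → ‖G β‖ ≤ A) : supN G ≤ A := by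
  have : Nonempty (Ici (0 : ℝ)) := ⟨⟨1, mem_Ici.2 zero_le_one⟩⟩
  exact ciSup_le fun β => hA β β.2

lemma supNIoi_le {A : ℝ} {G : ℝ → ℂ} (hA : ∀ β, 0 < β → ‖G β‖ ≤ A) : supNIoi G ≤ A := by
  have : Nonempty (Ioi (0 : ℝ)) := ⟨⟨1, mem_Ioi.2 one_pos⟩⟩
  exact ciSup_le fun β => hA β β.2

lemma tendsto_zero_of_rpow_mul_norm_le {δ B : ℝ} {G : ℝ → ℂ} (hδ : 0 < δ)
    (hB : ∀ β, 0 < β → β ^ δ * ‖G β‖ ≤ B) : Tendsto G atTop (𝓝 0) := by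
  rw [tendsto_zero_iff_norm_tendsto_zero]
  have h0 : Tendsto (fun β : ℝ => B * β ^ (-δ)) atTop (𝓝 0) := by
    simpa using (tendsto_rpow_neg_atTop hδ).const_mul B
  refine squeeze_zero' (Eventually.of_forall fun _ => norm_nonneg _) ?_ h0
  filter_upwards [eventually_gt_atTop 0] with β hβ
  have h1 : 0 < β ^ δ := Real.rpow_pos_of_pos hβ _
  rw [Real.rpow_neg hβ.le, ← div_eq_mul_inv, le_div_iff₀ h1]
  linarith [hB β hβ]

/-! ### The operator `k · T + 1` for a weighted average `T` -/

/-- If `g = σ ∫_S (scaledKernel)` solves `-βg' + inβg = k g + f`, then `-βg' + inβg` extends by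
`0` to an element of `𝒞^δ_0`, bounded in terms of `f`. -/
lemma exists_extension_Drho {p k : ℝ → ℝ} {n : ℤ} {f g : ℝ → ℂ} {S : Set ℝ}
    {d d₀ δ σ K : ℝ} (h : IsLogSlope p k) (hkc : ContinuousOn k (Ioi 0))
    (hS : MeasurableSet S) (hS0 : S ⊆ Ioi 0)
    (hp1 : ∀ β, 0 < β → β ≤ 1 → p β = β ^ d₀) (hk1 : ∀ β, 0 < β → β ≤ 1 → k β = d₀)
    (hpd : ∀ β, 0 < β → ∀ t ∈ S, p (β * t) ≤ p β * t ^ d) (hδ : 0 < δ)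
    (hint : ∀ e, 0 ≤ e → e ≤ δ → IntegrableOn (fun t : ℝ => t ^ (d - e - 1)) S)
    (hK : ∀ e, 0 ≤ e → e ≤ δ → ∀ β, 0 < β → |k β| * ∫ t in S, t ^ (d - e - 1) ≤ K)
    (hσ : |σ| = 1) (hσd : d₀ * (σ * ∫ t in S, t ^ (d₀ - 1)) = -1)
    (hf : MemCdelta δ f 0)
    (hg : ∀ β, 0 < β → g β = (σ : ℂ) * ∫ t in S, scaledKernel p n f β t)
    (hdiff : ∀ β, 0 < β → DifferentiableAt ℝ g β)
    (hD : ∀ β, 0 < β → Drho n g β = (k β : ℂ) * g β + f β) :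
    ∃ G : ℝ → ℂ, (∀ β : ℝ, 0 < β → G β = Drho n g β) ∧
      MemCdelta δ G 0 ∧ normC δ G 0 ≤ (K + 1) * normC δ f 0 := by
  have hG : ∀ e M, 0 ≤ e → e ≤ δ → (∀ b, 0 < b → ‖f b‖ ≤ M * b ^ (-e)) → ∀ β, 0 < β →
      ‖Drho n g β‖ ≤ (K + 1) * M * β ^ (-e) := by
    intro e M he heδ hM β hβ
    have hb : 0 < β ^ (-e) := Real.rpow_pos_of_pos hβ _
    have hM0 : 0 ≤ M * β ^ (-e) := (norm_nonneg _).trans (hM β hβ)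
    have h1 := norm_setIntegral_scaledKernel_le (n := n) hS hS0 h.pos hβ (hpd β hβ) hM
      (hint e he heδ)
    rw [hD β hβ, hg β hβ]
    calc ‖(k β : ℂ) * ((σ : ℂ) * ∫ t in S, scaledKernel p n f β t) + f β‖
        ≤ |k β| * ‖∫ t in S, scaledKernel p n f β t‖ + ‖f β‖ := by
          refine (norm_add_le _ _).trans_eq ?_
          rw [norm_mul, norm_mul, Complex.norm_real, Complex.norm_real, Real.norm_eq_abs,
            Real.norm_eq_abs, hσ, one_mul]
      _ ≤ |k β| * (M * β ^ (-e) * ∫ t in S, t ^ (d - e - 1)) + M * β ^ (-e) :=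
          add_le_add (mul_le_mul_of_nonneg_left h1 (abs_nonneg _)) (hM β hβ)
      _ = M * β ^ (-e) * (|k β| * ∫ t in S, t ^ (d - e - 1)) + M * β ^ (-e) := by ring
      _ ≤ M * β ^ (-e) * K + M * β ^ (-e) := by
          gcongr
          exact hK e he heδ β hβ
      _ = (K + 1) * M * β ^ (-e) := by ring
  have hsup : ∀ β, 0 < β → ‖Drho n g β‖ ≤ (K + 1) * supN f := fun β hβ => by
    simpa using hG 0 (supN f) le_rfl hδ.le (fun b hb => by simpa using hf.norm_le_supN hb.le) β hβ
  have hhoel : ∀ β, 0 < β → β ^ δ * ‖Drho n g β‖ ≤ (K + 1) * hoel δ f 0 := fun β hβ => by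
    have h1 := hG δ _ hδ.le le_rfl (fun b hb => hf.norm_le_hoel_mul_rpow hb) β hβ
    have h2 : 0 < β ^ δ := Real.rpow_pos_of_pos hβ _
    rw [Real.rpow_neg hβ.le, ← div_eq_mul_inv, le_div_iff₀ h2] at h1
    linarith
  have hlim : Tendsto (Drho n g) (𝓝[>] 0) (𝓝 0) := by
    have h1 := tendsto_setIntegral_scaledKernel (n := n) (M := supN f) hS hS0 h.pos
      h.continuousOn hp1 hpd hf.1 (fun b hb => hf.norm_le_supN hb.le)
      (by simpa using hint 0 le_rfl hδ.le)
    have hf0 : Tendsto f (𝓝[>] 0) (𝓝 (f 0)) :=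
      (hf.1 0 self_mem_Ici).tendsto.mono_left (nhdsWithin_mono _ Ioi_subset_Ici_self)
    have h2 := (h1.const_mul ((d₀ : ℂ) * (σ : ℂ))).add hf0
    have h3 : (d₀ : ℂ) * (σ : ℂ) * (((∫ t in S, t ^ (d₀ - 1) : ℝ) : ℂ) * f 0) + f 0 = 0 := by
      have : ((d₀ * (σ * ∫ t in S, t ^ (d₀ - 1)) : ℝ) : ℂ) = -1 := by rw [hσd]; simp
      push_cast at this
      linear_combination f 0 * this
    rw [h3] at h2
    refine h2.congr' ?_
    have hlt : ∀ᶠ β : ℝ in 𝓝[>] 0, β < 1 :=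
      nhdsWithin_le_nhds (eventually_lt_nhds one_pos)
    filter_upwards [self_mem_nhdsWithin, hlt] with β hβ hβ1
    rw [hD β hβ, hg β hβ, hk1 β hβ hβ1.le]
    ring
  have hGeq : ∀ β, 0 < β → (if 0 < β then Drho n g β else 0) = Drho n g β :=
    fun β hβ => if_pos hβ
  refine ⟨fun β => if 0 < β then Drho n g β else 0, hGeq, ⟨?_, ?_, ?_⟩, ?_⟩
  · intro β hβ
    rcases (show (0 : ℝ) ≤ β from hβ).eq_or_lt with rfl | hβ0
    · rw [← Ioi_insert, continuousWithinAt_insert_self]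
      simp only [ContinuousWithinAt, lt_self_iff_false, if_false]
      refine hlim.congr' ?_
      filter_upwards [self_mem_nhdsWithin] with x hx using (hGeq x hx).symm
    · have hn : Ioi (0 : ℝ) ∈ 𝓝 β := Ioi_mem_nhds hβ0
      have hfβ : ContinuousAt f β := hf.1.continuousAt (Ici_mem_nhds hβ0)
      have hkβ : ContinuousAt k β := hkc.continuousAt hn
      have : ContinuousAt (fun x => (k x : ℂ) * g x + f x) β :=
        ((Complex.continuous_ofReal.continuousAt.comp hkβ).mul
          (hdiff β hβ0).continuousAt).add hfβ
      refine (this.congr ?_).continuousWithinAt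
      filter_upwards [hn] with x hx
      rw [hGeq x hx, hD x hx]
  · refine tendsto_zero_of_rpow_mul_norm_le hδ (B := (K + 1) * hoel δ f 0) fun β hβ => ?_
    rw [hGeq β hβ]
    exact hhoel β hβ
  · simp only [sub_zero]
    refine bddAbove_hoel_zero (G := fun β => if 0 < β then Drho n g β else 0)
      (B := (K + 1) * hoel δ f 0) fun β hβ => ?_
    rw [hGeq β hβ]
    exact hhoel β hβ
  · rw [normC, normC, mul_add]
    refine add_le_add (supN_le fun β hβ => ?_) (hoel_zero_le fun β hβ => ?_)
    · rcases hβ.eq_or_lt with rfl | hβ0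
      · simpa using (norm_nonneg _).trans (hsup 1 one_pos)
      · rw [hGeq β hβ0]
        exact hsup β hβ0
    · rw [hGeq β hβ]
      exact hhoel β hβ

/-! ### Oscillatory integrals against a weight -/

/-- The integrand `b⁻¹ p(b) e^{-inb} f(b)`. -/
noncomputable def oscIntegrand (p : ℝ → ℝ) (n : ℤ) (f : ℝ → ℂ) (b : ℝ) : ℂ :=
  ((p b / b : ℝ) : ℂ) * Complex.exp (-(Complex.I * (n : ℂ) * (b : ℂ))) * f b

lemma norm_oscIntegrand {p : ℝ → ℝ} (n : ℤ) (f : ℝ → ℂ) {b : ℝ} (hp : 0 < p b) (hb : 0 < b) :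
    ‖oscIntegrand p n f b‖ = p b / b * ‖f b‖ := by
  rw [oscIntegrand, norm_mul, norm_mul, Complex.norm_real, Complex.norm_exp,
    Real.norm_of_nonneg (by positivity)]
  simp

lemma continuousOn_oscIntegrand {p : ℝ → ℝ} {n : ℤ} {f : ℝ → ℂ}
    (hpc : ContinuousOn p (Ioi 0)) (hfc : ContinuousOn f (Ioi 0)) :
    ContinuousOn (oscIntegrand p n f) (Ioi 0) := by
  have h : ContinuousOn (fun b : ℝ => p b / b) (Ioi 0) :=
    hpc.div continuousOn_id fun b hb => ne_of_gt hb
  unfold oscIntegrand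
  exact ((Complex.continuous_ofReal.comp_continuousOn h).mul (by fun_prop)).mul hfc

lemma exp_div_mul_oscIntegrand {p : ℝ → ℝ} (n : ℤ) (f : ℝ → ℂ) {β t : ℝ} (hβ : β ≠ 0) :
    Complex.exp (Complex.I * (n : ℂ) * (β : ℂ)) / (p β : ℂ) *
      ((β : ℂ) * oscIntegrand p n f (β * t)) = scaledKernel p n f β t := by
  have hβ' : (β : ℂ) ≠ 0 := by exact_mod_cast hβ
  rw [oscIntegrand, scaledKernel, mul_sub, sub_eq_add_neg, Complex.exp_add]
  push_cast
  by_cases ht : t = 0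
  · simp [ht]
  have ht' : (t : ℂ) ≠ 0 := by exact_mod_cast ht
  field_simp

lemma exp_div_mul_intervalIntegral_oscIntegrand {p : ℝ → ℝ} (n : ℤ) (f : ℝ → ℂ) {β : ℝ}
    (hβ : 0 < β) :
    Complex.exp (Complex.I * (n : ℂ) * (β : ℂ)) / (p β : ℂ) *
      ∫ b in (0 : ℝ)..β, oscIntegrand p n f b = ∫ t in Ioc 0 1, scaledKernel p n f β t := by
  have h := intervalIntegral.smul_integral_comp_mul_left (a := 0) (b := 1)
    (oscIntegrand p n f) β
  rw [mul_zero, mul_one] at h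
  rw [← h, ← intervalIntegral.integral_of_le zero_le_one, Complex.real_smul,
    ← intervalIntegral.integral_const_mul, ← intervalIntegral.integral_const_mul]
  simp only [exp_div_mul_oscIntegrand n f hβ.ne']

lemma exp_div_mul_setIntegral_Ioi_oscIntegrand {p : ℝ → ℝ} (n : ℤ) (f : ℝ → ℂ) {β : ℝ}
    (hβ : 0 < β) :
    Complex.exp (Complex.I * (n : ℂ) * (β : ℂ)) / (p β : ℂ) *
      ∫ b in Ioi β, oscIntegrand p n f b = ∫ t in Ioi 1, scaledKernel p n f β t := by
  have h := integral_comp_mul_left_Ioi' (oscIntegrand p n f) 1 hβ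
  rw [mul_one] at h
  rw [← h, Complex.real_smul,
    ← MeasureTheory.integral_const_mul, ← MeasureTheory.integral_const_mul]
  simp only [exp_div_mul_oscIntegrand n f hβ.ne']

lemma integrableOn_oscIntegrand {p : ℝ → ℝ} {n : ℤ} {f : ℝ → ℂ} {d M β : ℝ} {T : Set ℝ}
    (hT : MeasurableSet T) (hT0 : T ⊆ Ioi 0) (hβ : 0 < β) (hp : ∀ β, 0 < β → 0 < p β)
    (hpc : ContinuousOn p (Ioi 0)) (hpd : ∀ b ∈ T, p (β * (b / β)) ≤ p β * (b / β) ^ d)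
    (hfc : ContinuousOn f (Ioi 0)) (hf : ∀ b, 0 < b → ‖f b‖ ≤ M)
    (hint : IntegrableOn (fun b : ℝ => b ^ (d - 1)) T) :
    IntegrableOn (oscIntegrand p n f) T := by
  refine Integrable.mono' (hint.const_mul (p β * (β ^ d)⁻¹ * M))
    (((continuousOn_oscIntegrand hpc hfc).mono hT0).aestronglyMeasurable hT) ?_
  filter_upwards [ae_restrict_mem hT] with b hb
  have hb0 : 0 < b := hT0 hb
  rw [norm_oscIntegrand n f (hp b hb0) hb0]
  have h1 := hpd b hb
  rw [mul_div_cancel₀ _ hβ.ne', Real.div_rpow hb0.le hβ.le] at h1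
  have hpb := hp b hb0
  calc p b / b * ‖f b‖ ≤ p β * (b ^ d / β ^ d) / b * M := by
        refine mul_le_mul (by gcongr) (hf b hb0) (norm_nonneg _) ?_
        have := hp β hβ
        positivity
    _ = p β * (β ^ d)⁻¹ * M * b ^ (d - 1) := by
        rw [Real.rpow_sub_one hb0.ne']
        ring

lemma hasDerivAt_setIntegral_Ioi {h : ℝ → ℂ} {β : ℝ} (hc : ContinuousOn h (Ioi 0))
    (hint : ∀ x, 0 < x → IntegrableOn h (Ioi x)) (hβ : 0 < β) :
    HasDerivAt (fun x => ∫ b in Ioi x, h b) (-h β) β := by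
  have h1 : HasDerivAt (fun x => ∫ b in β..x, h b) (h β) β :=
    intervalIntegral.integral_hasDerivAt_right IntervalIntegrable.refl
      (hc.stronglyMeasurableAtFilter isOpen_Ioi β hβ) (hc.continuousAt (Ioi_mem_nhds hβ))
  refine (h1.const_sub (∫ b in Ioi β, h b)).congr_of_eventuallyEq ?_
  filter_upwards [Ioi_mem_nhds hβ] with x hx
  rw [← integral_Ioi_sub_Ioi' (hint β hβ) (hint x hx)]
  ring

/-- `x ↦ e^{inx} p(x)⁻¹ J(x)` with `J' = -oscIntegrand` solves `-βg' + inβg = k g + f`. -/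
lemma IsLogSlope.hasDerivAt_exp_div_mul {p k : ℝ → ℝ} (h : IsLogSlope p k) {n : ℤ}
    {f J : ℝ → ℂ} {β : ℝ} (hβ : 0 < β) (hJ : HasDerivAt J (-oscIntegrand p n f β) β) :
    HasDerivAt (fun x : ℝ => Complex.exp (Complex.I * (n : ℂ) * (x : ℂ)) / (p x : ℂ) * J x)
      ((Complex.I * (n : ℂ) - (k β : ℂ) / (β : ℂ)) *
        (Complex.exp (Complex.I * (n : ℂ) * (β : ℂ)) / (p β : ℂ) * J β) - f β / (β : ℂ)) β := by
  have hp0 : (p β : ℂ) ≠ 0 := by exact_mod_cast (h.pos β hβ).ne'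
  have hβ0 : (β : ℂ) ≠ 0 := by exact_mod_cast hβ.ne'
  have hid : HasDerivAt (fun x : ℝ => Complex.I * (n : ℂ) * (x : ℂ))
      (Complex.I * (n : ℂ)) β := by
    simpa using (Complex.ofRealCLM.hasDerivAt (x := β)).const_mul (Complex.I * (n : ℂ))
  convert! (hid.cexp.div (h.hasDerivAt β hβ).ofReal_comp hp0).mul hJ using 1
  have he : Complex.exp (Complex.I * (n : ℂ) * (β : ℂ)) *
      Complex.exp (-(Complex.I * (n : ℂ) * (β : ℂ))) = 1 := by
    rw [← Complex.exp_add]; simp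
  have h2 : Complex.exp (Complex.I * (n : ℂ) * (β : ℂ)) / (p β : ℂ) *
      (-oscIntegrand p n f β) = -(f β / (β : ℂ)) := by
    rw [oscIntegrand]
    push_cast
    field_simp
    linear_combination (-f β) * he
  simp only [Pi.div_apply]
  rw [h2]
  push_cast
  field_simp
  ring

lemma Drho_eq_of_hasDerivAt {n : ℤ} {g : ℝ → ℂ} {k β : ℝ} {y : ℂ} (hβ : β ≠ 0)
    (h : HasDerivAt g ((Complex.I * (n : ℂ) - (k : ℂ) / (β : ℂ)) * g β - y / (β : ℂ)) β) :
    Drho n g β = (k : ℂ) * g β + y := by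
  have hβ0 : (β : ℂ) ≠ 0 := by exact_mod_cast hβ
  rw [Drho, h.deriv]
  field_simp
  ring

lemma IsLogSlope.mul_rpow {p k : ℝ → ℝ} {c : ℝ} (h : IsLogSlope p k) :
    IsLogSlope (fun x => p x * x ^ (-c)) (fun x => k x - c) :=
  ⟨fun β hβ => mul_pos (h.pos β hβ) (Real.rpow_pos_of_pos hβ _),
    fun _ hβ => h.hasDerivAt_mul_rpow hβ⟩

lemma IsLogSlope.inv {p k : ℝ → ℝ} (h : IsLogSlope p k) :
    IsLogSlope (fun x => (p x)⁻¹) (fun x => -k x) := by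
  refine ⟨fun β hβ => inv_pos.2 (h.pos β hβ), fun β hβ => ?_⟩
  have hp := (h.pos β hβ).ne'
  convert! (h.hasDerivAt β hβ).inv hp using 1
  field_simp

lemma IsLogSlope.tendsto_atTop_zero {r k : ℝ → ℝ} {d : ℝ} (h : IsLogSlope r k)
    (hk : ∀ β, 0 < β → k β ≤ d) (hd : d < 0) : Tendsto r atTop (𝓝 0) := by
  have h0 : Tendsto (fun β : ℝ => r 1 * β ^ d) atTop (𝓝 0) := by
    simpa using (tendsto_rpow_neg_atTop (y := -d) (by linarith)).const_mul (r 1)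
  refine squeeze_zero' ?_ ?_ h0
  · filter_upwards [eventually_gt_atTop 0] with β hβ using (h.pos β hβ).le
  · filter_upwards [eventually_ge_atTop 1] with β hβ
    simpa using h.comp_mul_le_of_one_le hk one_pos hβ

lemma IsLogSlope.integrableOn_Ioi_oscIntegrand {p k : ℝ → ℝ} {n : ℤ} {f : ℝ → ℂ} {d M β : ℝ}
    (h : IsLogSlope p k) (hk : ∀ β, 0 < β → k β ≤ d) (hd : d < 0) (hβ : 0 < β)
    (hfc : ContinuousOn f (Ioi 0)) (hf : ∀ b, 0 < b → ‖f b‖ ≤ M) :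
    IntegrableOn (oscIntegrand p n f) (Ioi β) :=
  integrableOn_oscIntegrand (d := d) measurableSet_Ioi (Ioi_subset_Ioi hβ.le) hβ h.pos
    h.continuousOn
    (fun _ hb => h.comp_mul_le_of_one_le hk hβ ((one_le_div hβ).2 (le_of_lt hb)))
    hfc hf (integrableOn_Ioi_rpow_of_lt (by linarith) hβ)

lemma IsLogSlope.intervalIntegrable_oscIntegrand {p k : ℝ → ℝ} {n : ℤ} {f : ℝ → ℂ} {d M β : ℝ}
    (h : IsLogSlope p k) (hk : ∀ β, 0 < β → d ≤ k β) (hd : 0 < d) (hβ : 0 < β)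
    (hfc : ContinuousOn f (Ioi 0)) (hf : ∀ b, 0 < b → ‖f b‖ ≤ M) :
    IntervalIntegrable (oscIntegrand p n f) volume 0 β := by
  rw [intervalIntegrable_iff_integrableOn_Ioc_of_le hβ.le]
  exact integrableOn_oscIntegrand (d := d) measurableSet_Ioc Ioc_subset_Ioi_self hβ h.pos
    h.continuousOn
    (fun _ hb => h.comp_mul_le_of_le_one hk hβ (div_pos hb.1 hβ) ((div_le_one hβ).2 hb.2))
    hfc hf ((intervalIntegrable_iff_integrableOn_Ioc_of_le hβ.le).1
      (intervalIntegral.intervalIntegrable_rpow' (by linarith)))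

/-- Integration by parts: a decaying weight absorbs the derivative in `-βg' + inβg`. -/
lemma IsLogSlope.norm_exp_div_mul_integral_Drho_le {r k : ℝ → ℝ} {n : ℤ} {g G : ℝ → ℂ}
    {d K M M' B β : ℝ} (h : IsLogSlope r k) (hkc : ContinuousOn k (Ioi 0))
    (hk : ∀ β, 0 < β → k β ≤ d) (hd : d < 0) (hkK : ∀ β, 0 < β → |k β| ≤ K)
    (hgd : ∀ β, 0 < β → DifferentiableAt ℝ g β) (hg : ∀ b, 0 < b → ‖g b‖ ≤ M)
    (hG : ∀ b, 0 < b → G b = Drho n g b) (hGc : ContinuousOn G (Ioi 0))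
    (hGM : ∀ b, 0 < b → ‖G b‖ ≤ M') (hβ : 0 < β) (hB : ∀ b, β ≤ b → ‖g b‖ ≤ B) :
    ‖Complex.exp (Complex.I * (n : ℂ) * (β : ℂ)) / (r β : ℂ) *
      ∫ b in Ioi β, oscIntegrand r n (Drho n g) b‖ ≤ 2 * B := by
  have hgc : ContinuousOn g (Ioi 0) := fun b hb => (hgd b hb).continuousAt.continuousWithinAt
  have hsub : Ioi β ⊆ Ioi 0 := Ioi_subset_Ioi hβ.le
  have hr := h.pos β hβ
  have hi1 : IntegrableOn (oscIntegrand r n (Drho n g)) (Ioi β) := by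
    refine (h.integrableOn_Ioi_oscIntegrand hk hd hβ hGc hGM (n := n)).congr_fun ?_
      measurableSet_Ioi
    intro b hb
    simp only [oscIntegrand, hG b (hsub hb)]
  have hi2 : IntegrableOn (fun b => (k b : ℂ) * oscIntegrand r n g b) (Ioi β) := by
    refine Integrable.mono' ((h.integrableOn_Ioi_oscIntegrand hk hd hβ hgc hg
      (n := n)).norm.const_mul K) ?_ ?_
    · exact (((Complex.continuous_ofReal.comp_continuousOn hkc).mul
        (continuousOn_oscIntegrand h.continuousOn hgc)).mono hsub).aestronglyMeasurable
        measurableSet_Ioi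
    · filter_upwards [ae_restrict_mem measurableSet_Ioi] with b hb
      rw [norm_mul, Complex.norm_real, Real.norm_eq_abs]
      gcongr
      exact hkK b (hsub hb)
  have hi3 : IntegrableOn (fun b => r b * k b / b) (Ioi β) := by
    refine Integrable.mono' ((h.integrableOn_Ioi_oscIntegrand (f := fun _ => 1) hk hd hβ
      continuousOn_const (fun _ _ => norm_one.le) (n := n)).norm.const_mul K) ?_ ?_
    · exact (((h.continuousOn.mul hkc).div continuousOn_id fun b hb => ne_of_gt hb).mono
        hsub).aestronglyMeasurable measurableSet_Ioi
    · filter_upwards [ae_restrict_mem measurableSet_Ioi] with b hb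
      have hb0 : 0 < b := hsub hb
      have hrb := h.pos b hb0
      rw [norm_oscIntegrand n _ hrb hb0, norm_one, mul_one, Real.norm_eq_abs, abs_div, abs_mul,
        abs_of_pos hrb, abs_of_pos hb0]
      calc r b * |k b| / b = |k b| * (r b / b) := by ring
        _ ≤ K * (r b / b) := by
          gcongr
          exact hkK b hb0
  have hr0 : Tendsto r atTop (𝓝 0) := h.tendsto_atTop_zero hk hd
  have hI3 : ∫ b in Ioi β, r b * k b / b = -r β := by
    rw [integral_Ioi_of_hasDerivAt_of_tendsto'
      (fun b hb => h.hasDerivAt b (hβ.trans_le hb)) hi3 hr0, zero_sub]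
  set F : ℝ → ℂ := fun b =>
    (r b : ℂ) * Complex.exp (-(Complex.I * (n : ℂ) * (b : ℂ))) * g b with hF
  have hFd : ∀ b ∈ Ici β, HasDerivAt F
      ((k b : ℂ) * oscIntegrand r n g b - oscIntegrand r n (Drho n g) b) b := by
    intro b hb
    have hb0 : 0 < b := hβ.trans_le hb
    have hb0' : (b : ℂ) ≠ 0 := by exact_mod_cast hb0.ne'
    have hid : HasDerivAt (fun x : ℝ => -(Complex.I * (n : ℂ) * (x : ℂ)))
        (-(Complex.I * (n : ℂ))) b := by
      simpa using (Complex.ofRealCLM.hasDerivAt (x := b)).const_mul (-(Complex.I * (n : ℂ)))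
    convert! ((h.hasDerivAt b hb0).ofReal_comp.mul hid.cexp).mul (hgd b hb0).hasDerivAt using 1
    simp only [oscIntegrand, Drho, Pi.mul_apply]
    push_cast
    field_simp
    ring
  have hF0 : Tendsto F atTop (𝓝 0) := by
    rw [tendsto_zero_iff_norm_tendsto_zero]
    refine squeeze_zero' (Eventually.of_forall fun _ => norm_nonneg _) ?_
      (by simpa using hr0.mul_const M)
    filter_upwards [eventually_gt_atTop 0] with b hb
    have hrb := h.pos b hb
    simp only [hF]
    rw [norm_mul, norm_mul, Complex.norm_real, Complex.norm_exp, Real.norm_of_nonneg hrb.le]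
    simp only [Complex.neg_re, Complex.mul_re, Complex.I_re, Complex.I_im, Complex.intCast_re,
      Complex.intCast_im, Complex.ofReal_re, Complex.ofReal_im]
    simp only [zero_mul, mul_zero, sub_zero, neg_zero, Real.exp_zero, mul_one]
    have := hg b hb
    gcongr
  have hFTC := integral_Ioi_of_hasDerivAt_of_tendsto' hFd (hi2.sub hi1) hF0
  rw [MeasureTheory.integral_sub hi2 hi1] at hFTC
  have hI : ∫ b in Ioi β, oscIntegrand r n (Drho n g) b
      = F β + ∫ b in Ioi β, (k b : ℂ) * oscIntegrand r n g b := by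
    linear_combination -hFTC
  have hB0 : 0 ≤ B := (norm_nonneg _).trans (hB β le_rfl)
  have hbound : ‖∫ b in Ioi β, (k b : ℂ) * oscIntegrand r n g b‖ ≤ r β * B := by
    have : r β * B = ∫ b in Ioi β, -(r b * k b / b) * B := by
      rw [MeasureTheory.integral_mul_const, MeasureTheory.integral_neg, hI3, neg_neg]
    rw [this]
    refine MeasureTheory.norm_integral_le_of_norm_le (hi3.neg.mul_const B) ?_
    filter_upwards [ae_restrict_mem measurableSet_Ioi] with b hb
    have hb0 : 0 < b := hsub hb
    have hrb := h.pos b hb0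
    have hkb : k b ≤ 0 := (hk b hb0).trans hd.le
    rw [norm_mul, norm_oscIntegrand n g hrb hb0, Complex.norm_real, Real.norm_eq_abs,
      abs_of_nonpos hkb]
    calc -k b * (r b / b * ‖g b‖) ≤ -k b * (r b / b * B) := by
          have : 0 ≤ -k b := by linarith
          have := hB b (le_of_lt hb)
          gcongr
      _ = -(r b * k b / b) * B := by ring
  have hFβ : ‖F β‖ ≤ r β * B := by
    simp only [hF]
    rw [norm_mul, norm_mul, Complex.norm_real, Complex.norm_exp, Real.norm_of_nonneg hr.le]
    have := hB β le_rfl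
    simp
    gcongr
  have hpre : ‖Complex.exp (Complex.I * (n : ℂ) * (β : ℂ)) / (r β : ℂ)‖ = (r β)⁻¹ := by
    rw [norm_div, Complex.norm_exp, Complex.norm_real, Real.norm_of_nonneg hr.le]
    simp
  rw [norm_mul, hpre, hI, inv_mul_le_iff₀ hr]
  calc _ ≤ r β * B + r β * B := (norm_add_le _ _).trans (add_le_add hFβ hbound)
    _ = r β * (2 * B) := by ring

/-! ### The weights `W_n` -/

section WFun

variable {μ : ℝ} {η : ℝ → ℝ} {n : ℤ}

lemma continuous_aFun (hη : Continuous η) : Continuous (aFun μ η n) := by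
  unfold aFun
  fun_prop

lemma aFun_nonneg (β : ℝ) : 0 ≤ aFun μ η n β := Real.sqrt_nonneg _

lemma aFun_le (hμ : 1 < μ) {β : ℝ} (hη : 0 ≤ η β) : aFun μ η n β ≤ |(n : ℝ)| * μ := by
  refine Real.sqrt_le_iff.2 ⟨by positivity, ?_⟩
  rw [mul_pow, sq_abs]
  nlinarith

lemma aFun_eq (hμ : 1 < μ) {β : ℝ} (hη : η β = 0) : aFun μ η n β = |(n : ℝ)| * μ := by
  rw [aFun, hη, mul_zero, sub_zero, ← mul_pow, Real.sqrt_sq_eq_abs, abs_mul,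
    abs_of_pos (by linarith : 0 < μ)]

lemma le_aFun (hμ : 1 < μ) (hn : 2 ≤ |(n : ℝ)|) {β : ℝ} (hη : η β ≤ 1) :
    |(n : ℝ)| / 2 * Real.sqrt (4 * μ ^ 2 - 2 * μ + 1) ≤ aFun μ η n β := by
  refine Real.le_sqrt_of_sq_le ?_
  rw [mul_pow, Real.sq_sqrt (by nlinarith), div_pow, sq_abs]
  have h4 : 4 ≤ (n : ℝ) ^ 2 := by rw [← sq_abs]; nlinarith
  nlinarith

lemma isLogSlope_WFun (hη : Continuous η) : IsLogSlope (WFun μ η n) (aFun μ η n) := by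
  refine ⟨fun β _ => Real.exp_pos _, fun β hβ => ?_⟩
  have hc : ContinuousOn (fun b => aFun μ η n b / b) (Ioi 0) :=
    (continuous_aFun hη).continuousOn.div continuousOn_id fun b hb => ne_of_gt hb
  have hsub : uIcc 1 β ⊆ Ioi 0 := fun x hx => (lt_min one_pos hβ).trans_le hx.1
  have h := (intervalIntegral.integral_hasDerivAt_right ((hc.mono hsub).intervalIntegrable)
    (hc.stronglyMeasurableAtFilter isOpen_Ioi β hβ) (hc.continuousAt (Ioi_mem_nhds hβ))).exp
  rwa [← mul_div_assoc] at h

lemma WFun_eq_rpow (hμ : 1 < μ) (hη0 : ∀ β : ℝ, β ≤ 1 → η β = 0) {β : ℝ} (hβ : 0 < β)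
    (hβ1 : β ≤ 1) : WFun μ η n β = β ^ (|(n : ℝ)| * μ) := by
  have h : ∫ b in (1 : ℝ)..β, aFun μ η n b / b = ∫ b in (1 : ℝ)..β, |(n : ℝ)| * μ * b⁻¹ := by
    refine intervalIntegral.integral_congr fun b hb => ?_
    rw [uIcc_of_ge hβ1] at hb
    simp only [aFun_eq hμ (hη0 b hb.2), div_eq_mul_inv]
  rw [WFun, h, intervalIntegral.integral_const_mul, integral_inv_of_pos one_pos hβ, div_one,
    Real.rpow_def_of_pos hβ, mul_comm]

end WFun

/-! ### The operators `L_{n,±}⁻¹` as oscillatory integrals -/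

/-- The weight `β^{1-2μ} W_n(β)` of `L_{n,-}⁻¹`. -/
noncomputable def weightMinus (μ : ℝ) (η : ℝ → ℝ) (n : ℤ) (β : ℝ) : ℝ :=
  WFun μ η n β * β ^ (-(2 * μ - 1))

/-- The weight `β^{1-2μ} W_n(β)⁻¹` of `L_{n,+}⁻¹`. -/
noncomputable def weightPlus (μ : ℝ) (η : ℝ → ℝ) (n : ℤ) (β : ℝ) : ℝ :=
  (WFun μ η n β)⁻¹ * β ^ (-(2 * μ - 1))

section Operators

variable {μ : ℝ} {η : ℝ → ℝ} {n : ℤ} {f : ℝ → ℂ} {β : ℝ}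

lemma isLogSlope_weightMinus (hη : Continuous η) :
    IsLogSlope (weightMinus μ η n) (fun β => aFun μ η n β - (2 * μ - 1)) :=
  (isLogSlope_WFun hη).mul_rpow

lemma isLogSlope_weightPlus (hη : Continuous η) :
    IsLogSlope (weightPlus μ η n) (fun β => -aFun μ η n β - (2 * μ - 1)) :=
  (isLogSlope_WFun hη).inv.mul_rpow

lemma rpow_neg_two_mul_eq {b : ℝ} (hb : 0 < b) : b ^ (-(2 * μ)) = b ^ (-(2 * μ - 1)) / b := by
  rw [← Real.rpow_sub_one hb.ne']
  congr 1
  ring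

lemma rpow_two_mul_sub_one_eq (hβ : 0 < β) : β ^ (2 * μ - 1) = (β ^ (-(2 * μ - 1)))⁻¹ := by
  rw [Real.rpow_neg hβ.le, inv_inv]

lemma ofReal_mul_exp_mul_eq {p : ℝ → ℝ} {q b : ℝ} (hq : q = p b / b) :
    (q : ℂ) * Complex.exp (Complex.I * (n : ℂ) * ((β : ℂ) - (b : ℂ))) * f b =
      Complex.exp (Complex.I * (n : ℂ) * (β : ℂ)) * oscIntegrand p n f b := by
  rw [oscIntegrand, hq, mul_sub, sub_eq_add_neg, Complex.exp_add]
  ring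

lemma Lplus_eq (hβ : 0 < β) : Lplus μ η n f β =
    Complex.exp (Complex.I * (n : ℂ) * (β : ℂ)) / (weightPlus μ η n β : ℂ) *
      ∫ b in Ioi β, oscIntegrand (weightPlus μ η n) n f b := by
  have h : β ^ (2 * μ - 1) * WFun μ η n β = (weightPlus μ η n β)⁻¹ := by
    rw [weightPlus, mul_inv, inv_inv, rpow_two_mul_sub_one_eq hβ, mul_comm]
  have hi : ∀ b ∈ Ioi β, ((b ^ (-(2 * μ)) / WFun μ η n b : ℝ) : ℂ) *
        Complex.exp (Complex.I * (n : ℂ) * ((β : ℂ) - (b : ℂ))) * f b =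
      Complex.exp (Complex.I * (n : ℂ) * (β : ℂ)) * oscIntegrand (weightPlus μ η n) n f b := by
    intro b hb
    refine ofReal_mul_exp_mul_eq ?_
    rw [rpow_neg_two_mul_eq (hβ.trans hb), weightPlus]
    ring
  rw [Lplus, h, setIntegral_congr_fun measurableSet_Ioi hi, MeasureTheory.integral_const_mul]
  push_cast
  ring

lemma rpow_div_WFun_eq (hβ : 0 < β) :
    β ^ (2 * μ - 1) / WFun μ η n β = (weightMinus μ η n β)⁻¹ := by
  rw [weightMinus, mul_inv, rpow_two_mul_sub_one_eq hβ, div_eq_mul_inv, mul_comm]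

lemma Lminus_integrand_eq {b : ℝ} (hb : 0 < b) : ((b ^ (-(2 * μ)) * WFun μ η n b : ℝ) : ℂ) *
      Complex.exp (Complex.I * (n : ℂ) * ((β : ℂ) - (b : ℂ))) * f b =
    Complex.exp (Complex.I * (n : ℂ) * (β : ℂ)) * oscIntegrand (weightMinus μ η n) n f b := by
  refine ofReal_mul_exp_mul_eq ?_
  rw [rpow_neg_two_mul_eq hb, weightMinus]
  ring

lemma Lminus_eq_of_two_le (hn : 2 ≤ |n|) (hβ : 0 < β) : Lminus μ η n f β =
    Complex.exp (Complex.I * (n : ℂ) * (β : ℂ)) / (weightMinus μ η n β : ℂ) *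
      -∫ b in (0 : ℝ)..β, oscIntegrand (weightMinus μ η n) n f b := by
  rw [Lminus, if_pos hn, rpow_div_WFun_eq hβ, intervalIntegral.integral_of_le hβ.le,
    intervalIntegral.integral_of_le hβ.le,
    setIntegral_congr_fun measurableSet_Ioc fun b hb => Lminus_integrand_eq hb.1,
    MeasureTheory.integral_const_mul]
  push_cast
  ring

lemma Lminus_eq_of_lt_two (hn : ¬2 ≤ |n|) (hβ : 0 < β) : Lminus μ η n f β =
    Complex.exp (Complex.I * (n : ℂ) * (β : ℂ)) / (weightMinus μ η n β : ℂ) *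
      ∫ b in Ioi β, oscIntegrand (weightMinus μ η n) n f b := by
  rw [Lminus, if_neg hn, rpow_div_WFun_eq hβ,
    setIntegral_congr_fun measurableSet_Ioi fun b hb => Lminus_integrand_eq (hβ.trans hb),
    MeasureTheory.integral_const_mul]
  push_cast
  ring

/-- If `L_{n,-}⁻¹ f = e^{inβ} p(β)⁻¹ J` with `J' = -oscIntegrand`, it is differentiable and
`-βg' + inβg = (a_n - (2μ - 1)) g + f`. -/
lemma differentiableAt_Lminus_and_Drho_eq {J : ℝ → ℂ} (hη : Continuous η) (hβ : 0 < β)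
    (hJ : HasDerivAt J (-oscIntegrand (weightMinus μ η n) n f β) β)
    (hL : ∀ x, 0 < x → Lminus μ η n f x =
      Complex.exp (Complex.I * (n : ℂ) * (x : ℂ)) / (weightMinus μ η n x : ℂ) * J x) :
    DifferentiableAt ℝ (Lminus μ η n f) β ∧ Drho n (Lminus μ η n f) β =
      ((aFun μ η n β - (2 * μ - 1) : ℝ) : ℂ) * Lminus μ η n f β + f β := by
  have h1 := (isLogSlope_weightMinus (μ := μ) (n := n) hη).hasDerivAt_exp_div_mul hβ hJ
  have h2 : Lminus μ η n f =ᶠ[𝓝 β] fun x : ℝ =>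
      Complex.exp (Complex.I * (n : ℂ) * (x : ℂ)) / (weightMinus μ η n x : ℂ) * J x := by
    filter_upwards [Ioi_mem_nhds hβ] with x hx using hL x hx
  have h3 := h1.congr_of_eventuallyEq h2
  rw [← hL β hβ] at h3
  exact ⟨h3.differentiableAt, Drho_eq_of_hasDerivAt hβ.ne' h3⟩

lemma weightMinus_eq_rpow (hμ : 1 < μ) (hη0 : ∀ β : ℝ, β ≤ 1 → η β = 0) (hβ : 0 < β)
    (hβ1 : β ≤ 1) : weightMinus μ η n β = β ^ (|(n : ℝ)| * μ - (2 * μ - 1)) := by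
  rw [weightMinus, WFun_eq_rpow hμ hη0 hβ hβ1, ← Real.rpow_add hβ, ← sub_eq_add_neg]

/-- The bound for `L_{n,-}⁻¹` when `|n| ≥ 2`. -/
lemma Lminus_bound_of_two_le {δ : ℝ} (hμ : 1 < μ) (hδ0 : 0 < δ)
    (hδ : δ < Real.sqrt (4 * μ ^ 2 - 2 * μ + 1) - 2 * μ + 1) (hηc : Continuous η)
    (hη_range : ∀ β, 0 ≤ η β ∧ η β ≤ 1) (hη0 : ∀ β : ℝ, β ≤ 1 → η β = 0) (hn : 2 ≤ |n|)
    (hf : MemCdelta δ f 0) :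
    (∀ β : ℝ, 0 < β → DifferentiableAt ℝ (Lminus μ η n f) β) ∧
      ∃ G : ℝ → ℂ, (∀ β : ℝ, 0 < β → G β = Drho n (Lminus μ η n f) β) ∧ MemCdelta δ G 0 ∧
        normC δ G 0 ≤
          (2 * μ / (Real.sqrt (4 * μ ^ 2 - 2 * μ + 1) - 2 * μ + 1 - δ) + 1) * normC δ f 0 := by
  have hn' : (2 : ℝ) ≤ |(n : ℝ)| := by exact_mod_cast hn
  set c := Real.sqrt (4 * μ ^ 2 - 2 * μ + 1) - 2 * μ + 1 with hc
  set d := |(n : ℝ)| / 2 * c with hd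
  have hslope := isLogSlope_weightMinus (μ := μ) (n := n) hηc
  have hkd : ∀ β, 0 < β → d ≤ aFun μ η n β - (2 * μ - 1) := fun β _ => by
    have := le_aFun hμ hn' (hη_range β).2
    rw [hd, hc]
    nlinarith
  have hde : ∀ e, 0 ≤ e → e ≤ δ → |(n : ℝ)| / 2 * (c - δ) ≤ d - e := fun e he heδ => by
    rw [hd]
    nlinarith
  have hcδ : 0 < c - δ := by linarith
  have hdpos : 0 < |(n : ℝ)| / 2 * (c - δ) := by positivity
  have hd0 : 0 < d := by linarith [hde 0 le_rfl hδ0.le]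
  have hd₀ : 0 < |(n : ℝ)| * μ - (2 * μ - 1) := by nlinarith
  have hfc : ContinuousOn f (Ioi 0) := hf.1.mono Ioi_subset_Ici_self
  have hfM : ∀ b, 0 < b → ‖f b‖ ≤ supN f := fun b hb => hf.norm_le_supN hb.le
  have hJ : ∀ β, 0 < β → HasDerivAt
      (fun x => -∫ b in (0 : ℝ)..x, oscIntegrand (weightMinus μ η n) n f b)
      (-oscIntegrand (weightMinus μ η n) n f β) β := fun β hβ => by
    have ho := continuousOn_oscIntegrand (n := n) hslope.continuousOn hfc
    exact (intervalIntegral.integral_hasDerivAt_right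
      (hslope.intervalIntegrable_oscIntegrand hkd hd0 hβ hfc hfM)
      (ho.stronglyMeasurableAtFilter isOpen_Ioi β hβ) (ho.continuousAt (Ioi_mem_nhds hβ))).neg
  have hL : ∀ β : ℝ, 0 < β → _ := fun β hβ => differentiableAt_Lminus_and_Drho_eq hηc hβ (hJ β hβ)
    fun x hx => Lminus_eq_of_two_le hn hx
  refine ⟨fun β hβ => (hL β hβ).1, exists_extension_Drho (S := Ioc 0 1) (σ := -1) (d := d)
    hslope ((continuous_aFun hηc).sub continuous_const).continuousOn measurableSet_Ioc
    Ioc_subset_Ioi_self (fun β hβ hβ1 => weightMinus_eq_rpow hμ hη0 hβ hβ1)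
    (fun β _ hβ1 => by rw [aFun_eq hμ (hη0 β hβ1)])
    (fun β hβ t ht => hslope.comp_mul_le_of_le_one hkd hβ ht.1 ht.2) hδ0
    (fun e he heδ => integrableOn_Ioc_zero_one_rpow (hdpos.trans_le (hde e he heδ)))
    ?_ (by simp) ?_ hf ?_ (fun β hβ => (hL β hβ).1) (fun β hβ => (hL β hβ).2)⟩
  · intro e he heδ β hβ
    have h1 := hde e he heδ
    have h2 : |aFun μ η n β - (2 * μ - 1)| ≤ |(n : ℝ)| * μ := by
      rw [abs_of_nonneg (hd0.le.trans (hkd β hβ))]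
      linarith [aFun_le (n := n) hμ (hη_range β).1]
    rw [setIntegral_Ioc_zero_one_rpow (hdpos.trans_le h1)]
    calc _ ≤ |(n : ℝ)| * μ * (1 / (|(n : ℝ)| / 2 * (c - δ))) :=
          mul_le_mul h2 (one_div_le_one_div_of_le hdpos h1)
            (one_div_nonneg.2 (hdpos.le.trans h1)) (by positivity)
      _ = 2 * μ / (c - δ) := by
        have : |(n : ℝ)| ≠ 0 := by positivity
        field_simp
  · rw [setIntegral_Ioc_zero_one_rpow hd₀]
    rw [neg_one_mul, mul_neg, mul_one_div_cancel hd₀.ne']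
  · intro β hβ
    rw [Lminus_eq_of_two_le hn hβ, mul_neg, exp_div_mul_intervalIntegral_oscIntegrand n f hβ]
    simp

/-- The bound for `L_{n,-}⁻¹` when `|n| = 1`. -/
lemma Lminus_bound_of_lt_two {δ : ℝ} (hμ : 1 < μ) (hδ0 : 0 < δ) (hηc : Continuous η)
    (hη_range : ∀ β, 0 ≤ η β ∧ η β ≤ 1) (hη0 : ∀ β : ℝ, β ≤ 1 → η β = 0) (hn0 : n ≠ 0)
    (hn : ¬2 ≤ |n|) (hf : MemCdelta δ f 0) :
    (∀ β : ℝ, 0 < β → DifferentiableAt ℝ (Lminus μ η n f) β) ∧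
      ∃ G : ℝ → ℂ, (∀ β : ℝ, 0 < β → G β = Drho n (Lminus μ η n f) β) ∧ MemCdelta δ G 0 ∧
        normC δ G 0 ≤ (2 * μ / (μ - 1) + 1) * normC δ f 0 := by
  have hn' : |(n : ℝ)| = 1 := by
    have : |n| = 1 := by
      have := abs_pos.2 hn0
      omega
    exact_mod_cast this
  have hslope := isLogSlope_weightMinus (μ := μ) (n := n) hηc
  have hale : ∀ β, aFun μ η n β ≤ μ := fun β => by
    simpa [hn'] using aFun_le (n := n) hμ (hη_range β).1
  have hkd : ∀ β, 0 < β → aFun μ η n β - (2 * μ - 1) ≤ -(μ - 1) := fun β _ => by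
    linarith [hale β]
  have hd0 : -(μ - 1) < 0 := by linarith
  have hfc : ContinuousOn f (Ioi 0) := hf.1.mono Ioi_subset_Ici_self
  have hfM : ∀ b, 0 < b → ‖f b‖ ≤ supN f := fun b hb => hf.norm_le_supN hb.le
  have hJ : ∀ β, 0 < β → HasDerivAt
      (fun x => ∫ b in Ioi x, oscIntegrand (weightMinus μ η n) n f b)
      (-oscIntegrand (weightMinus μ η n) n f β) β := fun β hβ =>
    hasDerivAt_setIntegral_Ioi (continuousOn_oscIntegrand hslope.continuousOn hfc)
      (fun x hx => hslope.integrableOn_Ioi_oscIntegrand hkd hd0 hx hfc hfM) hβ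
  have hL : ∀ β : ℝ, 0 < β → _ := fun β hβ => differentiableAt_Lminus_and_Drho_eq hηc hβ (hJ β hβ)
    fun x hx => Lminus_eq_of_lt_two hn hx
  refine ⟨fun β hβ => (hL β hβ).1, exists_extension_Drho (S := Ioi 1) (σ := 1)
    (d := -(μ - 1)) (d₀ := -(μ - 1))
    hslope ((continuous_aFun hηc).sub continuous_const).continuousOn measurableSet_Ioi
    (Ioi_subset_Ioi zero_le_one) (fun β hβ hβ1 => ?_) (fun β _ hβ1 => ?_)
    (fun β hβ t ht => hslope.comp_mul_le_of_one_le hkd hβ (le_of_lt ht)) hδ0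
    (fun e he heδ => integrableOn_Ioi_one_rpow (by linarith))
    ?_ (by simp) ?_ hf ?_ (fun β hβ => (hL β hβ).1) (fun β hβ => (hL β hβ).2)⟩
  · rw [weightMinus_eq_rpow hμ hη0 hβ hβ1, hn']
    congr 1
    ring
  · rw [aFun_eq hμ (hη0 β hβ1), hn']
    ring
  · intro e he heδ β hβ
    have h2 : |aFun μ η n β - (2 * μ - 1)| ≤ 2 * μ :=
      abs_le.2 ⟨by linarith [aFun_nonneg (μ := μ) (η := η) (n := n) β], by linarith [hale β]⟩
    rw [setIntegral_Ioi_one_rpow (by linarith)]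
    have h3 : -(1 / (-(μ - 1) - e)) = 1 / (μ - 1 + e) := by
      rw [← neg_add', div_neg, neg_neg]
    have h4 : 0 < μ - 1 := by linarith
    rw [h3]
    calc _ ≤ 2 * μ * (1 / (μ - 1)) := by
          gcongr
          linarith
      _ = 2 * μ / (μ - 1) := by ring
  · rw [setIntegral_Ioi_one_rpow hd0]
    have h4 : μ - 1 ≠ 0 := by linarith
    field_simp
  · intro β hβ
    rw [Lminus_eq_of_lt_two hn hβ, exp_div_mul_setIntegral_Ioi_oscIntegrand n f hβ]
    simp

lemma norm_Lplus_Drho_le {g G : ℝ → ℂ} {M M' B : ℝ} (hμ : 1 < μ) (hηc : Continuous η)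
    (hη_range : ∀ β, 0 ≤ η β ∧ η β ≤ 1) (hgd : ∀ β, 0 < β → DifferentiableAt ℝ g β)
    (hg : ∀ b, 0 < b → ‖g b‖ ≤ M) (hG : ∀ b, 0 < b → G b = Drho n g b)
    (hGc : ContinuousOn G (Ioi 0)) (hGM : ∀ b, 0 < b → ‖G b‖ ≤ M') (hβ : 0 < β)
    (hB : ∀ b, β ≤ b → ‖g b‖ ≤ B) : ‖Lplus μ η n (Drho n g) β‖ ≤ 2 * B := by
  rw [Lplus_eq hβ]
  have ha : ∀ β, 0 ≤ aFun μ η n β := aFun_nonneg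
  refine (isLogSlope_weightPlus hηc).norm_exp_div_mul_integral_Drho_le (d := -(2 * μ - 1))
    (K := |(n : ℝ)| * μ + 2 * μ)
    ((continuous_aFun hηc).neg.sub continuous_const).continuousOn
    (fun x _ => by linarith [ha x]) (by linarith) (fun x _ => ?_) hgd hg hG hGc hGM hβ hB
  have := aFun_le (n := n) hμ (hη_range x).1
  rw [abs_of_nonpos (by linarith [ha x])]
  linarith

end Operators

/-- Uniform bounds for `\hat D_ρ ∘ L_{n,-}^{-1}` and
`L_{n,+}^{-1} ∘ \hat D_ρ` on `𝒞^δ_0`. -/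
theorem stmt_9 (μ δ : ℝ) (hμ : 1 < μ)
    (hδ0 : 0 < δ)
    (hδ1 : δ < min (Real.sqrt (4 * μ ^ 2 - 2 * μ + 1) - 2 * μ + 1) 1)
    (η : ℝ → ℝ) (hη_smooth : ContDiff ℝ (⊤ : ℕ∞) η)
    (hη_range : ∀ β, 0 ≤ η β ∧ η β ≤ 1)
    (hη0 : ∀ β : ℝ, β ≤ 1 → η β = 0) (hη1 : ∀ β : ℝ, 2 ≤ β → η β = 1) :
    ∃ C : ℝ, 0 < C ∧ ∀ n : ℤ, n ≠ 0 →
      (∀ f : ℝ → ℂ, MemCdelta δ f 0 →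
        (∀ β : ℝ, 0 < β → DifferentiableAt ℝ (Lminus μ η n f) β) ∧
        ∃ G : ℝ → ℂ, (∀ β : ℝ, 0 < β → G β = Drho n (Lminus μ η n f) β) ∧
          MemCdelta δ G 0 ∧ normC δ G 0 ≤ C * normC δ f 0) ∧
      (∀ g : ℝ → ℂ, MemCdelta δ g 0 →
        (∀ β : ℝ, 0 < β → DifferentiableAt ℝ g β) →
        (∃ G : ℝ → ℂ, (∀ β : ℝ, 0 < β → G β = Drho n g β) ∧ MemCdelta δ G 0) →
        BddAbove (Set.range fun β : Ioi (0 : ℝ) =>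
          (β : ℝ) ^ δ * ‖Lplus μ η n (Drho n g) (β : ℝ)‖) ∧
        supNIoi (Lplus μ η n (Drho n g)) + hoel δ (Lplus μ η n (Drho n g)) 0 ≤
          C * normC δ g 0) := by
  have hηc : Continuous η := hη_smooth.continuous
  have hδ2 := hδ1.trans_le (min_le_left _ _)
  set c := Real.sqrt (4 * μ ^ 2 - 2 * μ + 1) - 2 * μ + 1 with hc
  have h1 : 0 < 2 * μ / (c - δ) := div_pos (by linarith) (by linarith)
  have h2 : 0 < 2 * μ / (μ - 1) := div_pos (by linarith) (by linarith)
  have hnn : ∀ {f : ℝ → ℂ}, MemCdelta δ f 0 → 0 ≤ normC δ f 0 := fun hf =>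
    add_nonneg ((norm_nonneg _).trans (hf.norm_le_supN le_rfl))
      ((mul_nonneg (Real.rpow_nonneg zero_le_one _) (norm_nonneg _)).trans
        (hf.rpow_mul_norm_le_hoel one_pos))
  refine ⟨2 * μ / (c - δ) + 2 * μ / (μ - 1) + 2, by positivity, fun n hn0 => ⟨?_, ?_⟩⟩
  · intro f hf
    by_cases hn : 2 ≤ |n|
    · obtain ⟨hd, G, hG, hGm, hGn⟩ :=
        Lminus_bound_of_two_le hμ hδ0 hδ2 hηc hη_range hη0 hn hf
      exact ⟨hd, G, hG, hGm, hGn.trans (mul_le_mul_of_nonneg_right (by linarith) (hnn hf))⟩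
    · obtain ⟨hd, G, hG, hGm, hGn⟩ :=
        Lminus_bound_of_lt_two hμ hδ0 hηc hη_range hη0 hn0 hn hf
      exact ⟨hd, G, hG, hGm, hGn.trans (mul_le_mul_of_nonneg_right (by linarith) (hnn hf))⟩
  · rintro g hg hgd ⟨G, hG, hGm⟩
    have hb : ∀ β B, 0 < β → (∀ b, β ≤ b → ‖g b‖ ≤ B) →
        ‖Lplus μ η n (Drho n g) β‖ ≤ 2 * B := fun β B hβ hB =>
      norm_Lplus_Drho_le hμ hηc hη_range hgd (fun b hb => hg.norm_le_supN hb.le) hG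
        (hGm.1.mono Ioi_subset_Ici_self) (fun b hb => hGm.norm_le_supN hb.le) hβ hB
    have hsup : ∀ β, 0 < β → ‖Lplus μ η n (Drho n g) β‖ ≤ 2 * supN g := fun β hβ =>
      hb β _ hβ fun b hβb => hg.norm_le_supN (hβ.le.trans hβb)
    have hhoel : ∀ β, 0 < β → β ^ δ * ‖Lplus μ η n (Drho n g) β‖ ≤ 2 * hoel δ g 0 := by
      intro β hβ
      have hβδ : 0 < β ^ δ := Real.rpow_pos_of_pos hβ _
      have h := hb β (hoel δ g 0 / β ^ δ) hβ fun b hβb => by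
        have hb0 := hβ.trans_le hβb
        rw [le_div_iff₀ hβδ, mul_comm]
        refine le_trans ?_ (hg.rpow_mul_norm_le_hoel hb0)
        gcongr
      rwa [← mul_div_assoc, le_div_iff₀ hβδ, mul_comm] at h
    refine ⟨bddAbove_hoel_zero hhoel, ?_⟩
    calc _ ≤ 2 * supN g + 2 * hoel δ g 0 := add_le_add (supNIoi_le hsup) (hoel_zero_le hhoel)
      _ = 2 * normC δ g 0 := by rw [normC]; ring
      _ ≤ _ := mul_le_mul_of_nonneg_right (by linarith) (hnn hg)
end

section
/- Let μ > 1. Suppose f : (0,∞) × 𝕋 → ℂ is smooth and bounded and satisfies, pointwise on (0,∞) × 𝕋, the linearized equation ℒf = 0, where g = β∂_βf + f, D_ρ = β(∂_φ − ∂_β), and ℒf = (D_ρ + 2μ − 1)²g + μ²∂_φ²g + (2μ−1)β∂_φf. Then f ≡ 0. -/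
open Filter Topology Set

/-- partial derivative in the first (radial-type) variable `β`. -/
noncomputable def pB (h : ℝ → ℝ → ℂ) (β φ : ℝ) : ℂ := deriv (fun b => h b φ) β

/-- partial derivative in the second (angular) variable `φ`. -/
noncomputable def pP (h : ℝ → ℝ → ℂ) (β φ : ℝ) : ℂ := deriv (fun p => h β p) φ

/-- `D_ρ = β(∂_φ − ∂_β)`. -/
noncomputable def Drho2 (h : ℝ → ℝ → ℂ) (β φ : ℝ) : ℂ := (β : ℂ) * (pP h β φ - pB h β φ)

/-- the operator `D_ρ + (2μ−1)`. -/
noncomputable def Aop (μ : ℝ) (h : ℝ → ℝ → ℂ) (β φ : ℝ) : ℂ :=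
  Drho2 h β φ + ((2 * μ - 1 : ℝ) : ℂ) * h β φ

/-- `g = (D_β + 1) f = β ∂_β f + f`. -/
noncomputable def gOf (f : ℝ → ℝ → ℂ) (β φ : ℝ) : ℂ := (β : ℂ) * pB f β φ + f β φ

section BetaMoments

open MeasureTheory ProbabilityTheory

theorem ae_mem_Ioo_betaMeasure (a d : ℝ) : ∀ᵐ x ∂betaMeasure a d, x ∈ Ioo (0 : ℝ) 1 := by
  have hm : Measurable (betaPDF a d) := (measurable_betaPDFReal a d).ennreal_ofReal
  rw [betaMeasure, ae_withDensity_iff hm]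
  refine Eventually.of_forall fun x hx => ?_
  by_contra h
  apply hx
  rw [betaPDF_eq, if_neg (by simpa using h), ENNReal.ofReal_zero]

theorem betaPDFReal_nonneg {a d : ℝ} (ha : 0 < a) (hd : 0 < d) (x : ℝ) :
    0 ≤ betaPDFReal a d x := by
  by_cases h : 0 < x ∧ x < 1
  · exact (betaPDFReal_pos h.1 h.2 ha hd).le
  · rw [betaPDFReal, if_neg h]

theorem integral_betaMeasure {a d : ℝ} (ha : 0 < a) (hd : 0 < d) (u : ℝ → ℝ) :
    ∫ x, u x ∂betaMeasure a d = ∫ x, betaPDFReal a d x * u x := by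
  have hm : Measurable (betaPDF a d) := (measurable_betaPDFReal a d).ennreal_ofReal
  rw [betaMeasure, integral_withDensity_eq_integral_toReal_smul hm
    (Eventually.of_forall fun x => ENNReal.ofReal_lt_top)]
  refine integral_congr_ae (Eventually.of_forall fun x => ?_)
  simp [betaPDF, ENNReal.toReal_ofReal (betaPDFReal_nonneg ha hd x)]

theorem integral_pow_betaMeasure {a d : ℝ} (ha : 0 < a) (hd : 0 < d) (k : ℕ) :
    ∫ x, x ^ k ∂betaMeasure a d = beta (a + k) d / beta a d := by
  have hak : 0 < a + k := by positivity
  have := isProbabilityMeasureBeta hak hd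
  have h1 : ∫ x, betaPDFReal (a + k) d x * 1 = 1 := by
    rw [← integral_betaMeasure hak hd (fun _ => 1)]
    simp
  have hb := (beta_pos ha hd).ne'
  have hbk := (beta_pos hak hd).ne'
  rw [integral_betaMeasure ha hd]
  have h2 : ∀ x, betaPDFReal a d x * x ^ k =
      beta (a + k) d / beta a d * (betaPDFReal (a + k) d x * 1) := by
    intro x
    by_cases h : 0 < x ∧ x < 1
    · rw [betaPDFReal, betaPDFReal, if_pos h, if_pos h,
        show a + k - 1 = (a - 1) + k by ring, Real.rpow_add h.1, Real.rpow_natCast]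
      field_simp
    · rw [betaPDFReal, betaPDFReal, if_neg h, if_neg h]; simp
  simp_rw [h2]
  rw [integral_const_mul, h1, mul_one]

theorem integral_pow_succ_betaMeasure {a d : ℝ} (ha : 0 < a) (hd : 0 < d) (k : ℕ) :
    (a + d + k) * ∫ x, x ^ (k + 1) ∂betaMeasure a d =
      (a + k) * ∫ x, x ^ k ∂betaMeasure a d := by
  have hak : 0 < a + k := by positivity
  have hadk : 0 < a + k + d := by positivity
  rw [integral_pow_betaMeasure ha hd, integral_pow_betaMeasure ha hd]
  have e1 : a + ((k + 1 : ℕ) : ℝ) = a + k + 1 := by push_cast; ring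
  have e2 : a + k + 1 + d = a + k + d + 1 := by ring
  rw [e1]
  simp only [beta]
  rw [e2, Real.Gamma_add_one hak.ne', Real.Gamma_add_one hadk.ne']
  have := (Real.Gamma_pos_of_pos hadk).ne'
  have h3 : a + d + k = a + k + d := by ring
  rw [h3]
  field_simp

theorem exists_le_integral_exp_betaMeasure {a d : ℝ} (ha : 0 < a) (hd : 0 < d) :
    ∃ c > 0, ∀ y : ℝ, 1 ≤ y → c * y ^ (-a) ≤ ∫ x, Real.exp (-y * x) ∂betaMeasure a d := by
  have := isProbabilityMeasureBeta ha hd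
  have hb := beta_pos ha hd
  set C : ℝ := 1 / beta a d * min 1 ((1 / 2 : ℝ) ^ (d - 1)) * Real.exp (-1) with hC
  have hCpos : 0 < C := by positivity
  refine ⟨C * ((1 / 2) ^ a / a), by positivity, fun y hy => ?_⟩
  have hy0 : 0 < y := by linarith
  have hs : (0 : ℝ) < 1 / 2 * y⁻¹ := by positivity
  have hs2 : 1 / 2 * y⁻¹ ≤ (1 / 2 : ℝ) := by
    have := inv_le_one_of_one_le₀ hy
    linarith
  rw [integral_betaMeasure ha hd]
  have hintg : Integrable (fun x => betaPDFReal a d x * Real.exp (-y * x)) := by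
    have h1 : Integrable (fun x => Real.exp (-y * x)) (betaMeasure a d) := by
      refine Integrable.of_bound (by fun_prop) 1 ?_
      filter_upwards [ae_mem_Ioo_betaMeasure a d] with x hx
      rw [Real.norm_eq_abs, Real.abs_exp, Real.exp_le_one_iff]
      nlinarith [hx.1]
    have hm : Measurable (betaPDF a d) := (measurable_betaPDFReal a d).ennreal_ofReal
    rw [betaMeasure, integrable_withDensity_iff_integrable_smul' hm
      (Eventually.of_forall fun x => ENNReal.ofReal_lt_top)] at h1
    refine h1.congr (Eventually.of_forall fun x => ?_)
    simp [betaPDF, ENNReal.toReal_ofReal (betaPDFReal_nonneg ha hd x)]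
  have h1 : ∫ x in Ioc 0 (1 / 2 * y⁻¹), C * x ^ (a - 1) ≤
      ∫ x in Ioc 0 (1 / 2 * y⁻¹), betaPDFReal a d x * Real.exp (-y * x) := by
    refine setIntegral_mono_on ?_ hintg.integrableOn measurableSet_Ioc fun x hx => ?_
    · rw [← intervalIntegrable_iff_integrableOn_Ioc_of_le hs.le]
      exact (intervalIntegral.intervalIntegrable_rpow' (by linarith)).const_mul _
    · have hx1 : x ≤ 1 / 2 := hx.2.trans hs2
      have hp : 0 < x ∧ x < 1 := ⟨hx.1, by linarith⟩
      rw [betaPDFReal, if_pos hp]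
      have h3 : min 1 ((1 / 2 : ℝ) ^ (d - 1)) ≤ (1 - x) ^ (d - 1) := by
        rcases le_total 0 (d - 1) with h | h
        · exact (min_le_right _ _).trans
            (Real.rpow_le_rpow (by norm_num) (by linarith) h)
        · exact (min_le_left _ _).trans
            (Real.one_le_rpow_of_pos_of_le_one_of_nonpos (by linarith) (by linarith [hx.1]) h)
      have h4 : Real.exp (-1) ≤ Real.exp (-y * x) := by
        apply Real.exp_le_exp.2
        have := mul_le_mul_of_nonneg_left hx.2 hy0.le
        have h5 : y * (1 / 2 * y⁻¹) = 1 / 2 := by field_simp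
        linarith
      have h7 : 0 ≤ (1 - x) ^ (d - 1) := Real.rpow_nonneg (by linarith) _
      have h6 : 0 ≤ x ^ (a - 1) := Real.rpow_nonneg hx.1.le _
      calc C * x ^ (a - 1)
          = 1 / beta a d * x ^ (a - 1) * (min 1 ((1 / 2 : ℝ) ^ (d - 1)) * Real.exp (-1)) := by
            rw [hC]; ring
        _ ≤ 1 / beta a d * x ^ (a - 1) * ((1 - x) ^ (d - 1) * Real.exp (-y * x)) := by
            gcongr
        _ = _ := by ring
  have h2 : ∫ x in Ioc 0 (1 / 2 * y⁻¹), betaPDFReal a d x * Real.exp (-y * x) ≤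
      ∫ x, betaPDFReal a d x * Real.exp (-y * x) :=
    setIntegral_le_integral hintg (Eventually.of_forall fun x =>
      mul_nonneg (betaPDFReal_nonneg ha hd x) (Real.exp_pos _).le)
  refine le_trans (le_of_eq ?_) (h1.trans h2)
  rw [← intervalIntegral.integral_of_le hs.le, intervalIntegral.integral_const_mul,
    integral_rpow (Or.inl (by linarith))]
  rw [sub_add_cancel, Real.zero_rpow ha.ne', Real.mul_rpow (by norm_num) (by positivity),
    Real.inv_rpow hy0.le, Real.rpow_neg hy0.le]
  ring

end BetaMoments

section ExpMoments

open MeasureTheory ProbabilityTheory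

variable {Ω : Type*} [MeasurableSpace Ω]

/-- The `j`-th complex derivative of the moment generating function of `X`. -/
noncomputable def expMoment (m : Measure Ω) (X : Ω → ℝ) (j : ℕ) (z : ℂ) : ℂ :=
  ∫ ω, (X ω : ℂ) ^ j * Complex.exp (z * X ω) ∂m

variable {m : Measure Ω} {X : Ω → ℝ}

theorem norm_expMoment_zero_conj (z : ℂ) :
    ‖expMoment m X 0 (starRingEnd ℂ z)‖ = ‖expMoment m X 0 z‖ := by
  have h : expMoment m X 0 (starRingEnd ℂ z) = starRingEnd ℂ (expMoment m X 0 z) := by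
    rw [expMoment, expMoment, ← integral_conj]
    refine integral_congr_ae (Eventually.of_forall fun ω => ?_)
    simp [← Complex.exp_conj]
  rw [h, Complex.norm_conj]

theorem expMoment_zero_ofReal (y : ℝ) :
    expMoment m X 0 (y : ℂ) = ((∫ ω, Real.exp (y * X ω) ∂m : ℝ) : ℂ) := by
  rw [expMoment, ← integral_complex_ofReal]
  refine integral_congr_ae (Eventually.of_forall fun ω => ?_)
  push_cast
  rw [pow_zero, one_mul]

variable [IsProbabilityMeasure m]

theorem hasDerivAt_expMoment (hX : AEMeasurable X m) (h01 : ∀ᵐ ω ∂m, X ω ∈ Icc (0 : ℝ) 1)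
    (j : ℕ) (z : ℂ) : HasDerivAt (expMoment m X j) (expMoment m X (j + 1) z) z := by
  have h : integrableExpSet X m = univ := by
    refine eq_univ_of_forall fun t => ?_
    refine Integrable.of_bound (by fun_prop) (Real.exp |t|) ?_
    filter_upwards [h01] with ω hω
    rw [Real.norm_eq_abs, Real.abs_exp, Real.exp_le_exp]
    calc t * X ω ≤ |t| * X ω := mul_le_mul_of_nonneg_right (le_abs_self t) hω.1
      _ ≤ |t| * 1 := mul_le_mul_of_nonneg_left hω.2 (abs_nonneg t)
      _ = |t| := mul_one _
  exact hasDerivAt_integral_pow_mul_exp (by simp [h]) j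

theorem hasSum_expMoment (hX : AEMeasurable X m) (h01 : ∀ᵐ ω ∂m, X ω ∈ Icc (0 : ℝ) 1)
    (j : ℕ) (z : ℂ) :
    HasSum (fun k : ℕ => z ^ k / (k.factorial : ℂ) * ((∫ ω, X ω ^ (k + j) ∂m : ℝ) : ℂ))
      (expMoment m X j z) := by
  have hsum : Summable fun k : ℕ => ‖z‖ ^ k / (k.factorial : ℝ) := Real.summable_pow_div_factorial _
  have key : HasSum (fun k : ℕ => ∫ ω, z ^ k / (k.factorial : ℂ) * ((X ω ^ (k + j) : ℝ) : ℂ) ∂m)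
      (expMoment m X j z) := by
    refine hasSum_integral_of_dominated_convergence
      (fun (k : ℕ) _ => ‖z‖ ^ k / (k.factorial : ℝ)) (fun k => by fun_prop) (fun k => ?_)
      (Eventually.of_forall fun _ => hsum) (integrable_const _) (Eventually.of_forall fun ω => ?_)
    · filter_upwards [h01] with ω hω
      have h1 : |X ω| ^ (k + j) ≤ 1 := by
        rw [abs_of_nonneg hω.1]
        exact pow_le_one₀ hω.1 hω.2
      rw [norm_mul, norm_div, norm_pow, Complex.norm_natCast, Complex.norm_real, norm_pow,
        Real.norm_eq_abs]
      exact mul_le_of_le_one_right (by positivity) h1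
    · have h2 := (NormedSpace.expSeries_div_hasSum_exp (z * (X ω : ℂ))).mul_left ((X ω : ℂ) ^ j)
      rw [← Complex.exp_eq_exp_ℂ] at h2
      refine h2.congr_fun fun k => ?_
      push_cast
      ring
  refine key.congr_fun fun k => ?_
  rw [integral_const_mul, integral_complex_ofReal]

theorem hasSum_exp_series_mul {s : ℕ → ℂ} {z v : ℂ}
    (h : HasSum (fun k : ℕ => z ^ k / (k.factorial : ℂ) * s (k + 1)) v) :
    HasSum (fun k : ℕ => z ^ k / (k.factorial : ℂ) * (k * s k)) (z * v) := by
  have h2 := HasSum.zero_add (f := fun k : ℕ => z ^ k / (k.factorial : ℂ) * (k * s k))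
    (m := z * v) <| (h.mul_left z).congr_fun fun k => by
      have h3 : (k.factorial : ℂ) ≠ 0 := by exact_mod_cast k.factorial_ne_zero
      have h4 : (k : ℂ) + 1 ≠ 0 := by exact_mod_cast k.succ_ne_zero
      rw [Nat.factorial_succ]
      push_cast
      field_simp
      ring
  have h0 : z ^ 0 / (Nat.factorial 0 : ℂ) * (((0 : ℕ) : ℂ) * s 0) + z * v = z * v := by
    rw [Nat.cast_zero, zero_mul, mul_zero, zero_add]
  rw [← h0]
  exact h2

theorem expMoment_ode (hX : AEMeasurable X m) (h01 : ∀ᵐ ω ∂m, X ω ∈ Icc (0 : ℝ) 1)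
    {a₁ a₂ b₁ b₂ : ℝ}
    (hrec : ∀ k : ℕ, (k + b₁) * (k + b₂) * ∫ ω, X ω ^ (k + 1) ∂m =
      (k + a₁) * (k + a₂) * ∫ ω, X ω ^ k ∂m) (z : ℂ) :
    z ^ 2 * expMoment m X 3 z + (b₁ + b₂ + 1) * z * expMoment m X 2 z
        + b₁ * b₂ * expMoment m X 1 z =
      z ^ 2 * expMoment m X 2 z + (a₁ + a₂ + 1) * z * expMoment m X 1 z
        + a₁ * a₂ * expMoment m X 0 z := by
  set M : ℕ → ℂ := fun k => ((∫ ω, X ω ^ k ∂m : ℝ) : ℂ) with hM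
  have hS : ∀ j, HasSum (fun k : ℕ => z ^ k / (k.factorial : ℂ) * M (k + j))
      (expMoment m X j z) := fun j => hasSum_expMoment hX h01 j z
  have hS1 : ∀ j, HasSum (fun k : ℕ => z ^ k / (k.factorial : ℂ) * (k * M (k + j)))
      (z * expMoment m X (j + 1) z) := fun j => by
    refine hasSum_exp_series_mul (s := fun k => M (k + j)) ((hS (j + 1)).congr_fun fun k => ?_)
    rw [add_right_comm, add_assoc]
  have hS2 : ∀ j, HasSum (fun k : ℕ => z ^ k / (k.factorial : ℂ) * (k * ((k - 1) * M (k + j))))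
      (z * (z * expMoment m X (j + 2) z)) := fun j => by
    refine hasSum_exp_series_mul (s := fun k => (k - 1) * M (k + j))
      ((hS1 (j + 1)).congr_fun fun k => ?_)
    rw [add_right_comm, add_assoc]
    push_cast
    ring
  have hL := ((hS2 1).add ((hS1 1).mul_left ((b₁ : ℂ) + b₂ + 1))).add
    ((hS 1).mul_left ((b₁ : ℂ) * b₂))
  have hR := ((hS2 0).add ((hS1 0).mul_left ((a₁ : ℂ) + a₂ + 1))).add
    ((hS 0).mul_left ((a₁ : ℂ) * a₂))
  have hLR := hL.unique (hR.congr_fun fun k => by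
    have h1 : ((k : ℂ) + b₁) * (k + b₂) * M (k + 1) = (k + a₁) * (k + a₂) * M k := by
      simp only [hM]
      exact_mod_cast hrec k
    simp only [add_zero]
    linear_combination (z ^ k / (k.factorial : ℂ)) * h1)
  linear_combination hLR

theorem norm_expMoment_zero_le_one (h01 : ∀ᵐ ω ∂m, X ω ∈ Icc (0 : ℝ) 1)
    {z : ℂ} (hz : z.re ≤ 0) : ‖expMoment m X 0 z‖ ≤ 1 := by
  have h := norm_integral_le_of_norm_le_const (μ := m) (C := 1)
    (f := fun ω => (X ω : ℂ) ^ 0 * Complex.exp (z * X ω)) (by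
      filter_upwards [h01] with ω hω
      rw [pow_zero, one_mul, Complex.norm_exp, Real.exp_le_one_iff, Complex.re_mul_ofReal]
      exact mul_nonpos_of_nonpos_of_nonneg hz hω.1)
  simpa [expMoment] using h

/-- Polynomial decay of the characteristic function of a `[0, 1]`-valued random variable forces the
same decay of its Laplace transform, by the Phragmén–Lindelöf principle. -/
theorem exists_integral_exp_le_of_norm_expMoment_le (hX : AEMeasurable X m)
    (h01 : ∀ᵐ ω ∂m, X ω ∈ Icc (0 : ℝ) 1) {q K ω₀ : ℝ} (hq : 0 ≤ q) (hω₀ : ω₀ ≠ 0)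
    (hdecay : ∀ t : ℝ, 1 ≤ t → ‖expMoment m X 0 (-(Complex.I * ω₀) * t)‖ ≤ K * t ^ (-q)) :
    ∃ C : ℝ, ∀ y : ℝ, 0 ≤ y → (1 + y) ^ q * ∫ ω, Real.exp (-y * X ω) ∂m ≤ C := by
  have hline : ∃ C : ℝ, ∀ x : ℝ,
      ‖1 + (x : ℂ) * Complex.I‖ ^ q * ‖expMoment m X 0 (-((x : ℂ) * Complex.I))‖ ≤ C := by
    have hsymm : ∀ x : ℝ, ‖expMoment m X 0 (-((x : ℂ) * Complex.I))‖ =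
        ‖expMoment m X 0 (-(Complex.I * ω₀) * ((|x| / |ω₀| : ℝ) : ℂ))‖ := by
      intro x
      have hω' : |ω₀| ≠ 0 := abs_ne_zero.2 hω₀
      have hc : -(Complex.I * ω₀) * ((|x| / |ω₀| : ℝ) : ℂ) =
          -(((ω₀ * (|x| / |ω₀|) : ℝ) : ℂ) * Complex.I) := by push_cast; ring
      rw [hc]
      have habs : x = ω₀ * (|x| / |ω₀|) ∨ x = -(ω₀ * (|x| / |ω₀|)) := by
        apply abs_eq_abs.1
        rw [abs_mul, abs_div, abs_abs, abs_abs]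
        field_simp
      rcases habs with h | h
      · rw [← h]
      · rw [← norm_expMoment_zero_conj]
        congr 2
        conv_lhs => rw [h]
        simp
    refine ⟨max ((1 + |ω₀|) ^ q) ((1 + |ω₀|) ^ q * K), fun x => ?_⟩
    have hωpos : 0 < |ω₀| := abs_pos.2 hω₀
    have hn : ‖1 + (x : ℂ) * Complex.I‖ ≤ 1 + |x| := by
      refine (norm_add_le _ _).trans ?_
      simp
    rcases le_total |x| |ω₀| with h | h
    · refine le_trans ?_ (le_max_left _ _)
      have h1 := norm_expMoment_zero_le_one (m := m) h01 (z := -((x : ℂ) * Complex.I)) (by simp)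
      refine (mul_le_of_le_one_right (by positivity) h1).trans ?_
      gcongr
      linarith
    · refine le_trans ?_ (le_max_right _ _)
      rw [hsymm]
      have ht : 1 ≤ |x| / |ω₀| := (one_le_div hωpos).2 h
      have ht0 : 0 < |x| / |ω₀| := by linarith
      have h1 : 1 + |x| ≤ (1 + |ω₀|) * (|x| / |ω₀|) := by
        have : |ω₀| * (|x| / |ω₀|) = |x| := by field_simp
        nlinarith
      have hD := hdecay _ ht
      calc ‖1 + (x : ℂ) * Complex.I‖ ^ q * _
          ≤ ((1 + |ω₀|) * (|x| / |ω₀|)) ^ q * (K * (|x| / |ω₀|) ^ (-q)) := by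
            gcongr
            exact hn.trans h1
        _ = (1 + |ω₀|) ^ q * K := by
            rw [Real.mul_rpow (by positivity) ht0.le, Real.rpow_neg ht0.le]
            have := (Real.rpow_pos_of_pos ht0 q).ne'
            field_simp
  obtain ⟨C, hC⟩ := hline
  refine ⟨C, fun y hy => ?_⟩
  have hPL : ∀ ε : ℝ, 0 < ε →
      Real.exp (-ε * y) * ((1 + y) ^ q * ∫ ω, Real.exp (-y * X ω) ∂m) ≤ C := by
    intro ε hε
    set G : ℂ → ℂ := fun z =>
      Complex.exp (-ε * z) * ((1 + z) ^ (q : ℂ) * expMoment m X 0 (-z)) with hG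
    have hGn : ∀ z : ℂ, ‖G z‖ =
        Real.exp (-ε * z.re) * (‖1 + z‖ ^ q * ‖expMoment m X 0 (-z)‖) := by
      intro z
      simp only [hG]
      rw [norm_mul, norm_mul, Complex.norm_cpow_real, Complex.norm_exp]
      simp
    have hGle : ∀ z : ℂ, 0 ≤ z.re → ‖G z‖ ≤ Real.exp (-ε * z.re) * (1 + ‖z‖) ^ q := by
      intro z hz
      rw [hGn]
      have h1 := norm_expMoment_zero_le_one (m := m) h01 (z := -z) (by simpa using hz)
      have h2 : ‖1 + z‖ ≤ 1 + ‖z‖ := (norm_add_le _ _).trans (by simp)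
      gcongr
      exact (mul_le_of_le_one_right (by positivity) h1).trans (by gcongr)
    have hmem : ∀ z : ℂ, 0 ≤ z.re → 1 + z ∈ Complex.slitPlane := fun z hz => by
      rw [Complex.mem_slitPlane_iff]
      left
      simp only [Complex.add_re, Complex.one_re]
      linarith
    have hGd : ∀ z : ℂ, 0 ≤ z.re → DifferentiableAt ℂ G z := by
      intro z hz
      have h1 : DifferentiableAt ℂ (fun z : ℂ => expMoment m X 0 (-z)) z :=
        ((hasDerivAt_expMoment hX h01 0 (-z)).differentiableAt).comp z
          differentiableAt_id.neg
      have h2 : DifferentiableAt ℂ (fun z : ℂ => (1 + z) ^ (q : ℂ)) z :=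
        DifferentiableAt.cpow (by fun_prop) (by fun_prop) (hmem z hz)
      exact DifferentiableAt.mul (by fun_prop) (h2.mul h1)
    have hres := PhragmenLindelof.right_half_plane_of_tendsto_zero_on_real (f := G) (C := C)
      (z := (y : ℂ)) ?_ ?_ ?_ ?_ (by simpa using hy)
    · rw [hGn, ← Complex.ofReal_neg, expMoment_zero_ofReal, Complex.norm_real] at hres
      have h1 : ‖(1 : ℂ) + y‖ = 1 + y := by
        rw [← Complex.ofReal_one, ← Complex.ofReal_add, Complex.norm_real, Real.norm_eq_abs,
          abs_of_nonneg (by linarith)]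
      rw [h1, Complex.ofReal_re, Real.norm_eq_abs,
        abs_of_nonneg (integral_nonneg fun ω => (Real.exp_pos _).le)] at hres
      exact hres
    · refine ⟨fun z hz => (hGd z (le_of_lt hz)).differentiableWithinAt, fun z hz => ?_⟩
      rw [Complex.closure_setOfPred_lt_re] at hz
      exact (hGd z hz).continuousAt.continuousWithinAt
    · refine ⟨1, by norm_num, q, ?_⟩
      refine Asymptotics.IsBigO.of_bound 1 ?_
      rw [eventually_inf_principal]
      refine Eventually.of_forall fun z hz => ?_
      have hz' : 0 ≤ z.re := le_of_lt hz
      rw [one_mul, Real.norm_eq_abs, Real.abs_exp, Real.rpow_one]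
      refine (hGle z hz').trans ?_
      have h1 : Real.exp (-ε * z.re) ≤ 1 := by
        rw [Real.exp_le_one_iff]
        nlinarith
      refine (mul_le_of_le_one_left (by positivity) h1).trans ?_
      rw [mul_comm q, Real.exp_mul]
      gcongr
      linarith [Real.add_one_le_exp ‖z‖]
    · rw [tendsto_zero_iff_norm_tendsto_zero]
      have h1 := (tendsto_rpow_mul_exp_neg_mul_atTop_nhds_zero q ε hε).const_mul ((2 : ℝ) ^ q)
      rw [mul_zero] at h1
      refine squeeze_zero' (Eventually.of_forall fun x => norm_nonneg _) ?_ h1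
      filter_upwards [eventually_ge_atTop 1] with x hx
      refine (hGle x (by simp; linarith)).trans ?_
      rw [Complex.ofReal_re, Complex.norm_real, Real.norm_eq_abs, abs_of_nonneg (by linarith),
        ← mul_assoc, ← Real.mul_rpow (by norm_num) (by linarith), mul_comm]
      gcongr
      linarith
    · intro x
      rw [hGn]
      simpa using hC x
  have hlim : Tendsto (fun ε : ℝ =>
      Real.exp (-ε * y) * ((1 + y) ^ q * ∫ ω, Real.exp (-y * X ω) ∂m)) (𝓝[>] 0)
      (𝓝 ((1 + y) ^ q * ∫ ω, Real.exp (-y * X ω) ∂m)) := by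
    refine Tendsto.mono_left ?_ nhdsWithin_le_nhds
    exact Continuous.tendsto' (by fun_prop) _ _ (by simp)
  refine le_of_tendsto hlim ?_
  filter_upwards [self_mem_nhdsWithin] with ε hε using hPL ε hε

end ExpMoments

section Hypergeometric

open MeasureTheory ProbabilityTheory

/-- The entire solution `₂F₂(a₁, a₂; b₁, b₂; ·)` of the confluent hypergeometric equation of order
three, with its slow decay along imaginary rays. -/
theorem exists_hypergeometric {a₁ a₂ b₁ b₂ : ℝ} (ha₁ : 0 < a₁) (ha₂ : 0 < a₂) (hb₁ : a₁ < b₁)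
    (hb₂ : a₂ < b₂) :
    ∃ H : ℕ → ℂ → ℂ, (∀ j z, HasDerivAt (H j) (H (j + 1) z) z) ∧ H 0 0 = 1 ∧
      (∀ z, z ^ 2 * H 3 z + (b₁ + b₂ + 1) * z * H 2 z + b₁ * b₂ * H 1 z =
        z ^ 2 * H 2 z + (a₁ + a₂ + 1) * z * H 1 z + a₁ * a₂ * H 0 z) ∧
      ∀ q K ω : ℝ, a₂ < q → ω ≠ 0 →
        ¬ ∀ t : ℝ, 1 ≤ t → ‖H 0 (-(Complex.I * ω) * t)‖ ≤ K * t ^ (-q) := by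
  have hd₁ : 0 < b₁ - a₁ := sub_pos.2 hb₁
  have hd₂ : 0 < b₂ - a₂ := sub_pos.2 hb₂
  have hP₁ := isProbabilityMeasureBeta ha₁ hd₁
  have hP₂ := isProbabilityMeasureBeta ha₂ hd₂
  set m₁ := betaMeasure a₁ (b₁ - a₁) with hm₁
  set m₂ := betaMeasure a₂ (b₂ - a₂) with hm₂
  set X : ℝ × ℝ → ℝ := fun p => p.1 * p.2 with hXdef
  have hX : AEMeasurable X (m₁.prod m₂) := by fun_prop
  have h1 : ∀ᵐ p ∂m₁.prod m₂, p.1 ∈ Ioo (0 : ℝ) 1 :=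
    Measure.quasiMeasurePreserving_fst.ae (ae_mem_Ioo_betaMeasure a₁ (b₁ - a₁))
  have h2 : ∀ᵐ p ∂m₁.prod m₂, p.2 ∈ Ioo (0 : ℝ) 1 :=
    Measure.quasiMeasurePreserving_snd.ae (ae_mem_Ioo_betaMeasure a₂ (b₂ - a₂))
  have h01 : ∀ᵐ p ∂m₁.prod m₂, X p ∈ Icc (0 : ℝ) 1 := by
    filter_upwards [h1, h2] with p hp hp'
    exact ⟨(mul_pos hp.1 hp'.1).le, mul_le_one₀ hp.2.le hp'.1.le hp'.2.le⟩
  have hmom : ∀ k : ℕ, ∫ p, X p ^ k ∂m₁.prod m₂ = (∫ x, x ^ k ∂m₁) * ∫ x, x ^ k ∂m₂ := by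
    intro k
    rw [← integral_prod_mul]
    simp only [hXdef, mul_pow]
  have hrec : ∀ k : ℕ, (k + b₁) * (k + b₂) * ∫ p, X p ^ (k + 1) ∂m₁.prod m₂ =
      (k + a₁) * (k + a₂) * ∫ p, X p ^ k ∂m₁.prod m₂ := by
    intro k
    have e1 := integral_pow_succ_betaMeasure ha₁ hd₁ k
    have e2 := integral_pow_succ_betaMeasure ha₂ hd₂ k
    rw [← hm₁] at e1
    rw [← hm₂] at e2
    rw [hmom, hmom]
    calc _ = ((a₁ + (b₁ - a₁) + k) * ∫ x, x ^ (k + 1) ∂m₁) *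
          ((a₂ + (b₂ - a₂) + k) * ∫ x, x ^ (k + 1) ∂m₂) := by ring
      _ = _ := by rw [e1, e2]; ring
  refine ⟨expMoment (m₁.prod m₂) X, fun j z => hasDerivAt_expMoment hX h01 j z, ?_,
    expMoment_ode hX h01 hrec, fun q K ω hq hω hdecay => ?_⟩
  · simp [expMoment]
  obtain ⟨C, hC⟩ := exists_integral_exp_le_of_norm_expMoment_le hX h01 (by linarith) hω hdecay
  obtain ⟨c, hc, hlow⟩ := exists_le_integral_exp_betaMeasure ha₂ hd₂
  have hmono : ∀ y : ℝ, 0 ≤ y →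
      ∫ x, Real.exp (-y * x) ∂m₂ ≤ ∫ p, Real.exp (-y * X p) ∂m₁.prod m₂ := by
    intro y hy
    have e1 : ∫ x, Real.exp (-y * x) ∂m₂ = ∫ p, Real.exp (-y * p.2) ∂m₁.prod m₂ := by
      rw [integral_fun_snd (fun x => Real.exp (-y * x))]
      simp
    rw [e1]
    refine integral_mono_ae ?_ ?_ ?_
    · refine Integrable.of_bound (by fun_prop) 1 ?_
      filter_upwards [h2] with p hp
      rw [Real.norm_eq_abs, Real.abs_exp, Real.exp_le_one_iff]
      nlinarith [hp.1]
    · refine Integrable.of_bound (by fun_prop) 1 ?_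
      filter_upwards [h01] with p hp
      rw [Real.norm_eq_abs, Real.abs_exp, Real.exp_le_one_iff]
      nlinarith [hp.1]
    · filter_upwards [h1, h2] with p hp hp'
      apply Real.exp_le_exp.2
      have : p.1 * p.2 ≤ p.2 := mul_le_of_le_one_left hp'.1.le hp.2.le
      simp only [hXdef]
      nlinarith
  have hbd : ∀ y : ℝ, 1 ≤ y → c * y ^ (q - a₂) ≤ C := by
    intro y hy
    have hy0 : 0 < y := by linarith
    calc c * y ^ (q - a₂) = y ^ q * (c * y ^ (-a₂)) := by
          rw [sub_eq_add_neg, Real.rpow_add hy0]; ring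
      _ ≤ (1 + y) ^ q * ∫ p, Real.exp (-y * X p) ∂m₁.prod m₂ := by
          gcongr
          · linarith
          · linarith
          · exact (hlow y hy).trans (hmono y hy0.le)
      _ ≤ C := hC y hy0.le
  have hT : Tendsto (fun y : ℝ => c * y ^ (q - a₂)) atTop atTop :=
    (tendsto_rpow_atTop (sub_pos.2 hq)).const_mul_atTop hc
  obtain ⟨y, hy1, hy2⟩ := ((hT.eventually_gt_atTop C).and (eventually_ge_atTop 1)).exists
  exact absurd (hbd y hy2) (not_le.2 hy1)

end Hypergeometric

section ModeSystem

/-- The first order system satisfied by the `ω`-th angular mode, conjugated by `exp (iωβ)`. -/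
structure ModeSol (ω p r c : ℝ) (F h K : ℝ → ℂ) : Prop where
  hasDerivAt_fst : ∀ β : ℝ, 0 < β →
    HasDerivAt F ((h β - F β) / β - Complex.I * ω * F β) β
  hasDerivAt_snd : ∀ β : ℝ, 0 < β → HasDerivAt h ((r * h β + K β) / β) β
  hasDerivAt_trd : ∀ β : ℝ, 0 < β →
    HasDerivAt K ((p * K β + -(Complex.I * ω * c * β * F β)) / β) β

variable {ω p r c : ℝ} {F h K F' h' K' : ℝ → ℂ}

theorem ModeSol.sub_mul (s : ModeSol ω p r c F h K) (s' : ModeSol ω p r c F' h' K') (a : ℂ) :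
    ModeSol ω p r c (fun β => F β - a * F' β) (fun β => h β - a * h' β)
      (fun β => K β - a * K' β) where
  hasDerivAt_fst β hβ := by
    convert! (s.hasDerivAt_fst β hβ).sub ((s'.hasDerivAt_fst β hβ).const_mul a) using 1
    ring
  hasDerivAt_snd β hβ := by
    convert! (s.hasDerivAt_snd β hβ).sub ((s'.hasDerivAt_snd β hβ).const_mul a) using 1
    ring
  hasDerivAt_trd β hβ := by
    convert! (s.hasDerivAt_trd β hβ).sub ((s'.hasDerivAt_trd β hβ).const_mul a) using 1
    ring

theorem ModeSol.eq_zero_of_le (s : ModeSol ω p r c F h K) {a b : ℝ} (ha : 0 < a) (hab : a ≤ b)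
    (hF : F a = 0) (hh : h a = 0) (hK : K a = 0) : F b = 0 := by
  set Y : ℝ → ℂ × ℂ × ℂ := fun β => (F β, h β, K β) with hY
  set Y' : ℝ → ℂ × ℂ × ℂ := fun β => ((h β - F β) / β - Complex.I * ω * F β,
    (r * h β + K β) / β, (p * K β + -(Complex.I * ω * c * β * F β)) / β) with hY'
  have hd : ∀ β, 0 < β → HasDerivAt Y (Y' β) β := fun β hβ =>
    (s.hasDerivAt_fst β hβ).prodMk ((s.hasDerivAt_snd β hβ).prodMk (s.hasDerivAt_trd β hβ))
  set C : ℝ := (2 / a + |ω|) + (|r| + 1) / a + (|p| / a + |ω| * |c|) with hC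
  have hbound : ∀ β ∈ Ico a b, ‖Y' β‖ ≤ C * ‖Y β‖ + 0 := by
    intro β hβ
    have hβ0 : 0 < β := ha.trans_le hβ.1
    have hβn : ‖(β : ℂ)‖ = β := by
      rw [Complex.norm_real, Real.norm_eq_abs, abs_of_pos hβ0]
    have nF : ‖F β‖ ≤ ‖Y β‖ := norm_fst_le (Y β)
    have nh : ‖h β‖ ≤ ‖Y β‖ := (norm_fst_le (Y β).2).trans (norm_snd_le (Y β))
    have nK : ‖K β‖ ≤ ‖Y β‖ := (norm_snd_le (Y β).2).trans (norm_snd_le (Y β))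
    set n := ‖Y β‖ with hn
    have hn0 : 0 ≤ n := norm_nonneg _
    have hdiv : ∀ x : ℝ, 0 ≤ x → x / β ≤ x / a := fun x hx =>
      div_le_div_of_nonneg_left hx ha hβ.1
    have e1 : ‖(h β - F β) / β - Complex.I * ω * F β‖ ≤ (2 / a + |ω|) * n := by
      calc _ ≤ ‖(h β - F β) / β‖ + ‖Complex.I * ω * F β‖ := norm_sub_le _ _
        _ ≤ (n + n) / a + |ω| * n := by
          rw [norm_div, hβn, norm_mul, norm_mul, Complex.norm_I, one_mul, Complex.norm_real,
            Real.norm_eq_abs]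
          gcongr
          · exact (norm_sub_le _ _).trans (add_le_add nh nF)
          · exact hβ.1
        _ = _ := by ring
    have e2 : ‖(r * h β + K β) / β‖ ≤ ((|r| + 1) / a) * n := by
      calc _ ≤ (|r| * n + n) / a := by
            rw [norm_div, hβn]
            gcongr
            · refine (norm_add_le _ _).trans (add_le_add ?_ nK)
              rw [norm_mul, Complex.norm_real, Real.norm_eq_abs]
              gcongr
            · exact hβ.1
        _ = _ := by ring
    have e3 : ‖(p * K β + -(Complex.I * ω * c * β * F β)) / β‖ ≤ (|p| / a + |ω| * |c|) * n := by
      have : (p * K β + -(Complex.I * ω * c * β * F β)) / β =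
          p * K β / β - Complex.I * ω * c * F β := by
        have : (β : ℂ) ≠ 0 := by exact_mod_cast hβ0.ne'
        field_simp
        ring
      rw [this]
      calc _ ≤ ‖p * K β / β‖ + ‖Complex.I * ω * c * F β‖ := norm_sub_le _ _
        _ ≤ |p| * n / a + |ω| * |c| * n := by
          rw [norm_div, hβn, norm_mul, norm_mul, norm_mul, norm_mul, Complex.norm_I, one_mul,
            Complex.norm_real, Complex.norm_real, Complex.norm_real, Real.norm_eq_abs,
            Real.norm_eq_abs, Real.norm_eq_abs]
          gcongr
          exact hβ.1
        _ = _ := by ring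
    have p1 : 0 ≤ (2 / a + |ω|) * n := by positivity
    have p2 : 0 ≤ ((|r| + 1) / a) * n := by positivity
    have p3 : 0 ≤ (|p| / a + |ω| * |c|) * n := by positivity
    have hCn : C * n + 0 = (2 / a + |ω|) * n + ((|r| + 1) / a) * n + (|p| / a + |ω| * |c|) * n := by
      rw [hC]; ring
    rw [hCn]
    refine max_le ?_ (max_le ?_ ?_)
    · exact e1.trans (by linarith)
    · exact e2.trans (by linarith)
    · exact e3.trans (by linarith)
  have key := norm_le_gronwallBound_of_norm_deriv_right_le (f := Y) (f' := Y') (δ := 0)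
    (fun β hβ => (hd β (ha.trans_le hβ.1)).continuousAt.continuousWithinAt)
    (fun β hβ => (hd β (ha.trans_le hβ.1)).hasDerivWithinAt)
    (by simp [hY, hF, hh, hK]) hbound b ⟨hab, le_rfl⟩
  rw [gronwallBound_ε0_δ0] at key
  exact norm_le_zero_iff.1 ((norm_fst_le (Y b)).trans key)

theorem norm_sub_le_sub_of_norm_deriv_le {u u' : ℝ → ℂ} {B B' : ℝ → ℝ} {a b : ℝ} (hab : a ≤ b)
    (hu : ∀ t ∈ Icc a b, HasDerivAt u (u' t) t) (hB : ∀ t ∈ Icc a b, HasDerivAt B (B' t) t)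
    (hle : ∀ t ∈ Icc a b, ‖u' t‖ ≤ B' t) : ‖u b - u a‖ ≤ B b - B a :=
  image_norm_le_of_norm_deriv_right_le_deriv_boundary' (f := fun t => u t - u a) (f' := u')
    (B := fun t => B t - B a) (B' := B')
    (fun t ht => ((hu t ht).sub_const _).continuousAt.continuousWithinAt)
    (fun t ht => ((hu t (Ico_subset_Icc_self ht)).sub_const _).hasDerivWithinAt) (by simp)
    (fun t ht => ((hB t ht).sub_const _).continuousAt.continuousWithinAt)
    (fun t ht => ((hB t (Ico_subset_Icc_self ht)).sub_const _).hasDerivWithinAt)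
    (fun t ht => hle t (Ico_subset_Icc_self ht)) ⟨hab, le_rfl⟩

theorem hasDerivAt_rpow_neg_mul {v : ℝ → ℂ} {k : ℂ} {r β : ℝ} (hβ : 0 < β)
    (hv : HasDerivAt v ((r * v β + k) / β) β) :
    HasDerivAt (fun t : ℝ => ((t ^ (-r) : ℝ) : ℂ) * v t) (((β ^ (-r - 1) : ℝ) : ℂ) * k) β := by
  have h1 : HasDerivAt (fun t : ℝ => ((t ^ (-r) : ℝ) : ℂ)) ((-r * β ^ (-r - 1) : ℝ) : ℂ) β :=
    (Real.hasDerivAt_rpow_const (Or.inl hβ.ne')).ofReal_comp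
  convert! h1.mul hv using 1
  have h2 : β ^ (-r) = β ^ (-r - 1) * β := by
    rw [← Real.rpow_add_one hβ.ne', sub_add_cancel]
  have h3 : (β : ℂ) ≠ 0 := by exact_mod_cast hβ.ne'
  rw [h2]
  push_cast
  field_simp
  ring

theorem norm_rpow_neg_mul {r β : ℝ} (hβ : 0 < β) (v : ℂ) :
    ‖((β ^ (-r) : ℝ) : ℂ) * v‖ = β ^ (-r) * ‖v‖ := by
  rw [norm_mul, Complex.norm_real, Real.norm_eq_abs, abs_of_pos (Real.rpow_pos_of_pos hβ _)]

theorem hasDerivAt_const_mul_rpow_div {A s t : ℝ} (ht : 0 < t) (hs : s ≠ 0) :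
    HasDerivAt (fun t : ℝ => A * t ^ s / s) (A * t ^ (s - 1)) t := by
  convert! ((Real.hasDerivAt_rpow_const (p := s) (Or.inl ht.ne')).const_mul A).div_const s using 1
  field_simp

theorem ModeSol.norm_trd_le (s : ModeSol ω p r c F h K) (hp : 1 < p) {b M : ℝ} (hM : 0 ≤ M)
    (hF : ∀ β ∈ Ioc 0 b, ‖F β‖ ≤ M) (hK : K b = 0) {β : ℝ} (hβ : β ∈ Ioc 0 b) :
    ‖K β‖ ≤ |ω| * |c| / (p - 1) * M * β := by
  have hp1 : 0 < p - 1 := by linarith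
  have key := norm_sub_le_sub_of_norm_deriv_le (a := β) (b := b) hβ.2
    (u := fun t : ℝ => ((t ^ (-p) : ℝ) : ℂ) * K t)
    (B := fun t : ℝ => (|ω| * |c| * M) * t ^ (1 - p) / (1 - p))
    (fun t ht => hasDerivAt_rpow_neg_mul (hβ.1.trans_le ht.1)
      (s.hasDerivAt_trd t (hβ.1.trans_le ht.1)))
    (fun t ht => hasDerivAt_const_mul_rpow_div (hβ.1.trans_le ht.1) (by linarith))
    (fun t ht => by
      have ht0 : 0 < t := hβ.1.trans_le ht.1
      have h2 : t ^ (1 - p - 1) = t ^ (-p - 1) * t := by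
        rw [← Real.rpow_add_one ht0.ne']; ring_nf
      rw [show -p - 1 = -(p + 1) by ring, norm_rpow_neg_mul ht0, show -(p + 1) = -p - 1 by ring,
        norm_neg, norm_mul, norm_mul, norm_mul, norm_mul,
        Complex.norm_I, one_mul, Complex.norm_real, Complex.norm_real, Complex.norm_real,
        Real.norm_eq_abs, Real.norm_eq_abs, Real.norm_eq_abs, abs_of_pos ht0, h2]
      have h3 := hF t ⟨ht0, ht.2⟩
      calc t ^ (-p - 1) * (|ω| * |c| * t * ‖F t‖) ≤ t ^ (-p - 1) * (|ω| * |c| * t * M) := by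
            gcongr
        _ = _ := by ring)
  simp only [hK, mul_zero, zero_sub, norm_neg] at key
  rw [norm_rpow_neg_mul hβ.1] at key
  have h3 : β ^ (1 - p) = β ^ (-p) * β := by
    rw [← Real.rpow_add_one hβ.1.ne']; ring_nf
  have h4 : 0 < b ^ (1 - p) := Real.rpow_pos_of_pos (hβ.1.trans_le hβ.2) _
  have h5 : |ω| * |c| * M * b ^ (1 - p) / (1 - p) ≤ 0 :=
    div_nonpos_of_nonneg_of_nonpos (by positivity) (by linarith)
  have h6 : -(|ω| * |c| * M * β ^ (1 - p) / (1 - p)) =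
      β ^ (-p) * (|ω| * |c| / (p - 1) * M * β) := by
    rw [h3, ← neg_sub p 1, div_neg, neg_neg]
    ring
  refine le_of_mul_le_mul_left ?_ (Real.rpow_pos_of_pos hβ.1 (-p))
  linarith

theorem ModeSol.norm_snd_le_of_pos (s : ModeSol ω p r c F h K) (hr : 0 < r) {b A : ℝ}
    (hA : 0 ≤ A) (hK : ∀ β ∈ Ioc 0 b, ‖K β‖ ≤ A * β) (hh : h b = 0) {β : ℝ}
    (hβ : β ∈ Ioc 0 b) : ‖h β‖ ≤ A / r * b := by
  have hb : 0 < b := hβ.1.trans_le hβ.2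
  have key := norm_sub_le_sub_of_norm_deriv_le (a := β) (b := b) hβ.2
    (u := fun t : ℝ => ((t ^ (-r) : ℝ) : ℂ) * h t)
    (B := fun t : ℝ => (A * b) * t ^ (-r) / (-r))
    (fun t ht => hasDerivAt_rpow_neg_mul (hβ.1.trans_le ht.1)
      (s.hasDerivAt_snd t (hβ.1.trans_le ht.1)))
    (fun t ht => hasDerivAt_const_mul_rpow_div (hβ.1.trans_le ht.1) (by linarith))
    (fun t ht => by
      have ht0 : 0 < t := hβ.1.trans_le ht.1
      rw [show -r - 1 = -(r + 1) by ring, norm_rpow_neg_mul ht0, mul_comm]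
      gcongr
      exact (hK t ⟨ht0, ht.2⟩).trans (by gcongr; exact ht.2))
  simp only [hh, mul_zero, zero_sub, norm_neg] at key
  rw [norm_rpow_neg_mul hβ.1] at key
  have h4 : 0 < b ^ (-r) := Real.rpow_pos_of_pos hb _
  have h5 : A * b * b ^ (-r) / (-r) ≤ 0 :=
    div_nonpos_of_nonneg_of_nonpos (by positivity) (by linarith)
  have h6 : -(A * b * β ^ (-r) / (-r)) = β ^ (-r) * (A / r * b) := by
    rw [div_neg, neg_neg]
    ring
  refine le_of_mul_le_mul_left ?_ (Real.rpow_pos_of_pos hβ.1 (-r))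
  linarith

theorem ModeSol.norm_snd_le_of_le_neg_one (s : ModeSol ω p r c F h K) (hr : r ≤ -1) {b A M : ℝ}
    (hb : b ≤ 1) (hA : 0 ≤ A) (hK : ∀ β ∈ Ioc 0 b, ‖K β‖ ≤ A * β)
    (hF : ∀ β ∈ Ioc 0 b, ‖F β‖ ≤ M) {β : ℝ} (hβ : β ∈ Ioc 0 b) : ‖h β‖ ≤ A * b := by
  set u : ℝ → ℂ := fun t : ℝ => ((t ^ (-r) : ℝ) : ℂ) * h t with hu
  set B : ℝ → ℝ := fun t : ℝ => A * t ^ (1 - r) / (1 - r) with hB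
  have h1r : 0 < 1 - r := by linarith
  have hcmp : ∀ a, 0 < a → a ≤ β → ‖u β - u a‖ ≤ B β := by
    intro a ha haβ
    have key := norm_sub_le_sub_of_norm_deriv_le (a := a) (b := β) haβ (u := u) (B := B)
      (fun t ht => hasDerivAt_rpow_neg_mul (ha.trans_le ht.1)
        (s.hasDerivAt_snd t (ha.trans_le ht.1)))
      (fun t ht => hasDerivAt_const_mul_rpow_div (ha.trans_le ht.1) (by linarith))
      (fun t ht => by
        have ht0 : 0 < t := ha.trans_le ht.1
        have h2 : t ^ (1 - r - 1) = t ^ (-r - 1) * t := by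
          rw [← Real.rpow_add_one ht0.ne']; ring_nf
        rw [h2, show -r - 1 = -(r + 1) by ring, norm_rpow_neg_mul ht0]
        have h3 := hK t ⟨ht0, ht.2.trans hβ.2⟩
        calc _ ≤ t ^ (-(r + 1)) * (A * t) := by gcongr
          _ = _ := by ring)
    have : 0 ≤ B a := by
      simp only [hB]; positivity
    linarith
  have hmain : ‖u β‖ ≤ B β := by
    by_contra! hlt
    have hBβ : 0 ≤ B β := by
      have := hβ.1
      simp only [hB]; positivity
    set w : ℂ := starRingEnd ℂ (u β) with hw
    have hwn : ‖w‖ = ‖u β‖ := Complex.norm_conj _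
    set δ : ℝ := ‖u β‖ * (‖u β‖ - B β) with hδ
    have hδ0 : 0 < δ := mul_pos (by linarith) (by linarith)
    have hM : 0 ≤ M := (norm_nonneg _).trans (hF β hβ)
    have hre : ∀ a ∈ Ioc 0 β, δ / a ≤ (w * h a).re := by
      intro a ha
      have e1 : (w * u a).re = ‖u β‖ ^ 2 - (w * (u β - u a)).re := by
        have : (w * u β).re = ‖u β‖ ^ 2 := by
          rw [hw, ← Complex.normSq_eq_conj_mul_self, Complex.ofReal_re, Complex.normSq_eq_norm_sq]
        rw [mul_sub, Complex.sub_re, this]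
        ring
      have e2 : (w * (u β - u a)).re ≤ ‖u β‖ * B β := by
        refine (Complex.re_le_norm _).trans ?_
        rw [norm_mul, hwn]
        gcongr
        exact hcmp a ha.1 ha.2
      have e3 : δ ≤ (w * u a).re := by
        rw [e1, hδ]
        nlinarith
      have e4 : (w * u a).re = a ^ (-r) * (w * h a).re := by
        rw [← Complex.re_ofReal_mul]
        simp only [hu]
        ring_nf
      rw [e4] at e3
      have e5 : a ^ (-r) ≤ a := by
        have := Real.rpow_le_rpow_of_exponent_ge ha.1 ((ha.2.trans hβ.2).trans hb)
          (show (1 : ℝ) ≤ -r by linarith)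
        rwa [Real.rpow_one] at this
      have e6 : 0 < a ^ (-r) := Real.rpow_pos_of_pos ha.1 _
      rw [div_le_iff₀ ha.1]
      have e7 : 0 ≤ (w * h a).re := by
        by_contra! hneg
        nlinarith
      nlinarith
    set E : ℝ := ‖w‖ * |ω| * M with hE
    set ψ : ℝ → ℝ := fun a => (w * (a * F a)).re - δ * Real.log a + E * a with hψ
    have hψd : ∀ a, 0 < a → HasDerivAt ψ
        ((w * (h a - Complex.I * ω * a * F a)).re - δ * a⁻¹ + E * 1) a := by
      intro a ha
      have ha' : (a : ℂ) ≠ 0 := by exact_mod_cast ha.ne'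
      have d1 : HasDerivAt (fun a : ℝ => (a : ℂ) * F a) (h a - Complex.I * ω * a * F a) a := by
        convert! (HasDerivAt.ofReal_comp (hasDerivAt_id a)).mul (s.hasDerivAt_fst a ha) using 1
        simp only [id, Complex.ofReal_one]
        field_simp
        ring
      have d2 : HasDerivAt (fun a : ℝ => (w * (a * F a)).re)
          ((w * (h a - Complex.I * ω * a * F a)).re) a := by
        exact Complex.reCLM.hasFDerivAt.comp_hasDerivAt a (d1.const_mul w)
      exact (d2.sub ((Real.hasDerivAt_log ha.ne').const_mul δ)).add ((hasDerivAt_id a).const_mul E)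
    have hψmono : MonotoneOn ψ (Ioc 0 β) := by
      refine monotoneOn_of_deriv_nonneg (convex_Ioc 0 β)
        (fun a ha => (hψd a ha.1).continuousAt.continuousWithinAt)
        (fun a ha => ?_) (fun a ha => ?_)
      · rw [interior_Ioc] at ha
        exact (hψd a ha.1).differentiableAt.differentiableWithinAt
      · rw [interior_Ioc] at ha
        have ha' : a ∈ Ioc 0 β := Ioo_subset_Ioc_self ha
        rw [(hψd a ha.1).deriv, mul_sub, Complex.sub_re]
        have f1 := hre a ha'
        have f2 : (w * (Complex.I * ω * a * F a)).re ≤ E := by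
          refine (Complex.re_le_norm _).trans ?_
          rw [norm_mul, norm_mul, norm_mul, norm_mul, Complex.norm_I, one_mul, Complex.norm_real,
            Complex.norm_real, Real.norm_eq_abs, Real.norm_eq_abs, abs_of_pos ha.1]
          have g1 := hF a ⟨ha.1, ha'.2.trans hβ.2⟩
          have g2 : a ≤ 1 := (ha'.2.trans hβ.2).trans hb
          have g3 : a * ‖F a‖ ≤ 1 * M := mul_le_mul g2 g1 (norm_nonneg _) (by norm_num)
          calc ‖w‖ * (|ω| * a * ‖F a‖) = ‖w‖ * |ω| * (a * ‖F a‖) := by ring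
            _ ≤ ‖w‖ * |ω| * (1 * M) := by gcongr
            _ = E := by rw [hE, one_mul]
        rw [div_eq_mul_inv] at f1
        linarith
    have hlog : ∀ a ∈ Ioc 0 β, -(ψ β + ‖w‖ * M) / δ ≤ Real.log a := by
      intro a ha
      have f1 := hψmono ha ⟨hβ.1, le_rfl⟩ ha.2
      have f2 : -(‖w‖ * M) ≤ (w * (a * F a)).re := by
        refine le_trans ?_ (neg_le_of_abs_le (Complex.abs_re_le_norm _))
        rw [neg_le_neg_iff, norm_mul, norm_mul, Complex.norm_real, Real.norm_eq_abs,
          abs_of_pos ha.1]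
        have g1 := hF a ⟨ha.1, ha.2.trans hβ.2⟩
        have g2 : a ≤ 1 := (ha.2.trans hβ.2).trans hb
        have g3 : a * ‖F a‖ ≤ 1 * M := mul_le_mul g2 g1 (norm_nonneg _) (by norm_num)
        rw [one_mul] at g3
        gcongr
      have f3 : 0 ≤ E * a := by have := ha.1; positivity
      rw [div_le_iff₀ hδ0]
      have f4 : ψ a = (w * (a * F a)).re - δ * Real.log a + E * a := rfl
      linarith
    obtain ⟨a, ha1, ha2⟩ := ((Real.tendsto_log_nhdsGT_zero.eventually_lt_atBot
      (-(ψ β + ‖w‖ * M) / δ)).and (Ioc_mem_nhdsGT hβ.1)).exists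
    exact absurd (hlog a ha2) (not_le.2 ha1)
  rw [hu] at hmain
  simp only [norm_rpow_neg_mul hβ.1] at hmain
  have h2 : β ^ (1 - r) = β ^ (-r) * β := by
    rw [← Real.rpow_add_one hβ.1.ne']; ring_nf
  have h3 : B β ≤ β ^ (-r) * (A * b) := by
    have hβ0 := hβ.1
    simp only [hB]
    rw [h2, div_le_iff₀ h1r]
    have e1 : A * (β ^ (-r) * β) ≤ A * (β ^ (-r) * b) := by gcongr; exact hβ.2
    have e2 : 0 ≤ A * (β ^ (-r) * b) := by
      have := hβ.1.trans_le hβ.2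
      positivity
    nlinarith
  exact le_of_mul_le_mul_left (hmain.trans h3) (Real.rpow_pos_of_pos hβ.1 (-r))

theorem ModeSol.norm_fst_le (s : ModeSol ω p r c F h K) {b A M : ℝ}
    (hh : ∀ β ∈ Ioc 0 b, ‖h β‖ ≤ A * M * b) (hF : ∀ β ∈ Ioc 0 b, ‖F β‖ ≤ M) {β : ℝ}
    (hβ : β ∈ Ioc 0 b) : ‖F β‖ ≤ (A + |ω|) * b * M := by
  have hM : 0 ≤ M := (norm_nonneg _).trans (hF β hβ)
  have hcmp : ∀ a ∈ Ioc 0 β,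
      ‖(β : ℂ) * F β‖ ≤ (A + |ω|) * b * M * (β - a) + a * M := by
    intro a ha
    have key := norm_sub_le_sub_of_norm_deriv_le (a := a) (b := β) ha.2
      (u := fun t : ℝ => (t : ℂ) * F t) (u' := fun t => h t - Complex.I * ω * t * F t)
      (B := fun t : ℝ => (A + |ω|) * b * M * t) (B' := fun _ => (A + |ω|) * b * M * 1)
      (fun t ht => by
        have ht0 : 0 < t := ha.1.trans_le ht.1
        have ht' : (t : ℂ) ≠ 0 := by exact_mod_cast ht0.ne'
        convert! (HasDerivAt.ofReal_comp (hasDerivAt_id t)).mul (s.hasDerivAt_fst t ht0) using 1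
        simp only [id, Complex.ofReal_one]
        field_simp
        ring)
      (fun t _ => (hasDerivAt_id t).const_mul _)
      (fun t ht => by
        have ht0 : 0 < t := ha.1.trans_le ht.1
        have htb : t ∈ Ioc 0 b := ⟨ht0, ht.2.trans hβ.2⟩
        refine (norm_sub_le _ _).trans ?_
        rw [norm_mul, norm_mul, norm_mul, Complex.norm_I, one_mul, Complex.norm_real,
            Complex.norm_real, Real.norm_eq_abs, Real.norm_eq_abs, abs_of_pos ht0]
        have g3 : t * ‖F t‖ ≤ b * M := mul_le_mul htb.2 (hF t htb) (norm_nonneg _)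
          (ht0.le.trans htb.2)
        have g4 : |ω| * (t * ‖F t‖) ≤ |ω| * (b * M) := by gcongr
        have := hh t htb
        linarith)
    have h1 : ‖(a : ℂ) * F a‖ ≤ a * M := by
      rw [norm_mul, Complex.norm_real, Real.norm_eq_abs, abs_of_pos ha.1]
      have := ha.1
      gcongr
      exact hF a ⟨ha.1, ha.2.trans hβ.2⟩
    have h2 := norm_sub_norm_le ((β : ℂ) * F β) ((a : ℂ) * F a)
    linarith
  have hlim : Tendsto (fun a : ℝ => (A + |ω|) * b * M * (β - a) + a * M) (𝓝[>] 0)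
      (𝓝 ((A + |ω|) * b * M * β)) := by
    refine Tendsto.mono_left ?_ nhdsWithin_le_nhds
    exact Continuous.tendsto' (by fun_prop) _ _ (by simp)
  have h3 := ge_of_tendsto hlim (by
    filter_upwards [Ioc_mem_nhdsGT hβ.1] with a ha using hcmp a ha)
  rw [norm_mul, Complex.norm_real, Real.norm_eq_abs, abs_of_pos hβ.1, mul_comm] at h3
  exact le_of_mul_le_mul_right h3 hβ.1

/-- A solution that is bounded near the origin is determined by finitely many values at a small
radius. -/
theorem exists_radius_eq_zero (hp : 1 < p) (hr : r ≤ -1 ∨ 0 < r) :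
    ∃ b > 0, ∀ F h K : ℝ → ℂ, ModeSol ω p r c F h K →
      (∃ M : ℝ, ∀ β ∈ Ioc (0 : ℝ) 1, ‖F β‖ ≤ M) → K b = 0 → (0 < r → h b = 0) →
      ∀ β, 0 < β → F β = 0 := by
  set A₀ : ℝ := |ω| * |c| / (p - 1) with hA₀
  have hp1 : 0 < p - 1 := by linarith
  set A : ℝ := A₀ + A₀ / |r| with hA
  have hA₀0 : 0 ≤ A₀ := by positivity
  have hA0 : 0 ≤ A := by positivity
  set D : ℝ := 2 * (A + |ω|) + 1 with hD
  have hD1 : 1 ≤ D := by have := abs_nonneg ω; linarith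
  have hb0 : 0 < D⁻¹ := by positivity
  have hb1 : D⁻¹ ≤ 1 := inv_le_one_of_one_le₀ hD1
  have hhalf : (A + |ω|) * D⁻¹ ≤ 1 / 2 := by
    rw [← div_eq_mul_inv, div_le_iff₀ (by linarith)]
    linarith
  refine ⟨D⁻¹, hb0, fun F h K s ⟨M, hM⟩ hK hh => ?_⟩
  set b := D⁻¹ with hb
  have hstep : ∀ M : ℝ, (∀ β ∈ Ioc 0 b, ‖F β‖ ≤ M) → ∀ β ∈ Ioc 0 b, ‖F β‖ ≤ 1 / 2 * M := by
    intro M hF β hβ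
    have hM0 : 0 ≤ M := (norm_nonneg _).trans (hF β hβ)
    have hKb : ∀ β ∈ Ioc 0 b, ‖K β‖ ≤ A₀ * M * β := fun β hβ =>
      s.norm_trd_le hp hM0 hF hK hβ
    have hhb : ∀ β ∈ Ioc 0 b, ‖h β‖ ≤ A * M * b := by
      intro β hβ
      rcases hr with hr | hr
      · refine (s.norm_snd_le_of_le_neg_one hr hb1 (by positivity) hKb hF hβ).trans ?_
        gcongr
        rw [hA]
        have : 0 ≤ A₀ / |r| := by positivity
        linarith
      · refine (s.norm_snd_le_of_pos hr (by positivity) hKb (hh hr) hβ).trans ?_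
        gcongr
        rw [hA, abs_of_pos hr, mul_div_right_comm]
        gcongr
        linarith
    refine (s.norm_fst_le hhb hF hβ).trans ?_
    gcongr
  have hiter : ∀ n : ℕ, ∀ β ∈ Ioc 0 b, ‖F β‖ ≤ (1 / 2) ^ n * M := by
    intro n
    induction n with
    | zero => exact fun β hβ => by simpa using hM β ⟨hβ.1, hβ.2.trans hb1⟩
    | succ n ih =>
      intro β hβ
      refine (hstep _ ih β hβ).trans (le_of_eq ?_)
      ring
  have hzero : ∀ β ∈ Ioc 0 b, F β = 0 := by
    intro β hβ
    have hlim : Tendsto (fun n : ℕ => (1 / 2 : ℝ) ^ n * M) atTop (𝓝 (0 * M)) :=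
      (tendsto_pow_atTop_nhds_zero_of_lt_one (by norm_num) (by norm_num)).mul_const M
    rw [zero_mul] at hlim
    exact norm_le_zero_iff.1 (ge_of_tendsto' hlim fun n => hiter n β hβ)
  have hz1 : ∀ β ∈ Ioo 0 b, h β = 0 := by
    intro β hβ
    have h1 : F =ᶠ[𝓝 β] fun _ => 0 := by
      filter_upwards [Ioo_mem_nhds hβ.1 hβ.2] with t ht using hzero t (Ioo_subset_Ioc_self ht)
    have h2 := (s.hasDerivAt_fst β hβ.1).unique
      ((hasDerivAt_const β (0 : ℂ)).congr_of_eventuallyEq h1)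
    have h3 : (β : ℂ) ≠ 0 := by exact_mod_cast hβ.1.ne'
    rw [hzero β (Ioo_subset_Ioc_self hβ), mul_zero, sub_zero, sub_zero, div_eq_zero_iff] at h2
    exact h2.resolve_right h3
  have hz2 : ∀ β ∈ Ioo 0 b, K β = 0 := by
    intro β hβ
    have h1 : h =ᶠ[𝓝 β] fun _ => 0 := by
      filter_upwards [Ioo_mem_nhds hβ.1 hβ.2] with t ht using hz1 t ht
    have h2 := (s.hasDerivAt_snd β hβ.1).unique
      ((hasDerivAt_const β (0 : ℂ)).congr_of_eventuallyEq h1)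
    have h3 : (β : ℂ) ≠ 0 := by exact_mod_cast hβ.1.ne'
    rw [hz1 β hβ, mul_zero, zero_add, div_eq_zero_iff] at h2
    exact h2.resolve_right h3
  intro β hβ
  rcases le_total β b with hle | hle
  · exact hzero β ⟨hβ, hle⟩
  · have hmid : b / 2 ∈ Ioo 0 b := ⟨by linarith, by linarith⟩
    exact s.eq_zero_of_le hmid.1 (hmid.2.le.trans hle) (hzero _ (Ioo_subset_Ioc_self hmid))
      (hz1 _ hmid) (hz2 _ hmid)

end ModeSystem

section ModeUniqueness

variable {ω p r c : ℝ}

theorem hasDerivAt_rpow_mul {v : ℝ → ℂ} {v' : ℂ} {β : ℝ} (s : ℝ) (hβ : 0 < β)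
    (hv : HasDerivAt v v' β) :
    HasDerivAt (fun t : ℝ => ((t ^ s : ℝ) : ℂ) * v t)
      (((β ^ s : ℝ) : ℂ) * (s * v β / β + v')) β := by
  have h1 : HasDerivAt (fun t : ℝ => ((t ^ s : ℝ) : ℂ)) ((s * β ^ (s - 1) : ℝ) : ℂ) β :=
    (Real.hasDerivAt_rpow_const (Or.inl hβ.ne')).ofReal_comp
  convert! h1.mul hv using 1
  have h3 : (β : ℂ) ≠ 0 := by exact_mod_cast hβ.ne'
  rw [Real.rpow_sub_one hβ.ne']
  push_cast
  field_simp

theorem hasDerivAt_comp_mul_ofReal {G G' : ℂ → ℂ} (hG : ∀ z, HasDerivAt G (G' z) z) (a : ℂ)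
    (t : ℝ) : HasDerivAt (fun t : ℝ => G (a * t)) (G' (a * t) * a) t := by
  have h1 : HasDerivAt (fun t : ℝ => a * (t : ℂ)) (a * 1) t :=
    (HasDerivAt.ofReal_comp (hasDerivAt_id t)).const_mul a
  rw [mul_one] at h1
  exact (hG (a * t)).comp t h1

theorem modeSol_rpow_mul {a₁ a₂ b₁ b₂ : ℝ} {H : ℕ → ℂ → ℂ}
    (hH : ∀ j z, HasDerivAt (H j) (H (j + 1) z) z)
    (hode : ∀ z, z ^ 2 * H 3 z + (b₁ + b₂ + 1) * z * H 2 z + b₁ * b₂ * H 1 z =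
      z ^ 2 * H 2 z + (a₁ + a₂ + 1) * z * H 1 z + a₁ * a₂ * H 0 z)
    (hb₁ : b₁ = p - r + 1) (hb₂ : b₂ = p + 2) (hadd : a₁ + a₂ = b₁ + 1)
    (hmul : a₁ * a₂ = b₁ + c) :
    ∃ h K, ModeSol ω p r c
      (fun β => ((β ^ p : ℝ) : ℂ) * H 0 (-(Complex.I * ω) * β)) h K := by
  set J : ℂ → ℂ := fun z => (p + 1) * H 0 z + z * H 1 z - z * H 0 z with hJ
  set J' : ℂ → ℂ := fun z => (p + 2) * H 1 z + z * H 2 z - H 0 z - z * H 1 z with hJ'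
  set J'' : ℂ → ℂ := fun z => (p + 3) * H 2 z + z * H 3 z - 2 * H 1 z - z * H 2 z with hJ''
  have dJ : ∀ z, HasDerivAt J (J' z) z := fun z => by
    convert! (((hH 0 z).const_mul ((p : ℂ) + 1)).add ((hasDerivAt_id z).mul (hH 1 z))).sub
      ((hasDerivAt_id z).mul (hH 0 z)) using 1
    simp only [hJ', id]
    ring
  have dJ' : ∀ z, HasDerivAt J' (J'' z) z := fun z => by
    convert! ((((hH 1 z).const_mul ((p : ℂ) + 2)).add ((hasDerivAt_id z).mul (hH 2 z))).sub
      (hH 0 z)).sub ((hasDerivAt_id z).mul (hH 1 z)) using 1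
    simp only [hJ'', id]
    ring
  have dK : ∀ z, HasDerivAt (fun z => ((p : ℂ) - r) * J z + z * J' z)
      (((p : ℂ) - r) * J' z + (1 * J' z + z * J'' z)) z := fun z =>
    ((dJ z).const_mul ((p : ℂ) - r)).add ((hasDerivAt_id z).mul (dJ' z))
  have hode' : ∀ z, ((p : ℂ) - r + 1) * J' z + z * J'' z = c * H 0 z := by
    intro z
    have hadd' : (a₁ : ℂ) + a₂ = b₁ + 1 := by exact_mod_cast congrArg Complex.ofReal hadd
    have hmul' : (a₁ : ℂ) * a₂ = b₁ + c := by exact_mod_cast congrArg Complex.ofReal hmul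
    have e := hode z
    rw [hadd', hmul', hb₁, hb₂] at e
    push_cast at e
    simp only [hJ', hJ'']
    linear_combination e
  refine ⟨fun β => ((β ^ p : ℝ) : ℂ) * J (-(Complex.I * ω) * β),
    fun β => ((β ^ p : ℝ) : ℂ) * (((p : ℂ) - r) * J (-(Complex.I * ω) * β) +
      (-(Complex.I * ω) * β) * J' (-(Complex.I * ω) * β)), ?_, ?_, ?_⟩
  · intro β hβ
    have h3 : (β : ℂ) ≠ 0 := by exact_mod_cast hβ.ne'
    convert! hasDerivAt_rpow_mul p hβ (hasDerivAt_comp_mul_ofReal (hH 0) _ β) using 1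
    simp only [hJ]
    field_simp
    ring
  · intro β hβ
    have h3 : (β : ℂ) ≠ 0 := by exact_mod_cast hβ.ne'
    convert! hasDerivAt_rpow_mul p hβ (hasDerivAt_comp_mul_ofReal dJ _ β) using 1
    field_simp
    ring
  · intro β hβ
    have h3 : (β : ℂ) ≠ 0 := by exact_mod_cast hβ.ne'
    convert! hasDerivAt_rpow_mul p hβ (hasDerivAt_comp_mul_ofReal dK _ β) using 1
    have e := hode' (-(Complex.I * ω) * β)
    set z := -(Complex.I * ω) * (β : ℂ)
    have e2 : Complex.I * ω * c * β * (((β ^ p : ℝ) : ℂ) * H 0 z) =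
        Complex.I * ω * β * ((β ^ p : ℝ) : ℂ) * (((p : ℂ) - r + 1) * J' z + z * J'' z) := by
      rw [e]; ring
    rw [e2]
    field_simp
    ring

theorem exists_modeSol {μ N : ℝ} (hμ : 1 < μ) (hN : 1 ≤ N) (hω : ω ≠ 0)
    (hc : c = 2 * μ - 1) (hp : p = c + μ * N) (hr : r = c - μ * N) :
    ∃ H h K : ℝ → ℂ, ModeSol ω p r c (fun β => ((β ^ p : ℝ) : ℂ) * H β) h K ∧ Continuous H ∧
      H 0 = 1 ∧ ∀ C : ℝ, ¬ ∀ t : ℝ, 1 ≤ t → ‖H t‖ ≤ C * t ^ (-(μ * (N + 1))) := by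
  have hμN : μ ≤ μ * N := le_mul_of_one_le_right (by linarith) hN
  have hsq : (μ - 1) ^ 2 ≤ (μ * N) ^ 2 - c := by nlinarith
  set κ := √((μ * N) ^ 2 - c) with hκ
  have hκ1 : μ - 1 ≤ κ := Real.le_sqrt_of_sq_le hsq
  have hκ2 : κ ^ 2 = (μ * N) ^ 2 - c := Real.sq_sqrt ((sq_nonneg _).trans hsq)
  have hκ3 : κ < μ * N := by
    rw [hκ, Real.sqrt_lt' (by linarith)]
    linarith
  obtain ⟨H, hH, h0, hode, hgrow⟩ := exists_hypergeometric (a₁ := 1 + μ * N + κ)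
    (a₂ := 1 + μ * N - κ) (b₁ := 2 * (μ * N) + 1) (b₂ := p + 2) (by linarith) (by linarith)
    (by linarith) (by linarith)
  obtain ⟨h, K, s⟩ := modeSol_rpow_mul (ω := ω) (p := p) (r := r) (c := c) hH hode
    (by rw [hp, hr]; ring) rfl (by ring) (by linear_combination -hκ2)
  refine ⟨_, h, K, s, ?_, by simpa using h0, fun C => hgrow _ C ω ?_ hω⟩
  · exact continuous_iff_continuousAt.2 fun t =>
      (hasDerivAt_comp_mul_ofReal (hH 0) _ t).continuousAt
  · linarith

theorem bounded_rpow_mul {H : ℝ → ℂ} (hH : Continuous H) (hp : 0 ≤ p) :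
    ∃ M : ℝ, ∀ β ∈ Ioc (0 : ℝ) 1, ‖((β ^ p : ℝ) : ℂ) * H β‖ ≤ M := by
  obtain ⟨M, hM⟩ := (isCompact_Icc (a := (0 : ℝ)) (b := 1)).exists_bound_of_continuousOn
    hH.continuousOn
  refine ⟨M, fun β hβ => ?_⟩
  have h1 := hM β (Ioc_subset_Icc_self hβ)
  have h2 : β ^ p ≤ 1 := Real.rpow_le_one hβ.1.le hβ.2 hp
  rw [norm_mul, Complex.norm_real, Real.norm_eq_abs, abs_of_pos (Real.rpow_pos_of_pos hβ.1 _)]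
  exact (mul_le_of_le_one_left (norm_nonneg _) h2).trans h1

theorem bounded_sub_mul {F F' : ℝ → ℂ} {s : Set ℝ} (hF : ∃ M : ℝ, ∀ β ∈ s, ‖F β‖ ≤ M)
    (hF' : ∃ M : ℝ, ∀ β ∈ s, ‖F' β‖ ≤ M) (a : ℂ) :
    ∃ M : ℝ, ∀ β ∈ s, ‖F β - a * F' β‖ ≤ M := by
  obtain ⟨M, hM⟩ := hF
  obtain ⟨M', hM'⟩ := hF'
  refine ⟨M + ‖a‖ * M', fun β hβ => (norm_sub_le _ _).trans ?_⟩
  rw [norm_mul]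
  gcongr
  exacts [hM β hβ, hM' β hβ]

theorem eq_of_eqOn_Ioi {H : ℝ → ℂ} {a : ℂ} (hH : Continuous H) (h : ∀ β, 0 < β → H β = a) :
    H 0 = a :=
  tendsto_nhds_unique ((hH.tendsto 0).mono_left nhdsWithin_le_nhds)
    (tendsto_const_nhds.congr' (by
      filter_upwards [self_mem_nhdsWithin] with β hβ using (h β hβ).symm) :
      Tendsto H (𝓝[>] 0) (𝓝 a))

/-- Modes with `r ≤ -1`. -/
theorem ModeSol.eq_zero_of_bounded_of_two_le {μ N : ℝ} (hμ : 1 < μ) (hN : 2 ≤ N) (hω : ω ≠ 0)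
    (hc : c = 2 * μ - 1) (hp : p = c + μ * N) (hr : r = c - μ * N) {F h K : ℝ → ℂ}
    (s : ModeSol ω p r c F h K) {M : ℝ} (hM : ∀ β, 0 < β → ‖F β‖ ≤ M) {β : ℝ} (hβ : 0 < β) :
    F β = 0 := by
  have hμN : μ * 2 ≤ μ * N := mul_le_mul_of_nonneg_left hN (by linarith)
  have hr1 : r ≤ -1 := by linarith
  have hp1 : 1 < p := by linarith
  obtain ⟨H, hS, KS, S, hcont, h0, hgrow⟩ := exists_modeSol hμ (by linarith) hω hc hp hr
  obtain ⟨b, hb, huniq⟩ := exists_radius_eq_zero (ω := ω) (p := p) (r := r) (c := c) hp1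
    (Or.inl hr1)
  have hSbdd := bounded_rpow_mul hcont (p := p) (by linarith)
  have hKS : KS b ≠ 0 := by
    intro hKS
    have h1 := huniq _ _ _ S hSbdd hKS (fun h => absurd h (by linarith))
    have h2 : H 0 = 0 := eq_of_eqOn_Ioi hcont fun β hβ => by
      refine (mul_eq_zero.1 (h1 β hβ)).resolve_left ?_
      exact_mod_cast (Real.rpow_pos_of_pos hβ p).ne'
    rw [h0] at h2
    exact one_ne_zero h2
  set a := K b / KS b with ha
  have h1 := huniq _ _ _ (s.sub_mul S a)
    (bounded_sub_mul ⟨M, fun β hβ => hM β hβ.1⟩ hSbdd a)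
    (by rw [ha, div_mul_cancel₀ _ hKS, sub_self]) (fun h => absurd h (by linarith))
  by_cases ha0 : a = 0
  · simpa [ha0] using h1 β hβ
  · refine absurd (fun t ht => ?_) (hgrow (M / ‖a‖))
    have ht0 : 0 < t := by linarith
    have h2 := hM t ht0
    have hM0 : 0 ≤ M := (norm_nonneg _).trans h2
    rw [sub_eq_zero.1 (h1 t ht0), norm_mul, norm_mul, Complex.norm_real, Real.norm_eq_abs,
      abs_of_pos (Real.rpow_pos_of_pos ht0 _)] at h2
    have h3 : t ^ (-p) ≤ t ^ (-(μ * (N + 1))) :=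
      Real.rpow_le_rpow_of_exponent_le ht (by linarith)
    refine le_trans ?_ (mul_le_mul_of_nonneg_left h3 (by positivity))
    rw [Real.rpow_neg ht0.le, ← div_eq_mul_inv, div_div,
      le_div_iff₀ (mul_pos (norm_pos_iff.2 ha0) (Real.rpow_pos_of_pos ht0 _))]
    linarith

theorem modeSol_rpow {μ : ℝ} : ModeSol ω (3 * μ - 1) (μ - 1) (2 * μ - 1)
    (fun β => ((β ^ (μ - 1) : ℝ) : ℂ) * 1)
    (fun β => ((β ^ (μ - 1) : ℝ) : ℂ) * (μ + Complex.I * ω * β))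
    (fun β => ((β ^ (μ - 1) : ℝ) : ℂ) * (Complex.I * ω * β)) := by
  have hd : ∀ β : ℝ, HasDerivAt (fun β : ℝ => Complex.I * ω * β) (Complex.I * ω * 1) β :=
    fun β => (HasDerivAt.ofReal_comp (hasDerivAt_id β)).const_mul _
  refine ⟨fun β hβ => ?_, fun β hβ => ?_, fun β hβ => ?_⟩
  · have h3 : (β : ℂ) ≠ 0 := by exact_mod_cast hβ.ne'
    convert! hasDerivAt_rpow_mul (μ - 1) hβ (hasDerivAt_const β (1 : ℂ)) using 1
    push_cast
    field_simp
    ring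
  · have h3 : (β : ℂ) ≠ 0 := by exact_mod_cast hβ.ne'
    convert! hasDerivAt_rpow_mul (μ - 1) hβ ((hd β).const_add (μ : ℂ)) using 1
    push_cast
    field_simp
  · have h3 : (β : ℂ) ≠ 0 := by exact_mod_cast hβ.ne'
    convert! hasDerivAt_rpow_mul (μ - 1) hβ (hd β) using 1
    push_cast
    field_simp
    ring

/-- Modes with `|n| = 1`. -/
theorem ModeSol.eq_zero_of_bounded_of_one {μ : ℝ} (hμ : 1 < μ) (hω : ω ≠ 0) {F h K : ℝ → ℂ}
    (s : ModeSol ω (3 * μ - 1) (μ - 1) (2 * μ - 1) F h K) {M : ℝ}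
    (hM : ∀ β, 0 < β → ‖F β‖ ≤ M) {β : ℝ} (hβ : 0 < β) : F β = 0 := by
  obtain ⟨H, hS, KS, S, hcont, h0, hgrow⟩ := exists_modeSol (ω := ω) (p := 3 * μ - 1)
    (r := μ - 1) (c := 2 * μ - 1) hμ le_rfl hω rfl (by ring) (by ring)
  obtain ⟨b, hb, huniq⟩ := exists_radius_eq_zero (ω := ω) (p := 3 * μ - 1) (r := μ - 1)
    (c := 2 * μ - 1) (by linarith) (Or.inr (by linarith))
  have hpos : ∀ β : ℝ, 0 < β → ∀ q : ℝ, ((β ^ q : ℝ) : ℂ) ≠ 0 := fun β hβ q => by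
    exact_mod_cast (Real.rpow_pos_of_pos hβ q).ne'
  have hsplit : ∀ β : ℝ, 0 < β → β ^ (3 * μ - 1) = β ^ (μ - 1) * β ^ (2 * μ) := fun β hβ => by
    rw [← Real.rpow_add hβ]; ring_nf
  have hSbdd := bounded_rpow_mul hcont (p := 3 * μ - 1) (by linarith)
  have hZbdd := bounded_rpow_mul (continuous_const (y := (1 : ℂ))) (p := μ - 1) (by linarith)
  have Z := modeSol_rpow (ω := ω) (μ := μ)
  set KZ : ℂ := ((b ^ (μ - 1) : ℝ) : ℂ) * (Complex.I * ω * b) with hKZ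
  have hKZ0 : KZ ≠ 0 := by
    refine mul_ne_zero (hpos b hb _) (mul_ne_zero (mul_ne_zero Complex.I_ne_zero ?_) ?_)
    · exact_mod_cast hω
    · exact_mod_cast hb.ne'
  set d := KS b / KZ with hd
  have S' := S.sub_mul Z d
  have hS'bdd := bounded_sub_mul hSbdd hZbdd d
  set hS' : ℂ := hS b - d * (((b ^ (μ - 1) : ℝ) : ℂ) * (μ + Complex.I * ω * b)) with hhS'
  have hhS'0 : hS' ≠ 0 := by
    intro hz
    have h1 := huniq _ _ _ S' hS'bdd (by rw [← hKZ, hd, div_mul_cancel₀ _ hKZ0, sub_self])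
      (fun _ => hz)
    have h2 : ∀ β : ℝ, 0 < β → ((β ^ (2 * μ) : ℝ) : ℂ) * H β = d := fun β hβ => by
      have := h1 β hβ
      rw [hsplit β hβ] at this
      refine mul_left_cancel₀ (hpos β hβ (μ - 1)) ?_
      push_cast at this ⊢
      linear_combination this
    have hc2 : Continuous fun β : ℝ => ((β ^ (2 * μ) : ℝ) : ℂ) * H β :=
      (Complex.continuous_ofReal.comp
        (Real.continuous_rpow_const (by linarith : 0 ≤ 2 * μ))).mul hcont
    have h3 := eq_of_eqOn_Ioi hc2 h2
    rw [Real.zero_rpow (by linarith), Complex.ofReal_zero, zero_mul] at h3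
    have h4 : H 0 = 0 := eq_of_eqOn_Ioi hcont fun β hβ => by
      have := h2 β hβ
      rw [← h3] at this
      exact (mul_eq_zero.1 this).resolve_left (hpos β hβ _)
    rw [h0] at h4
    exact one_ne_zero h4
  set B := K b / KZ with hB
  have s1 := s.sub_mul Z B
  set A := (h b - B * (((b ^ (μ - 1) : ℝ) : ℂ) * (μ + Complex.I * ω * b))) / hS' with hA
  have key := huniq _ _ _ (s1.sub_mul S' A)
    (bounded_sub_mul (bounded_sub_mul ⟨M, fun β hβ => hM β hβ.1⟩ hZbdd B) hS'bdd A)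
    (by rw [← hKZ, hd, hB, div_mul_cancel₀ _ hKZ0, div_mul_cancel₀ _ hKZ0]; ring)
    (fun _ => by rw [← hhS', hA, div_mul_cancel₀ _ hhS'0, sub_self])
  have hF : ∀ β : ℝ, 0 < β →
      F β = ((β ^ (μ - 1) : ℝ) : ℂ) * ((B - A * d) + A * ((β ^ (2 * μ) : ℝ) : ℂ) * H β) := by
    intro β hβ
    have := key β hβ
    rw [hsplit β hβ] at this
    push_cast at this ⊢
    linear_combination this
  have hM0 : 0 ≤ M := (norm_nonneg _).trans (hM β hβ)
  have hbound : ∀ t : ℝ, 0 < t →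
      t ^ (μ - 1) * ‖(B - A * d) + A * ((t ^ (2 * μ) : ℝ) : ℂ) * H t‖ ≤ M := by
    intro t ht
    have := hM t ht
    rwa [hF t ht, norm_mul, Complex.norm_real, Real.norm_eq_abs,
      abs_of_pos (Real.rpow_pos_of_pos ht _)] at this
  by_cases hA0 : A = 0
  · have hB0 : B = 0 := by
      by_contra hB0
      have hlim : Tendsto (fun t : ℝ => t ^ (μ - 1) * ‖B‖) atTop atTop :=
        (tendsto_rpow_atTop (by linarith)).atTop_mul_const (norm_pos_iff.2 hB0)
      obtain ⟨t, ht1, ht2⟩ := ((hlim.eventually_gt_atTop M).and (eventually_gt_atTop 0)).exists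
      have := hbound t ht2
      simp only [hA0, zero_mul, sub_zero, add_zero] at this
      linarith
    rw [hF β hβ, hA0, hB0]
    simp
  · refine absurd (fun t ht => ?_) (hgrow ((M + ‖B - A * d‖) / ‖A‖))
    have ht0 : 0 < t := by linarith
    have h1 := hbound t ht0
    have h2 : 1 ≤ t ^ (μ - 1) := Real.one_le_rpow ht (by linarith)
    have h3 : ‖(B - A * d) + A * ((t ^ (2 * μ) : ℝ) : ℂ) * H t‖ ≤ M :=
      (le_mul_of_one_le_left (norm_nonneg _) h2).trans h1
    have h4 := norm_sub_le ((B - A * d) + A * ((t ^ (2 * μ) : ℝ) : ℂ) * H t) (B - A * d)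
    rw [add_sub_cancel_left, norm_mul, norm_mul, Complex.norm_real, Real.norm_eq_abs,
      abs_of_pos (Real.rpow_pos_of_pos ht0 _)] at h4
    rw [show μ * (1 + 1) = 2 * μ by ring, Real.rpow_neg ht0.le, ← div_eq_mul_inv, div_div,
      le_div_iff₀ (mul_pos (norm_pos_iff.2 hA0) (Real.rpow_pos_of_pos ht0 _))]
    linarith

/-- The zero mode. -/
theorem ModeSol.eq_zero_of_bounded_of_zero (hc : 1 < c) {F h K : ℝ → ℂ}
    (s : ModeSol 0 c c c F h K) {M : ℝ} (hM : ∀ β, 0 < β → ‖F β‖ ≤ M) {β : ℝ} (hβ : 0 < β) :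
    F β = 0 := by
  obtain ⟨b, hb, huniq⟩ := exists_radius_eq_zero (ω := 0) (p := c) (r := c) (c := c) hc
    (Or.inr (by linarith))
  have hc1 : (c : ℂ) + 1 ≠ 0 := by
    have : c + 1 ≠ 0 := by linarith
    exact_mod_cast this
  have hlog : ∀ β : ℝ, 0 < β → HasDerivAt (fun β : ℝ => ((Real.log β : ℝ) : ℂ)) (β : ℂ)⁻¹ β :=
    fun β hβ => by simpa using (Real.hasDerivAt_log hβ.ne').ofReal_comp
  have hβn : ∀ β : ℝ, 0 < β → (β : ℂ) ≠ 0 := fun β hβ => by exact_mod_cast hβ.ne'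
  have Z : ModeSol 0 c c c (fun β => ((β ^ c : ℝ) : ℂ) * 1) (fun β => ((β ^ c : ℝ) : ℂ) * (c + 1))
      (fun _ => 0) := by
    refine ⟨fun β hβ => ?_, fun β hβ => ?_, fun β hβ => ?_⟩
    · have h3 := hβn β hβ
      convert! hasDerivAt_rpow_mul c hβ (hasDerivAt_const β (1 : ℂ)) using 1
      push_cast
      field_simp
      ring
    · have h3 := hβn β hβ
      convert! hasDerivAt_rpow_mul c hβ (hasDerivAt_const β ((c : ℂ) + 1)) using 1
      field_simp
      ring
    · simpa using hasDerivAt_const β (0 : ℂ)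
  have S : ModeSol 0 c c c
      (fun β => ((β ^ c : ℝ) : ℂ) * (((Real.log β : ℝ) : ℂ) / (c + 1) - 1 / (c + 1) ^ 2))
      (fun β => ((β ^ c : ℝ) : ℂ) * ((Real.log β : ℝ) : ℂ))
      (fun β => ((β ^ c : ℝ) : ℂ) * 1) := by
    refine ⟨fun β hβ => ?_, fun β hβ => ?_, fun β hβ => ?_⟩
    · have h3 := hβn β hβ
      convert! hasDerivAt_rpow_mul c hβ
        (((hlog β hβ).div_const ((c : ℂ) + 1)).sub_const (1 / ((c : ℂ) + 1) ^ 2)) using 1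
      push_cast
      field_simp
      ring
    · have h3 := hβn β hβ
      convert! hasDerivAt_rpow_mul c hβ (hlog β hβ) using 1
      field_simp
    · have h3 := hβn β hβ
      convert! hasDerivAt_rpow_mul c hβ (hasDerivAt_const β (1 : ℂ)) using 1
      push_cast
      field_simp
      ring
  have hZbdd := bounded_rpow_mul (continuous_const (y := (1 : ℂ))) (p := c) (by linarith)
  have hSbdd : ∃ M : ℝ, ∀ β ∈ Ioc (0 : ℝ) 1,
      ‖((β ^ c : ℝ) : ℂ) * (((Real.log β : ℝ) : ℂ) / (c + 1) - 1 / (c + 1) ^ 2)‖ ≤ M := by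
    refine ⟨1 / ‖(c : ℂ) + 1‖ + ‖1 / ((c : ℂ) + 1) ^ 2‖, fun β hβ => ?_⟩
    have h1 : β ^ c ≤ β := by
      simpa using Real.rpow_le_rpow_of_exponent_ge hβ.1 hβ.2 hc.le
    have h2 := Real.abs_log_mul_self_lt β hβ.1 hβ.2
    rw [abs_mul, abs_of_pos hβ.1] at h2
    have h3 : β ^ c * |Real.log β| ≤ 1 := by
      have := mul_le_mul_of_nonneg_right h1 (abs_nonneg (Real.log β))
      linarith
    rw [mul_sub]
    refine (norm_sub_le _ _).trans (add_le_add ?_ ?_)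
    · rw [norm_mul, norm_div, Complex.norm_real, Complex.norm_real, Real.norm_eq_abs,
        Real.norm_eq_abs, abs_of_pos (Real.rpow_pos_of_pos hβ.1 _), mul_div_assoc']
      gcongr
    · rw [norm_mul, Complex.norm_real, Real.norm_eq_abs,
        abs_of_pos (Real.rpow_pos_of_pos hβ.1 _)]
      exact mul_le_of_le_one_left (norm_nonneg _) (h1.trans hβ.2)
  have hpos : ∀ β : ℝ, 0 < β → ((β ^ c : ℝ) : ℂ) ≠ 0 := fun β hβ => by
    exact_mod_cast (Real.rpow_pos_of_pos hβ c).ne'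
  set B := K b / (((b ^ c : ℝ) : ℂ) * 1) with hB
  have s1 := s.sub_mul S B
  set A := (h b - B * (((b ^ c : ℝ) : ℂ) * ((Real.log b : ℝ) : ℂ))) /
    (((b ^ c : ℝ) : ℂ) * (c + 1)) with hA
  have key := huniq _ _ _ (s1.sub_mul Z A)
    (bounded_sub_mul (bounded_sub_mul ⟨M, fun β hβ => hM β hβ.1⟩ hSbdd B) hZbdd A)
    (by rw [hB, div_mul_cancel₀ _ (mul_ne_zero (hpos b hb) one_ne_zero)]; ring)
    (fun _ => by rw [hA, div_mul_cancel₀ _ (mul_ne_zero (hpos b hb) hc1), sub_self])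
  set G : ℝ → ℂ := fun t =>
    A + B * (((Real.log t : ℝ) : ℂ) / (c + 1) - 1 / (c + 1) ^ 2) with hG
  have hF : ∀ t : ℝ, 0 < t → F t = ((t ^ c : ℝ) : ℂ) * G t := fun t ht => by
    simp only [hG]
    linear_combination key t ht
  have hG0 : Tendsto G atTop (𝓝 0) := by
    have h1 : Tendsto (fun t : ℝ => M * t ^ (-c)) atTop (𝓝 (M * 0)) :=
      (tendsto_rpow_neg_atTop (by linarith)).const_mul M
    rw [mul_zero] at h1
    refine squeeze_zero_norm' ?_ h1
    filter_upwards [eventually_gt_atTop 0] with t ht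
    have := hM t ht
    rw [hF t ht, norm_mul, Complex.norm_real, Real.norm_eq_abs,
      abs_of_pos (Real.rpow_pos_of_pos ht _)] at this
    rw [Real.rpow_neg ht.le, ← div_eq_mul_inv, le_div_iff₀ (Real.rpow_pos_of_pos ht _)]
    linarith
  have hBA : B / (c + 1) = 0 := by
    have h1 : Tendsto (fun t => G (Real.exp 1 * t) - G t) atTop (𝓝 (0 - 0)) :=
      (hG0.comp (tendsto_id.const_mul_atTop (Real.exp_pos 1))).sub hG0
    rw [sub_zero] at h1
    refine tendsto_nhds_unique (tendsto_const_nhds.congr' ?_) h1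
    filter_upwards [eventually_gt_atTop 0] with t ht
    simp only [hG]
    rw [Real.log_mul (Real.exp_pos 1).ne' ht.ne', Real.log_exp]
    push_cast
    ring
  have hB0 : B = 0 := (div_eq_zero_iff.1 hBA).resolve_right hc1
  have hA0 : A = 0 := by
    simp only [hG, hB0, zero_mul, add_zero] at hG0
    exact tendsto_nhds_unique tendsto_const_nhds hG0
  rw [hF β hβ]
  simp [hG, hA0, hB0]

/-- A bounded solution of the mode system with frequency `n` vanishes. -/
theorem ModeSol.eq_zero_of_bounded {μ : ℝ} (hμ : 1 < μ) (n : ℤ) {F h K : ℝ → ℂ}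
    (s : ModeSol n (2 * μ - 1 + μ * |(n : ℝ)|) (2 * μ - 1 - μ * |(n : ℝ)|) (2 * μ - 1) F h K)
    {M : ℝ} (hM : ∀ β, 0 < β → ‖F β‖ ≤ M) {β : ℝ} (hβ : 0 < β) : F β = 0 := by
  rcases eq_or_ne n 0 with rfl | hn
  · simp only [Int.cast_zero, abs_zero, mul_zero, add_zero, sub_zero] at s
    exact s.eq_zero_of_bounded_of_zero (by linarith) hM hβ
  have hω : (n : ℝ) ≠ 0 := by exact_mod_cast hn
  have h1 : 1 ≤ |n| := Int.one_le_abs hn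
  rcases h1.eq_or_lt with h1 | h1
  · have h2 : |(n : ℝ)| = 1 := by exact_mod_cast h1.symm
    rw [h2, show 2 * μ - 1 + μ * 1 = 3 * μ - 1 by ring,
      show 2 * μ - 1 - μ * 1 = μ - 1 by ring] at s
    exact s.eq_zero_of_bounded_of_one hμ hω hM hβ
  · have h2 : 2 ≤ |(n : ℝ)| := by exact_mod_cast h1
    exact s.eq_zero_of_bounded_of_two_le hμ h2 hω rfl rfl rfl hM hβ

end ModeUniqueness

section FourierModes

/-- Smooth functions on the half plane that are periodic in the angular variable. -/
structure SmoothPeriodic (h : ℝ → ℝ → ℂ) : Prop where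
  contDiffOn : ContDiffOn ℝ (⊤ : ℕ∞) (fun p : ℝ × ℝ => h p.1 p.2) (Ioi 0 ×ˢ univ)
  periodic : ∀ β φ : ℝ, h β (φ + 2 * Real.pi) = h β φ

variable {h h' : ℝ → ℝ → ℂ}

theorem isOpen_Ioi_prod_univ : IsOpen (Ioi (0 : ℝ) ×ˢ (univ : Set ℝ)) :=
  isOpen_Ioi.prod isOpen_univ

theorem SmoothPeriodic.hasFDerivAt (hs : SmoothPeriodic h) {β : ℝ} (hβ : 0 < β) (φ : ℝ) :
    HasFDerivAt (fun p : ℝ × ℝ => h p.1 p.2) (fderiv ℝ (fun p : ℝ × ℝ => h p.1 p.2) (β, φ))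
      (β, φ) :=
  ((hs.contDiffOn.differentiableOn (by simp)).differentiableAt
    (isOpen_Ioi_prod_univ.mem_nhds (mk_mem_prod hβ (mem_univ φ)))).hasFDerivAt

theorem SmoothPeriodic.hasDerivAt_fderiv_left (hs : SmoothPeriodic h) {β : ℝ} (hβ : 0 < β)
    (φ : ℝ) : HasDerivAt (fun b => h b φ)
      (fderiv ℝ (fun p : ℝ × ℝ => h p.1 p.2) (β, φ) (1, 0)) β :=
  HasFDerivAt.comp_hasDerivAt (f := fun b => (b, φ)) β (hs.hasFDerivAt hβ φ)
    ((hasDerivAt_id β).prodMk (hasDerivAt_const β φ))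

theorem SmoothPeriodic.hasDerivAt_fderiv_right (hs : SmoothPeriodic h) {β : ℝ} (hβ : 0 < β)
    (φ : ℝ) : HasDerivAt (fun p => h β p)
      (fderiv ℝ (fun p : ℝ × ℝ => h p.1 p.2) (β, φ) (0, 1)) φ :=
  HasFDerivAt.comp_hasDerivAt (f := fun p => (β, p)) φ (hs.hasFDerivAt hβ φ)
    ((hasDerivAt_const φ β).prodMk (hasDerivAt_id φ))

theorem SmoothPeriodic.hasDerivAt_pB (hs : SmoothPeriodic h) {β : ℝ} (hβ : 0 < β) (φ : ℝ) :
    HasDerivAt (fun b => h b φ) (pB h β φ) β :=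
  (hs.hasDerivAt_fderiv_left hβ φ).differentiableAt.hasDerivAt

theorem SmoothPeriodic.hasDerivAt_pP (hs : SmoothPeriodic h) {β : ℝ} (hβ : 0 < β) (φ : ℝ) :
    HasDerivAt (fun p => h β p) (pP h β φ) φ :=
  (hs.hasDerivAt_fderiv_right hβ φ).differentiableAt.hasDerivAt

theorem SmoothPeriodic.contDiffOn_fderiv_apply (hs : SmoothPeriodic h) (v : ℝ × ℝ) :
    ContDiffOn ℝ (⊤ : ℕ∞) (fun p : ℝ × ℝ => fderiv ℝ (fun p : ℝ × ℝ => h p.1 p.2) p v)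
      (Ioi 0 ×ˢ univ) :=
  (hs.contDiffOn.fderiv_of_isOpen isOpen_Ioi_prod_univ (by simp)).clm_apply contDiffOn_const

theorem SmoothPeriodic.pB (hs : SmoothPeriodic h) : SmoothPeriodic (pB h) where
  contDiffOn := (hs.contDiffOn_fderiv_apply (1, 0)).congr fun p hp =>
    (hs.hasDerivAt_fderiv_left hp.1 p.2).deriv
  periodic β φ := by simp only [_root_.pB, hs.periodic]

theorem SmoothPeriodic.pP (hs : SmoothPeriodic h) : SmoothPeriodic (pP h) where
  contDiffOn := (hs.contDiffOn_fderiv_apply (0, 1)).congr fun p hp =>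
    (hs.hasDerivAt_fderiv_right hp.1 p.2).deriv
  periodic β φ := by
    simp only [_root_.pP]
    rw [← deriv_comp_add_const (f := fun p => h β p)]
    simp only [hs.periodic]

theorem SmoothPeriodic.add (hs : SmoothPeriodic h) (hs' : SmoothPeriodic h') :
    SmoothPeriodic fun β φ => h β φ + h' β φ where
  contDiffOn := hs.contDiffOn.add hs'.contDiffOn
  periodic β φ := by rw [hs.periodic, hs'.periodic]

theorem SmoothPeriodic.sub (hs : SmoothPeriodic h) (hs' : SmoothPeriodic h') :
    SmoothPeriodic fun β φ => h β φ - h' β φ where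
  contDiffOn := hs.contDiffOn.sub hs'.contDiffOn
  periodic β φ := by rw [hs.periodic, hs'.periodic]

theorem SmoothPeriodic.ofReal_mul (hs : SmoothPeriodic h) :
    SmoothPeriodic fun β φ => (β : ℂ) * h β φ where
  contDiffOn := (Complex.ofRealCLM.contDiff.comp contDiff_fst).contDiffOn.mul hs.contDiffOn
  periodic β φ := by rw [hs.periodic]

theorem SmoothPeriodic.const_mul (hs : SmoothPeriodic h) (a : ℂ) :
    SmoothPeriodic fun β φ => a * h β φ where
  contDiffOn := contDiffOn_const.mul hs.contDiffOn
  periodic β φ := by rw [hs.periodic]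

theorem SmoothPeriodic.gOf (hs : SmoothPeriodic h) : SmoothPeriodic (gOf h) :=
  hs.pB.ofReal_mul.add hs

theorem SmoothPeriodic.aop (hs : SmoothPeriodic h) (μ : ℝ) : SmoothPeriodic (Aop μ h) :=
  (hs.pP.sub hs.pB).ofReal_mul.add (hs.const_mul _)

theorem SmoothPeriodic.continuous (hs : SmoothPeriodic h) {β : ℝ} (hβ : 0 < β) :
    Continuous (h β) :=
  continuous_iff_continuousAt.2 fun φ => (hs.hasDerivAt_pP hβ φ).continuousAt

theorem hasDerivAt_cexp_mul_ofReal (a : ℂ) (φ : ℝ) :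
    HasDerivAt (fun φ : ℝ => Complex.exp (a * φ)) (a * Complex.exp (a * φ)) φ := by
  have := ((HasDerivAt.ofReal_comp (hasDerivAt_id φ)).const_mul a).cexp
  simpa [mul_comm] using this

theorem norm_cexp_neg_I_mul (n : ℤ) (φ : ℝ) : ‖Complex.exp (-(Complex.I * n) * φ)‖ = 1 := by
  rw [show -(Complex.I * n) * (φ : ℂ) = ((-(n * φ) : ℝ) : ℂ) * Complex.I by push_cast; ring]
  exact Complex.norm_exp_ofReal_mul_I _

/-- The (unnormalised) angular Fourier coefficient. -/
noncomputable def angularCoeff (n : ℤ) (h : ℝ → ℝ → ℂ) (β : ℝ) : ℂ :=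
  ∫ φ in (0 : ℝ)..2 * Real.pi, Complex.exp (-(Complex.I * n) * φ) * h β φ

theorem continuous_cexp_mul_ofReal (a : ℂ) : Continuous fun φ : ℝ => Complex.exp (a * φ) :=
  continuous_iff_continuousAt.2 fun φ => (hasDerivAt_cexp_mul_ofReal a φ).continuousAt

theorem SmoothPeriodic.intervalIntegrable (hs : SmoothPeriodic h) (n : ℤ) {β : ℝ} (hβ : 0 < β) :
    IntervalIntegrable (fun φ : ℝ => Complex.exp (-(Complex.I * n) * φ) * h β φ)
      MeasureTheory.volume 0 (2 * Real.pi) :=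
  ((continuous_cexp_mul_ofReal _).mul (hs.continuous hβ)).intervalIntegrable _ _

theorem angularCoeff_add (hs : SmoothPeriodic h) (hs' : SmoothPeriodic h') (n : ℤ) {β : ℝ}
    (hβ : 0 < β) : angularCoeff n (fun β φ => h β φ + h' β φ) β =
      angularCoeff n h β + angularCoeff n h' β := by
  simp only [angularCoeff, mul_add]
  exact intervalIntegral.integral_add (hs.intervalIntegrable n hβ) (hs'.intervalIntegrable n hβ)

theorem angularCoeff_sub (hs : SmoothPeriodic h) (hs' : SmoothPeriodic h') (n : ℤ) {β : ℝ}
    (hβ : 0 < β) : angularCoeff n (fun β φ => h β φ - h' β φ) β =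
      angularCoeff n h β - angularCoeff n h' β := by
  simp only [angularCoeff, mul_sub]
  exact intervalIntegral.integral_sub (hs.intervalIntegrable n hβ) (hs'.intervalIntegrable n hβ)

theorem angularCoeff_mul (n : ℤ) (a : ℝ → ℂ) (β : ℝ) :
    angularCoeff n (fun β φ => a β * h β φ) β = a β * angularCoeff n h β := by
  simp only [angularCoeff, mul_left_comm _ (a β)]
  exact intervalIntegral.integral_const_mul _ _

theorem angularCoeff_pP (hs : SmoothPeriodic h) (n : ℤ) {β : ℝ} (hβ : 0 < β) :
    angularCoeff n (pP h) β = Complex.I * n * angularCoeff n h β := by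
  have key := intervalIntegral.integral_deriv_mul_eq_sub (a := 0) (b := 2 * Real.pi)
    (u := fun φ : ℝ => Complex.exp (-(Complex.I * n) * φ)) (v := h β)
    (fun φ _ => hasDerivAt_cexp_mul_ofReal _ φ) (fun φ _ => hs.hasDerivAt_pP hβ φ)
    ((continuous_const.mul (continuous_cexp_mul_ofReal _)).intervalIntegrable _ _)
    ((hs.pP.continuous hβ).intervalIntegrable _ _)
  have hexp : Complex.exp (-(Complex.I * n) * ((2 * Real.pi : ℝ) : ℂ)) = 1 := by
    rw [Complex.exp_eq_one_iff]
    exact ⟨-n, by push_cast; ring⟩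
  have hperiod : h β (2 * Real.pi) = h β 0 := by simpa using hs.periodic β 0
  rw [hexp, hperiod, Complex.ofReal_zero, mul_zero, Complex.exp_zero, sub_self,
    intervalIntegral.integral_add] at key
  · simp only [mul_assoc] at key
    rw [intervalIntegral.integral_const_mul] at key
    simp only [angularCoeff]
    linear_combination key
  · exact (((continuous_const.mul (continuous_cexp_mul_ofReal _)).mul
      (hs.continuous hβ)).intervalIntegrable _ _)
  · exact hs.pP.intervalIntegrable n hβ

theorem hasDerivAt_angularCoeff (hs : SmoothPeriodic h) (n : ℤ) {β : ℝ} (hβ : 0 < β) :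
    HasDerivAt (angularCoeff n h) (angularCoeff n (pB h) β) β := by
  have hI : Icc (β / 2) (2 * β) ⊆ Ioi 0 := fun t ht => lt_of_lt_of_le (by linarith) ht.1
  obtain ⟨C, hC⟩ := ((isCompact_Icc (a := β / 2) (b := 2 * β)).prod
    (isCompact_Icc (a := 0) (b := 2 * Real.pi))).exists_bound_of_continuousOn
      (hs.pB.contDiffOn.continuousOn.mono (prod_mono hI (subset_univ _)))
  refine (intervalIntegral.hasDerivAt_integral_of_dominated_loc_of_deriv_le
    (F := fun β φ => Complex.exp (-(Complex.I * n) * φ) * h β φ)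
    (F' := fun β φ => Complex.exp (-(Complex.I * n) * φ) * pB h β φ)
    (bound := fun _ => C) (Icc_mem_nhds (show β / 2 < β by linarith) (show β < 2 * β by linarith))
    ?_ (hs.intervalIntegrable n hβ) ?_ ?_ intervalIntegrable_const ?_).2
  · filter_upwards [Ioi_mem_nhds hβ] with b hb
    exact ((continuous_cexp_mul_ofReal _).mul (hs.continuous hb)).aestronglyMeasurable
  · exact ((continuous_cexp_mul_ofReal _).mul (hs.pB.continuous hβ)).aestronglyMeasurable
  · refine Eventually.of_forall fun φ hφ b hb => ?_
    rw [uIoc_of_le (by positivity)] at hφ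
    rw [norm_mul, norm_cexp_neg_I_mul, one_mul]
    exact hC (b, φ) ⟨hb, Ioc_subset_Icc_self hφ⟩
  · exact Eventually.of_forall fun φ _ b hb => (hs.hasDerivAt_pB (hI hb) φ).const_mul _

theorem norm_angularCoeff_le {M : ℝ} (hM : ∀ β φ : ℝ, 0 < β → ‖h β φ‖ ≤ M) (n : ℤ) {β : ℝ}
    (hβ : 0 < β) : ‖angularCoeff n h β‖ ≤ M * |2 * Real.pi - 0| := by
  refine intervalIntegral.norm_integral_le_of_norm_le_const fun φ _ => ?_
  rw [norm_mul, norm_cexp_neg_I_mul, one_mul]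
  exact hM β φ hβ

theorem eq_zero_of_angularCoeff_eq_zero (hs : SmoothPeriodic h) {β : ℝ} (hβ : 0 < β)
    (h0 : ∀ n, angularCoeff n h β = 0) (φ : ℝ) : h β φ = 0 := by
  have : Fact (0 < 2 * Real.pi) := ⟨by positivity⟩
  have hper : Function.Periodic (h β) (2 * Real.pi) := hs.periodic β
  let G : C(AddCircle (2 * Real.pi), ℂ) :=
    ⟨hper.lift, continuous_coinduced_dom.2 (hs.continuous hβ)⟩
  have hcoeff : fourierCoeff G = 0 := by
    funext n
    rw [fourierCoeff_eq_intervalIntegral _ n 0, zero_add]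
    have h1 := h0 n
    simp only [angularCoeff] at h1
    have h2 : ∀ x : ℝ, (fourier (-n) (x : AddCircle (2 * Real.pi)) : ℂ) • G x =
        Complex.exp (-(Complex.I * n) * x) * h β x := by
      intro x
      rw [fourier_coe_apply, smul_eq_mul]
      have hpi : (Real.pi : ℂ) ≠ 0 := by exact_mod_cast Real.pi_ne_zero
      congr 2
      push_cast
      field_simp
    simp only [h2, h1, smul_zero, Pi.zero_apply]
  have h3 := has_pointwise_sum_fourier_series_of_summable (f := G)
    (by rw [hcoeff]; exact summable_zero) (φ : AddCircle (2 * Real.pi))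
  simp only [hcoeff, Pi.zero_apply, zero_smul] at h3
  exact h3.unique hasSum_zero

theorem angularCoeff_gOf (hs : SmoothPeriodic h) (n : ℤ) {β : ℝ} (hβ : 0 < β) :
    angularCoeff n (gOf h) β = β * angularCoeff n (pB h) β + angularCoeff n h β :=
  (angularCoeff_add hs.pB.ofReal_mul hs n hβ).trans
    (congrArg (· + _) (angularCoeff_mul n (fun β => (β : ℂ)) β))

theorem angularCoeff_aop (hs : SmoothPeriodic h) (μ : ℝ) (n : ℤ) {β : ℝ} (hβ : 0 < β) :
    angularCoeff n (Aop μ h) β = β * (Complex.I * n * angularCoeff n h β -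
      angularCoeff n (pB h) β) + (2 * μ - 1) * angularCoeff n h β := by
  refine (angularCoeff_add (hs.pP.sub hs.pB).ofReal_mul
    (hs.const_mul ((2 * μ - 1 : ℝ) : ℂ)) n hβ).trans ?_
  rw [angularCoeff_mul n (fun β => (β : ℂ)), angularCoeff_mul n (fun _ => ((2 * μ - 1 : ℝ) : ℂ)),
    angularCoeff_sub hs.pP hs.pB n hβ, angularCoeff_pP hs n hβ]
  push_cast
  rfl

theorem modeSol_angularCoeff {μ : ℝ} {f : ℝ → ℝ → ℂ} (hs : SmoothPeriodic f)
    (heq : ∀ β φ : ℝ, 0 < β →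
      Aop μ (Aop μ (gOf f)) β φ + ((μ : ℂ)) ^ 2 * pP (pP (gOf f)) β φ +
        ((2 * μ - 1 : ℝ) : ℂ) * (β : ℂ) * pP f β φ = 0) (n : ℤ) :
    ModeSol n (2 * μ - 1 + μ * |(n : ℝ)|) (2 * μ - 1 - μ * |(n : ℝ)|) (2 * μ - 1)
      (fun β => Complex.exp (-(Complex.I * n) * β) * angularCoeff n f β)
      (fun β => Complex.exp (-(Complex.I * n) * β) * angularCoeff n (gOf f) β)
      (fun β => Complex.exp (-(Complex.I * n) * β) *
        (μ * |(n : ℝ)| * angularCoeff n (gOf f) β - angularCoeff n (Aop μ (gOf f)) β)) := by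
  have hg := hs.gOf
  have ha := hg.aop μ
  have hN : ((|(n : ℝ)| : ℝ) : ℂ) ^ 2 = (n : ℂ) ^ 2 := by
    have := sq_abs (n : ℝ)
    exact_mod_cast this
  have hmode : ∀ β : ℝ, 0 < β → β * (Complex.I * n * angularCoeff n (Aop μ (gOf f)) β -
      angularCoeff n (pB (Aop μ (gOf f))) β) + (2 * μ - 1) * angularCoeff n (Aop μ (gOf f)) β +
      μ ^ 2 * (Complex.I * n * (Complex.I * n * angularCoeff n (gOf f) β)) +
      (2 * μ - 1) * β * (Complex.I * n * angularCoeff n f β) = 0 := by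
    intro β hβ
    rw [← angularCoeff_aop ha μ n hβ, ← angularCoeff_pP hg n hβ, ← angularCoeff_pP hg.pP n hβ,
      ← angularCoeff_pP hs n hβ, ← angularCoeff_mul n (fun _ => (μ : ℂ) ^ 2),
      ← angularCoeff_add (ha.aop μ) (hg.pP.pP.const_mul _) n hβ, mul_assoc,
      ← angularCoeff_mul n (fun β => (β : ℂ)),
      ← angularCoeff_mul n (fun _ => (2 * (μ : ℂ) - 1)),
      ← angularCoeff_add ((ha.aop μ).add (hg.pP.pP.const_mul _))
        (hs.pP.ofReal_mul.const_mul _) n hβ]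
    refine (intervalIntegral.integral_congr fun φ _ => ?_).trans intervalIntegral.integral_zero
    have := heq β φ hβ
    push_cast at this
    rw [mul_assoc] at this
    simp only [this, mul_zero]
  refine ⟨fun β hβ => ?_, fun β hβ => ?_, fun β hβ => ?_⟩
  · have h3 : (β : ℂ) ≠ 0 := by exact_mod_cast hβ.ne'
    convert! (hasDerivAt_cexp_mul_ofReal _ β).mul (hasDerivAt_angularCoeff hs n hβ) using 1
    rw [angularCoeff_gOf hs n hβ]
    push_cast
    field_simp
    ring
  · have h3 : (β : ℂ) ≠ 0 := by exact_mod_cast hβ.ne'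
    convert! (hasDerivAt_cexp_mul_ofReal _ β).mul (hasDerivAt_angularCoeff hg n hβ) using 1
    rw [angularCoeff_aop hg μ n hβ]
    push_cast
    field_simp
    ring
  · have h3 : (β : ℂ) ≠ 0 := by exact_mod_cast hβ.ne'
    convert! (hasDerivAt_cexp_mul_ofReal _ β).mul
      (((hasDerivAt_angularCoeff hg n hβ).const_mul ((μ : ℂ) * |(n : ℝ)|)).sub
        (hasDerivAt_angularCoeff ha n hβ)) using 1
    rw [div_eq_iff h3]
    have e1 := hmode β hβ
    have e2 := angularCoeff_aop hg μ n hβ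
    simp only [Pi.sub_apply, Complex.ofReal_add, Complex.ofReal_sub, Complex.ofReal_mul,
      Complex.ofReal_ofNat, Complex.ofReal_one, Complex.ofReal_intCast]
    set E := Complex.exp (-(Complex.I * n) * β)
    set N : ℂ := ((|(n : ℝ)| : ℝ) : ℂ)
    linear_combination -E * e1 - E * μ * N * e2 +
      E * μ ^ 2 * angularCoeff n (gOf f) β * hN +
      E * μ ^ 2 * angularCoeff n (gOf f) β * n ^ 2 * Complex.I_sq

end FourierModes

/-- Uniqueness for the linearized operator: a bounded smooth solution
of `ℒf = (D_ρ+2μ−1)²g + μ²∂_φ²g + (2μ−1)β∂_φ f = 0` on `(0,∞) × 𝕋`, with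
`g = (D_β+1)f`, vanishes identically. -/
theorem stmt_10 (μ : ℝ) (hμ : 1 < μ) (f : ℝ → ℝ → ℂ)
    (hsmooth : ContDiffOn ℝ (⊤ : ℕ∞) (fun p : ℝ × ℝ => f p.1 p.2) (Ioi 0 ×ˢ univ))
    (hper : ∀ β φ : ℝ, f β (φ + 2 * Real.pi) = f β φ)
    (hbdd : ∃ M : ℝ, ∀ β φ : ℝ, 0 < β → ‖f β φ‖ ≤ M)
    (heq : ∀ β φ : ℝ, 0 < β →
      Aop μ (Aop μ (gOf f)) β φ + ((μ : ℂ)) ^ 2 * pP (pP (gOf f)) β φ +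
        ((2 * μ - 1 : ℝ) : ℂ) * (β : ℂ) * pP f β φ = 0) :
    ∀ β φ : ℝ, 0 < β → f β φ = 0 := by
  have hs : SmoothPeriodic f := ⟨hsmooth, hper⟩
  obtain ⟨M, hM⟩ := hbdd
  intro β φ hβ
  refine eq_zero_of_angularCoeff_eq_zero hs hβ (fun n => ?_) φ
  have h1 := (modeSol_angularCoeff hs heq n).eq_zero_of_bounded hμ n
    (M := M * |2 * Real.pi - 0|) (fun b hb => by
      rw [norm_mul, norm_cexp_neg_I_mul, one_mul]
      exact norm_angularCoeff_le hM n hb) hβ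
  exact (mul_eq_zero.1 h1).resolve_left (Complex.exp_ne_zero _)
end
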